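/- arXiv:2312.07444 — 6 statements merged into one kernel-verified Lean document; each statement's English description precedes it below -/
import Mathlib

section
/- For all real α > 0 and real β ≥ 1, the function t ↦ E_{α,β}(−t) is differentiable on ℝ and its derivative satisfies d/dt E_{α,β}(−t) = −(1/α) [ E_{α, β+α−1}(−t) − (β−1) E_{α, β+α}(−t) ] for every real t. -/
noncomputable def mlfR (α β : ℝ) (x : ℝ) : ℝ :=
  ∑' k : ℕ, x ^ k / Real.Gamma (α * k + β)

theorem Real.rpow_mul_Gamma_le_Gamma_add {a s : ℝ} (ha : 0 < a) (hs : 1 < s) :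
    (s - 1) ^ a * Real.Gamma s ≤ Real.Gamma (s + a) := by
  have h := Real.convexOn_log_Gamma.slope_mono_adjacent (x := s - 1) (y := s) (z := s + a)
    (Set.mem_Ioi.2 (by linarith)) (Set.mem_Ioi.2 (by linarith)) (by linarith) (by linarith)
  have hs1 : 0 < s - 1 := by linarith
  have hG : 0 < Real.Gamma s := Real.Gamma_pos_of_pos (by linarith)
  have hG' : 0 < Real.Gamma (s + a) := Real.Gamma_pos_of_pos (by linarith)
  have hrec : Real.Gamma s = (s - 1) * Real.Gamma (s - 1) := by
    simpa using Real.Gamma_add_one hs1.ne'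
  have hlog : Real.log (Real.Gamma s) = Real.log (s - 1) + Real.log (Real.Gamma (s - 1)) := by
    rw [hrec, Real.log_mul hs1.ne' (Real.Gamma_pos_of_pos hs1).ne']
  simp only [Function.comp_apply, sub_sub_cancel, div_one, add_sub_cancel_left] at h
  rw [le_div_iff₀ ha] at h
  rw [← Real.log_le_log_iff (by positivity) hG', Real.log_mul (by positivity) hG.ne',
    Real.log_rpow hs1]
  have : Real.log (Real.Gamma s) - Real.log (Real.Gamma (s - 1)) = Real.log (s - 1) := by linarith
  rw [this] at h
  linarith

open Filter in
theorem summable_pow_div_Gamma {a : ℝ} (ha : 0 < a) (b x : ℝ) :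
    Summable fun k : ℕ => x ^ k / Real.Gamma (a * k + b) := by
  have hlim : Tendsto (fun k : ℕ => a * (k : ℝ) + b - 1) atTop atTop :=
    tendsto_atTop_add_const_right _ (-1) (tendsto_atTop_add_const_right _ b
      (tendsto_natCast_atTop_atTop.const_mul_atTop ha))
  refine summable_of_ratio_norm_eventually_le (r := 1 / 2) (by norm_num) ?_
  filter_upwards [hlim.eventually_gt_atTop 0,
    ((tendsto_rpow_atTop ha).comp hlim).eventually_ge_atTop (2 * |x|)] with k hk hkx
  simp only [Function.comp_apply] at hkx
  have hG : 0 < Real.Gamma (a * k + b) := Real.Gamma_pos_of_pos (by linarith)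
  have harg : a * ((k + 1 : ℕ) : ℝ) + b = a * k + b + a := by push_cast; ring
  have hG' : 0 < Real.Gamma (a * k + b + a) := Real.Gamma_pos_of_pos (by linarith)
  have hmul := Real.rpow_mul_Gamma_le_Gamma_add ha (s := a * k + b) (by linarith)
  rw [harg, norm_div, norm_div, norm_pow, norm_pow, Real.norm_of_nonneg hG.le,
    Real.norm_of_nonneg hG'.le, Real.norm_eq_abs, ← mul_div_assoc, div_le_div_iff₀ hG' hG]
  have h2 : 2 * |x| * Real.Gamma (a * k + b) ≤ Real.Gamma (a * k + b + a) :=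
    (mul_le_mul_of_nonneg_right hkx hG.le).trans hmul
  have := mul_le_mul_of_nonneg_left h2 (pow_nonneg (abs_nonneg x) k)
  rw [pow_succ]
  linarith

theorem succ_mul_pow_div_Gamma {α β : ℝ} (hα : 0 < α) (hβ : 1 ≤ β) (x : ℝ) (k : ℕ) :
    ((k + 1 : ℕ) : ℝ) * x ^ k / Real.Gamma (α * (k + 1 : ℕ) + β)
      = 1 / α * (x ^ k / Real.Gamma (α * k + (β + α - 1))
        - (β - 1) * (x ^ k / Real.Gamma (α * k + (β + α)))) := by
  have hpos : 0 < α * k + (β + α - 1) := by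
    have : 0 ≤ α * k := by positivity
    linarith
  have hG : Real.Gamma (α * k + (β + α - 1)) ≠ 0 := (Real.Gamma_pos_of_pos hpos).ne'
  have h1 : α * ((k + 1 : ℕ) : ℝ) + β = α * k + (β + α - 1) + 1 := by push_cast; ring
  have h2 : α * (k : ℝ) + (β + α) = α * k + (β + α - 1) + 1 := by ring
  rw [h1, h2, Real.Gamma_add_one hpos.ne']
  have hne := hpos.ne'
  generalize Real.Gamma (α * k + (β + α - 1)) = G at *
  generalize hs : α * (k : ℝ) + (β + α - 1) = s at *
  field_simp
  rw [← hs]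
  push_cast
  ring

theorem hasDerivAt_mlfR {α β : ℝ} (hα : 0 < α) (hβ : 1 ≤ β) (x : ℝ) :
    HasDerivAt (mlfR α β)
      (1 / α * (mlfR α (β + α - 1) x - (β - 1) * mlfR α (β + α) x)) x := by
  have hs1 (y : ℝ) := summable_pow_div_Gamma hα (β + α - 1) y
  have hs2 (y : ℝ) := (summable_pow_div_Gamma hα (β + α) y).mul_left (β - 1)
  have hsum (y : ℝ) :
      Summable fun n : ℕ => (n : ℝ) * y ^ (n - 1) / Real.Gamma (α * n + β) := by
    rw [← summable_nat_add_iff 1]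
    simp only [Nat.add_sub_cancel, succ_mul_pow_div_Gamma hα hβ]
    exact ((hs1 y).sub (hs2 y)).mul_left _
  have hder : HasDerivAt (mlfR α β)
      (∑' n : ℕ, (n : ℝ) * x ^ (n - 1) / Real.Gamma (α * n + β)) x := by
    refine hasDerivAt_tsum_of_isPreconnected (hsum (|x| + 1)) (Metric.isOpen_ball (x := (0 : ℝ)) (ε := |x| + 1))
      (convex_ball (0 : ℝ) (|x| + 1)).isPreconnected
      (fun n y _ => (hasDerivAt_pow n y).div_const _) (fun n y hy => ?_)
      (Metric.mem_ball_self (by positivity))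
      (summable_pow_div_Gamma hα β 0) (by simp)
    have hG : 0 < Real.Gamma (α * n + β) := Real.Gamma_pos_of_pos (by positivity)
    rw [mem_ball_zero_iff] at hy
    rw [norm_div, norm_mul, norm_pow, Real.norm_of_nonneg hG.le, Real.norm_natCast]
    gcongr
  convert hder using 1
  rw [(hsum x).tsum_eq_zero_add]
  simp only [Nat.add_sub_cancel, succ_mul_pow_div_Gamma hα hβ, Nat.cast_zero, zero_mul, zero_div,
    zero_add]
  rw [tsum_mul_left, (hs1 x).tsum_sub (hs2 x), tsum_mul_left]
  rfl

theorem mlf_deriv (α β : ℝ) (hα : 0 < α) (hβ : 1 ≤ β) :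
    Differentiable ℝ (fun t : ℝ => mlfR α β (-t)) ∧
    ∀ t : ℝ, deriv (fun t : ℝ => mlfR α β (-t)) t
      = -(1 / α) * (mlfR α (β + α - 1) (-t) - (β - 1) * mlfR α (β + α) (-t)) := by
  have h (t : ℝ) := (hasDerivAt_mlfR hα hβ (-t)).comp t (hasDerivAt_neg t)
  refine ⟨fun t => (h t).differentiableAt, fun t => (h t).deriv.trans ?_⟩
  ring
end

section
/- For all real α with 1 < α < 2 and real β ≥ 1, the function t ↦ E_{α,β}(−t) tends to 0 as t → +∞. -/
open MeasureTheory Filter Topology Complex Set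

/-- The Laplace transform of `x ^ (z - 1)` on the open right half-plane. -/
theorem integral_rpow_mul_cexp_neg_mul_Ioi {z : ℝ} (hz : 0 < z) {s : ℂ} (hs : 0 < s.re) :
    ∫ x in Ioi (0 : ℝ), ((x ^ (z - 1) : ℝ) : ℂ) * cexp (-(s * x)) =
      Real.Gamma z * s ^ (-z : ℂ) := by
  set μ : Measure ℝ := (volume.restrict (Ioi 0)).withDensity
    (fun x => (Real.toNNReal (x ^ (z - 1)) : ENNReal)) with hμ
  have hmeas : Measurable fun x : ℝ => Real.toNNReal (x ^ (z - 1)) := by fun_prop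
  set L : ℂ → ℂ := fun s => ∫ x in Ioi (0 : ℝ), ((x ^ (z - 1) : ℝ) : ℂ) * cexp (-(s * x)) with hL
  have hLm : L = fun s => ProbabilityTheory.complexMGF id μ (-s) := by
    funext s
    rw [ProbabilityTheory.complexMGF, hμ, integral_withDensity_eq_integral_smul hmeas]
    refine setIntegral_congr_fun measurableSet_Ioi fun x hx => ?_
    have : 0 ≤ x ^ (z - 1) := Real.rpow_nonneg (le_of_lt hx) _
    simp [NNReal.smul_def, Real.coe_toNNReal _ this]
  have hint : Iio 0 ⊆ interior (ProbabilityTheory.integrableExpSet id μ) := by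
    refine interior_maximal (fun r hr => ?_) isOpen_Iio
    have hr : r < 0 := hr
    change Integrable _ _
    rw [hμ, integrable_withDensity_iff_integrable_smul hmeas]
    have := integrableOn_rpow_mul_exp_neg_mul_rpow (p := 1) (s := z - 1) (b := -r)
      (by linarith) one_pos (by linarith)
    refine this.congr_fun (fun x hx => ?_) measurableSet_Ioi
    have : 0 ≤ x ^ (z - 1) := Real.rpow_nonneg (le_of_lt hx) _
    simp [NNReal.smul_def, Real.coe_toNNReal _ this]
  have hLa : AnalyticOnNhd ℂ L {s | 0 < s.re} := by
    refine DifferentiableOn.analyticOnNhd (fun s hs => ?_)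
      (isOpen_lt continuous_const continuous_re)
    have h1 : (-s).re ∈ interior (ProbabilityTheory.integrableExpSet id μ) :=
      hint (by simpa using hs)
    have h2 := (ProbabilityTheory.hasDerivAt_complexMGF h1).differentiableAt
    rw [hLm]
    exact (h2.comp s differentiableAt_id.neg).differentiableWithinAt
  have hRa : AnalyticOnNhd ℂ (fun s : ℂ => Real.Gamma z * s ^ (-z : ℂ)) {s | 0 < s.re} := by
    refine DifferentiableOn.analyticOnNhd (fun s hs => ?_)
      (isOpen_lt continuous_const continuous_re)
    exact ((differentiableAt_id.cpow_const (Or.inl hs)).const_mul _).differentiableWithinAt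
  have hfreq : ∃ᶠ s in 𝓝[≠] (1 : ℂ), L s = Real.Gamma z * s ^ (-z : ℂ) := by
    have ht : Tendsto (fun r : ℝ => (r : ℂ)) (𝓝[≠] 1) (𝓝[≠] 1) := by
      refine tendsto_nhdsWithin_iff.2 ⟨?_, ?_⟩
      · exact (continuous_ofReal.tendsto' 1 1 (by simp)).mono_left nhdsWithin_le_nhds
      · filter_upwards [self_mem_nhdsWithin] with r hr
        simpa using hr
    refine ht.frequently (Eventually.frequently ?_)
    filter_upwards [nhdsWithin_le_nhds (lt_mem_nhds (zero_lt_one' ℝ))] with r hr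
    have h := Real.integral_rpow_mul_exp_neg_mul_Ioi hz hr
    have h1 : L r = ((∫ x in Ioi (0 : ℝ), x ^ (z - 1) * Real.exp (-(r * x)) : ℝ) : ℂ) := by
      rw [← integral_complex_ofReal]
      simp [hL]
    rw [h1, h, one_div, Real.inv_rpow hr.le, ← Real.rpow_neg hr.le, ofReal_mul,
      ofReal_cpow hr.le, mul_comm]
    simp
  exact hLa.eqOn_of_preconnected_of_frequently_eq hRa
    (convex_halfSpace_re_gt 0).isPreconnected (z₀ := 1) (by simp) hfreq hs

theorem inv_sq_norm_le {a : ℝ} (ha : 0 < a) {s : ℂ} (hs : a ≤ s.re) :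
    (‖s‖ ^ 2)⁻¹ ≤ (1 + (a ^ 2)⁻¹) * (1 + s.im ^ 2)⁻¹ := by
  have h0 : 0 < s.re := ha.trans_le hs
  have h1 : ‖s‖ ^ 2 = s.re ^ 2 + s.im ^ 2 := by rw [Complex.sq_norm, normSq_apply]; ring
  have h2 : a ^ 2 ≤ s.re ^ 2 := by gcongr
  rw [h1, ← one_div, ← div_eq_mul_inv, div_le_div_iff₀ (by positivity) (by positivity)]
  have h3 : (a ^ 2)⁻¹ * a ^ 2 = 1 := inv_mul_cancel₀ (by positivity)
  have h4 : (a ^ 2)⁻¹ * a ^ 2 ≤ (a ^ 2)⁻¹ * s.re ^ 2 := by gcongr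
  have h5 : 0 ≤ (a ^ 2)⁻¹ * s.im ^ 2 := by positivity
  nlinarith [sq_nonneg s.re]

theorem norm_cpow_neg_le {a z : ℝ} (ha : 0 < a) (hz : 2 ≤ z) {s : ℂ} (hs : a ≤ s.re) :
    ‖s ^ (-z : ℂ)‖ ≤ a ^ (2 - z) * ((1 + (a ^ 2)⁻¹) * (1 + s.im ^ 2)⁻¹) := by
  have h0 : a ≤ ‖s‖ := hs.trans (re_le_norm s)
  have hpos : 0 < ‖s‖ := ha.trans_le h0
  rw [← ofReal_neg, norm_cpow_real, show -z = (2 - z) + -2 by ring, Real.rpow_add hpos]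
  refine mul_le_mul (Real.rpow_le_rpow_of_nonpos ha h0 (by linarith)) ?_ (by positivity)
    (by positivity)
  rw [Real.rpow_neg hpos.le, Real.rpow_ofNat]
  exact inv_sq_norm_le ha hs

/-- Functions which are holomorphic on a right half-plane and decay quadratically on vertical
strips have the same integral over all vertical lines. -/
theorem integral_vertical_eq {F : ℂ → ℂ} (hF : DifferentiableOn ℂ F {s | 0 < s.re})
    {a b C : ℝ} (ha : 0 < a) (hab : a ≤ b)
    (hC : ∀ s : ℂ, a ≤ s.re → s.re ≤ b → ‖F s‖ ≤ C * (1 + s.im ^ 2)⁻¹) :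
    ∫ y : ℝ, F (a + y * I) = ∫ y : ℝ, F (b + y * I) := by
  have hint : ∀ c, a ≤ c → c ≤ b → Integrable fun y : ℝ => F (c + y * I) := by
    intro c hac hcb
    refine (integrable_inv_one_add_sq.const_mul C).mono' ?_ (ae_of_all _ fun y => ?_)
    · refine Continuous.aestronglyMeasurable ?_
      refine hF.continuousOn.comp_continuous (by fun_prop) fun y => ?_
      simpa using ha.trans_le hac
    · simpa using hC (c + y * I) (by simpa using hac) (by simpa using hcb)
  have hrect : ∀ T : ℝ, (∫ x : ℝ in a..b, F (x + (-T : ℝ) * I)) - (∫ x : ℝ in a..b, F (x + T * I))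
      + I * (∫ y : ℝ in -T..T, F (b + y * I)) - I * (∫ y : ℝ in -T..T, F (a + y * I)) = 0 := by
    intro T
    have := integral_boundary_rect_eq_zero_of_differentiableOn F (a + (-T : ℝ) * I) (b + T * I)
      (hF.mono fun s hs => ?_)
    · simpa using this
    · have h := hs.1
      simp only [mem_preimage, add_re, ofReal_re, mul_re, I_re, mul_zero, ofReal_im, I_im,
        mul_one, sub_self, add_zero, uIcc_of_le hab] at h
      exact ha.trans_le h.1
  have hhor : ∀ T : ℝ, ‖∫ x : ℝ in a..b, F (x + T * I)‖ ≤ C * (1 + T ^ 2)⁻¹ * |b - a| := by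
    intro T
    refine intervalIntegral.norm_integral_le_of_norm_le_const fun x hx => ?_
    rw [uIoc_of_le hab] at hx
    simpa using hC (x + T * I) (by simpa using hx.1.le) (by simpa using hx.2)
  have hlim0 : Tendsto (fun T : ℝ => C * (1 + T ^ 2)⁻¹ * |b - a|) atTop (𝓝 0) := by
    have : Tendsto (fun T : ℝ => (1 + T ^ 2)⁻¹) atTop (𝓝 0) :=
      (tendsto_atTop_add_const_left _ _ (tendsto_pow_atTop two_ne_zero)).inv_tendsto_atTop
    simpa using (this.const_mul C).mul_const |b - a|
  have hz1 := squeeze_zero_norm hhor hlim0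
  have hz2 : Tendsto (fun T : ℝ => ∫ x : ℝ in a..b, F (x + (-T : ℝ) * I)) atTop (𝓝 0) :=
    squeeze_zero_norm (fun T => by simpa only [neg_sq] using hhor (-T)) hlim0
  have hb := intervalIntegral_tendsto_integral (hint b hab le_rfl) tendsto_neg_atTop_atBot
    tendsto_id
  have ha' := intervalIntegral_tendsto_integral (hint a le_rfl hab) tendsto_neg_atTop_atBot
    tendsto_id
  have h := ((hz2.sub hz1).add (hb.const_mul I)).sub (ha'.const_mul I)
  have h0 := tendsto_nhds_unique h ((tendsto_congr hrect).2 tendsto_const_nhds)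
  have h1 : I * ((∫ y : ℝ, F (b + y * I)) - ∫ y : ℝ, F (a + y * I)) = 0 := by
    linear_combination h0
  have h2 := (mul_eq_zero.1 h1).resolve_left I_ne_zero
  exact (sub_eq_zero.1 h2).symm

theorem integrable_cpow_neg_vertical {a z : ℝ} (ha : 0 < a) (hz : 2 ≤ z) :
    Integrable fun y : ℝ => ((a : ℂ) + y * I) ^ (-z : ℂ) := by
  refine (((integrable_inv_one_add_sq.const_mul (1 + (a ^ 2)⁻¹)).const_mul
    (a ^ (2 - z)))).mono' ?_ (ae_of_all _ fun y => ?_)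
  · refine Continuous.aestronglyMeasurable (Continuous.cpow (by fun_prop) continuous_const ?_)
    intro y
    exact Or.inl (by simpa using ha)
  · simpa using norm_cpow_neg_le ha hz (s := a + y * I) (by simp)

/-- The Bromwich integral for the reciprocal of the Gamma function. -/
theorem integral_cexp_mul_cpow_neg_vertical {a z : ℝ} (ha : 0 < a) (hz : 2 ≤ z) :
    ∫ y : ℝ, cexp (a + y * I) * ((a : ℂ) + y * I) ^ (-z : ℂ) =
      2 * Real.pi * (Real.Gamma z : ℂ)⁻¹ := by
  set f : ℝ → ℂ := (Ioi (0 : ℝ)).indicator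
    fun x => ((x ^ (z - 1) : ℝ) : ℂ) * cexp (-(a * x)) with hf
  have hfi : Integrable f := by
    rw [hf, integrable_indicator_iff measurableSet_Ioi]
    have := integrableOn_rpow_mul_exp_neg_mul_rpow (p := 1) (s := z - 1) (b := a)
      (by linarith) one_pos ha
    refine (Integrable.ofReal (𝕜 := ℂ) this).congr (ae_of_all _ fun x => ?_)
    simp
  have hFf : ∀ w : ℝ, FourierTransform.fourier f w =
      Real.Gamma z * ((a : ℂ) + ((2 * Real.pi * w : ℝ) : ℂ) * I) ^ (-z : ℂ) := by
    intro w
    rw [← integral_rpow_mul_cexp_neg_mul_Ioi (by linarith) (by simpa using ha),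
      Real.fourier_real_eq_integral_exp_smul, ← integral_indicator measurableSet_Ioi]
    congr 1
    funext x
    by_cases hx : x ∈ Ioi (0 : ℝ)
    · simp only [hf, indicator_of_mem hx, smul_eq_mul]
      rw [mul_left_comm, ← Complex.exp_add]
      congr 2
      push_cast
      ring
    · simp [hf, indicator_of_notMem hx]
  have hpi : (2 * Real.pi) ≠ 0 := by positivity
  have hFi : Integrable (FourierTransform.fourier f) := by
    rw [funext hFf]
    exact ((integrable_cpow_neg_vertical ha hz).comp_mul_left' hpi).const_mul _
  have hcont : ContinuousAt f 1 := by
    have : f =ᶠ[𝓝 1] fun x => ((x ^ (z - 1) : ℝ) : ℂ) * cexp (-(a * x)) := by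
      filter_upwards [lt_mem_nhds (zero_lt_one' ℝ)] with x hx
      exact indicator_of_mem hx _
    refine ContinuousAt.congr ?_ this.symm
    refine ContinuousAt.mul ?_ (by fun_prop)
    exact continuous_ofReal.continuousAt.comp (Real.continuousAt_rpow_const _ _ (by simp))
  have hinv := hfi.fourierInv_fourier_eq hFi hcont
  rw [Real.fourierInv_eq'] at hinv
  have hG : (Real.Gamma z : ℂ) ≠ 0 := by
    exact_mod_cast (Real.Gamma_pos_of_pos (by linarith)).ne'
  set g : ℝ → ℂ := fun y => cexp (a + y * I) * ((a : ℂ) + y * I) ^ (-z : ℂ) with hg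
  have hcomp : ∫ w : ℝ, g (2 * Real.pi * w) = (Real.Gamma z : ℂ)⁻¹ := by
    have h1 : ∀ w : ℝ, g (2 * Real.pi * w) = (Real.Gamma z : ℂ)⁻¹ * cexp a *
        (cexp ((2 * Real.pi * inner ℝ w 1 : ℝ) * I) • FourierTransform.fourier f w) := by
      intro w
      rw [hFf, hg]
      simp only [smul_eq_mul, Complex.exp_add, RCLike.inner_apply, conj_trivial, one_mul]
      field_simp
    simp_rw [h1]
    rw [integral_const_mul, hinv]
    simp [hf, mul_assoc, ← Complex.exp_add]
  rw [Measure.integral_comp_mul_left] at hcomp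
  have hpi' : (Real.pi : ℂ) ≠ 0 := by exact_mod_cast Real.pi_ne_zero
  rw [← hcomp, abs_of_pos (by positivity), real_smul]
  push_cast
  field_simp

theorem mul_one_add_sq_norm_le {α : ℝ} (hα1 : 1 < α) (hα2 : α < 2) {t : ℝ} (ht : 0 ≤ t) {s : ℂ}
    (hs : 0 < s.re) :
    (1 + Real.cos (Real.pi * α / 2)) * (1 + (t * ‖s‖ ^ (-α)) ^ 2) ≤
      ‖1 + t * s ^ (-α : ℂ)‖ ^ 2 := by
  have hπ := Real.pi_pos
  set u : ℂ := s ^ (-α : ℂ) with hu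
  have hnorm : ‖u‖ = ‖s‖ ^ (-α) := by rw [hu, ← ofReal_neg, norm_cpow_real]
  have harg : |arg s| < Real.pi / 2 := abs_arg_lt_pi_div_two_iff.2 (Or.inl hs)
  have hre : ‖s‖ ^ (-α) * Real.cos (Real.pi * α / 2) ≤ u.re := by
    rw [hu, ← ofReal_neg, cpow_ofReal_re]
    refine mul_le_mul_of_nonneg_left ?_ (by positivity)
    rw [← Real.cos_abs (arg s * -α), abs_mul, abs_neg, abs_of_pos (by linarith : 0 < α)]
    refine Real.cos_le_cos_of_nonneg_of_le_pi (by positivity) (by nlinarith) (by nlinarith)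
  have hcos : Real.cos (Real.pi * α / 2) ≤ 0 :=
    Real.cos_nonpos_of_pi_div_two_le_of_le (by nlinarith) (by nlinarith)
  have hexp : ‖1 + t * u‖ ^ 2 = 1 + 2 * (t * u.re) + (t * ‖s‖ ^ (-α)) ^ 2 := by
    rw [← hnorm, mul_pow, Complex.sq_norm, Complex.sq_norm, normSq_apply, normSq_apply]
    simp
    ring
  rw [hexp]
  have := mul_le_mul_of_nonneg_left hre ht
  nlinarith [mul_nonneg (neg_nonneg.2 hcos) (sq_nonneg (1 - t * ‖s‖ ^ (-α)))]

theorem one_add_cos_pi_mul_div_two_pos {α : ℝ} (hα1 : 1 < α) (hα2 : α < 2) :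
    0 < 1 + Real.cos (Real.pi * α / 2) := by
  have hπ := Real.pi_pos
  have := Real.cos_lt_cos_of_nonneg_of_le_pi (x := Real.pi * α / 2) (y := Real.pi) (by positivity)
    le_rfl (by nlinarith)
  rw [Real.cos_pi] at this
  linarith

theorem one_add_cos_le_norm {α : ℝ} (hα1 : 1 < α) (hα2 : α < 2) {t : ℝ} (ht : 0 ≤ t) {s : ℂ}
    (hs : 0 < s.re) :
    1 + Real.cos (Real.pi * α / 2) ≤ ‖1 + t * s ^ (-α : ℂ)‖ := by
  have hπ := Real.pi_pos
  have hm := one_add_cos_pi_mul_div_two_pos hα1 hα2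
  have hcos : Real.cos (Real.pi * α / 2) ≤ 0 :=
    Real.cos_nonpos_of_pi_div_two_le_of_le (by nlinarith) (by nlinarith)
  refine abs_le_of_sq_le_sq' ?_ (norm_nonneg _) |>.2
  refine le_trans ?_ (mul_one_add_sq_norm_le hα1 hα2 ht hs)
  nlinarith [mul_nonneg hm.le (sq_nonneg (t * ‖s‖ ^ (-α)))]

/-- The integrand of the Bromwich representation of the Mittag-Leffler function. -/
noncomputable def mlfKernel (α β t : ℝ) (s : ℂ) : ℂ :=
  cexp s * s ^ (-(β + 1 : ℝ) : ℂ) *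
    ((β - α) * (1 + t * s ^ (-α : ℂ))⁻¹ + α * (1 + t * s ^ (-α : ℂ))⁻¹ ^ 2)

theorem norm_mlfKernel_le {α β : ℝ} (hα1 : 1 < α) (hα2 : α < 2) (hβ : 1 ≤ β) {a b : ℝ}
    (ha : 0 < a) :
    ∃ C : ℝ, ∀ t : ℝ, 0 ≤ t → ∀ s : ℂ, a ≤ s.re → s.re ≤ b →
      ‖mlfKernel α β t s‖ ≤ C * (1 + s.im ^ 2)⁻¹ := by
  set m := 1 + Real.cos (Real.pi * α / 2) with hm
  have hm0 : 0 < m := one_add_cos_pi_mul_div_two_pos hα1 hα2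
  refine ⟨Real.exp b * (a ^ (2 - (β + 1)) * (1 + (a ^ 2)⁻¹)) * (|β - α| * m⁻¹ + α * m⁻¹ ^ 2),
    fun t ht s has hsb => ?_⟩
  have hv : ‖(1 + t * s ^ (-α : ℂ))⁻¹‖ ≤ m⁻¹ := by
    rw [norm_inv]
    exact inv_anti₀ hm0 (one_add_cos_le_norm hα1 hα2 ht (ha.trans_le has))
  have h1 : ‖cexp s‖ ≤ Real.exp b := by
    rw [Complex.norm_exp]
    exact Real.exp_le_exp.2 hsb
  have h2 := norm_cpow_neg_le ha (z := β + 1) (by linarith) has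
  have h3 : ‖(β - α) * (1 + t * s ^ (-α : ℂ))⁻¹ + α * (1 + t * s ^ (-α : ℂ))⁻¹ ^ 2‖ ≤
      |β - α| * m⁻¹ + α * m⁻¹ ^ 2 := by
    refine (norm_add_le _ _).trans ?_
    rw [norm_mul, norm_mul, norm_pow, ← ofReal_sub, norm_real, norm_real, Real.norm_eq_abs,
      Real.norm_eq_abs, abs_of_pos (by linarith : 0 < α)]
    gcongr
  rw [mlfKernel, norm_mul, norm_mul]
  refine (mul_le_mul (mul_le_mul h1 h2 (norm_nonneg _) (by positivity)) h3 (norm_nonneg _)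
    (by positivity)).trans_eq ?_
  ring

theorem differentiableOn_mlfKernel {α β : ℝ} (hα1 : 1 < α) (hα2 : α < 2) {t : ℝ} (ht : 0 ≤ t) :
    DifferentiableOn ℂ (mlfKernel α β t) {s | 0 < s.re} := by
  intro s hs
  have hs : 0 < s.re := hs
  have h0 : 1 + t * s ^ (-α : ℂ) ≠ 0 := norm_pos_iff.1
    ((one_add_cos_pi_mul_div_two_pos hα1 hα2).trans_le (one_add_cos_le_norm hα1 hα2 ht hs))
  have hd : ∀ c : ℂ, DifferentiableAt ℂ (fun s : ℂ => s ^ c) s :=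
    fun c => differentiableAt_id.cpow_const (Or.inl hs)
  have hv : DifferentiableAt ℂ (fun s : ℂ => (1 + t * s ^ (-α : ℂ))⁻¹) s :=
    (((hd _).const_mul _).const_add _).inv h0
  exact ((differentiableAt_exp.mul (hd _)).mul
    ((hv.const_mul _).add ((hv.pow 2).const_mul _))).differentiableWithinAt

theorem hasSum_mlfKernel {α β t : ℝ} {s : ℂ} (hs : s ≠ 0) (h : ‖(t : ℂ) * s ^ (-α : ℂ)‖ < 1) :
    HasSum (fun k : ℕ => ((α * k + β) * (-t) ^ k : ℂ) *
      (cexp s * s ^ (-(α * k + β + 1 : ℝ) : ℂ))) (mlfKernel α β t s) := by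
  set w : ℂ := -(t * s ^ (-α : ℂ)) with hw
  have hw1 : ‖w‖ < 1 := by rwa [hw, norm_neg]
  have hne : 1 - w ≠ 0 := by
    intro h0
    rw [← sub_eq_zero.1 h0, norm_one] at hw1
    exact lt_irrefl _ hw1
  have hsum := (((hasSum_coe_mul_geometric_of_norm_lt_one hw1).mul_left (α : ℂ)).add
    ((hasSum_geometric_of_norm_lt_one hw1).mul_left (β : ℂ))).mul_left
    (cexp s * s ^ (-(β + 1 : ℝ) : ℂ))
  have hK : mlfKernel α β t s = cexp s * s ^ (-(β + 1 : ℝ) : ℂ) *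
      (α * (w / (1 - w) ^ 2) + β * (1 - w)⁻¹) := by
    have : 1 + t * s ^ (-α : ℂ) = 1 - w := by rw [hw]; ring
    rw [mlfKernel, this]
    congr 1
    field_simp
    ring
  rw [hK]
  refine hsum.congr_fun ?_
  intro k
  have hpow : s ^ (-(α * k + β + 1 : ℝ) : ℂ) = s ^ (-(β + 1 : ℝ) : ℂ) * (s ^ (-α : ℂ)) ^ k := by
    rw [← cpow_mul_nat, ← cpow_add _ _ hs]
    congr 1
    push_cast
    ring
  rw [hpow, hw, ← neg_mul, mul_pow]
  ring

theorem mlfR_neg_eq_integral {α β : ℝ} (hα1 : 1 < α) (hβ : 1 ≤ β) {t a : ℝ} (ht : 0 ≤ t)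
    (ha : 0 < a) (hta : t * a ^ (-α) < 1) :
    2 * Real.pi * (mlfR α β (-t) : ℂ) = ∫ y : ℝ, mlfKernel α β t (a + y * I) := by
  have hz : ∀ k : ℕ, 2 ≤ α * k + β + 1 := fun k => by
    have : 0 ≤ α * k := by positivity
    linarith
  set F : ℕ → ℝ → ℂ := fun k y => ((α * k + β) * (-t) ^ k : ℂ) *
    (cexp (a + y * I) * ((a : ℂ) + y * I) ^ (-(α * k + β + 1 : ℝ) : ℂ)) with hF
  set D := (1 + (a ^ 2)⁻¹) with hD
  set q := t * a ^ (-α) with hq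
  have hq0 : 0 ≤ q := by positivity
  have hbound : ∀ k y, ‖F k y‖ ≤ (α * k + β) * q ^ k *
      (Real.exp a * a ^ (1 - β) * D) * (1 + y ^ 2)⁻¹ := by
    intro k y
    have h1 := norm_cpow_neg_le ha (hz k) (s := a + y * I) (by simp)
    have h2 : ‖((α * k + β) * (-t) ^ k : ℂ)‖ = (α * k + β) * t ^ k := by
      rw [norm_mul, norm_pow, norm_neg, norm_real, Real.norm_of_nonneg ht]
      congr 1
      rw [show ((α : ℂ) * k + β) = ((α * k + β : ℝ) : ℂ) by push_cast; rfl, norm_real,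
        Real.norm_of_nonneg (by positivity)]
    have h3 : a ^ (2 - (α * k + β + 1)) = (a ^ (-α)) ^ k * a ^ (1 - β) := by
      rw [← Real.rpow_mul_natCast ha.le, ← Real.rpow_add ha]
      congr 1
      ring
    have h4 : ‖cexp (a + y * I)‖ = Real.exp a := by simp [Complex.norm_exp]
    rw [hF]
    simp only [norm_mul _ (cexp _ * _), norm_mul (cexp _) _]
    rw [h2, h4]
    rw [h3] at h1
    calc _ ≤ (α * k + β) * t ^ k * (Real.exp a * _) :=
          mul_le_mul_of_nonneg_left (mul_le_mul_of_nonneg_left h1 (Real.exp_pos a).le)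
            (by positivity)
      _ = _ := by
          rw [hq, mul_pow]
          simp
          ring
  have hgi := integrable_inv_one_add_sq
  have hFi : ∀ k, Integrable (F k) := by
    intro k
    refine (hgi.const_mul _).mono' ?_ (ae_of_all _ (hbound k))
    refine Continuous.aestronglyMeasurable (continuous_const.mul (Continuous.mul (by fun_prop)
      (Continuous.cpow (by fun_prop) continuous_const fun y => Or.inl (by simpa using ha))))
  have hqs : ‖q‖ < 1 := by rwa [Real.norm_of_nonneg hq0]
  have hgeo : Summable fun k : ℕ => (α * k + β) * q ^ k := by
    refine (((hasSum_coe_mul_geometric_of_norm_lt_one hqs).summable.mul_left α).add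
      ((summable_geometric_of_norm_lt_one hqs).mul_left β)).congr fun k => ?_
    ring
  have hFs : Summable fun k => ∫ y, ‖F k y‖ := by
    refine Summable.of_nonneg_of_le (fun k => integral_nonneg fun y => norm_nonneg _)
      (fun k => integral_mono (hFi k).norm (hgi.const_mul _) (hbound k)) ?_
    simp_rw [integral_const_mul]
    exact (hgeo.mul_right _).mul_right _
  have hsum := hasSum_integral_of_summable_integral_norm hFi hFs
  have hK : ∀ y : ℝ, ∑' k, F k y = mlfKernel α β t (a + y * I) := by
    intro y
    have hre : ((a : ℂ) + y * I).re = a := by simp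
    have hle : a ≤ ‖(a : ℂ) + y * I‖ := by simpa using re_le_norm ((a : ℂ) + y * I)
    refine (hasSum_mlfKernel (fun h => ?_) ?_).tsum_eq
    · rw [h] at hre
      simp at hre
      exact ha.ne hre
    · rw [norm_mul, ← ofReal_neg, norm_cpow_real, norm_real, Real.norm_of_nonneg ht]
      refine lt_of_le_of_lt (mul_le_mul_of_nonneg_left ?_ ht) hta
      exact Real.rpow_le_rpow_of_nonpos ha hle (by linarith)
  simp_rw [hK] at hsum
  rw [← hsum.tsum_eq, mlfR, ofReal_tsum, ← tsum_mul_left]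
  refine tsum_congr fun k => ?_
  have hpos : 0 < α * k + β := by positivity
  rw [hF]
  simp only
  rw [integral_const_mul, integral_cexp_mul_cpow_neg_vertical ha (hz k),
    Real.Gamma_add_one hpos.ne']
  have hG : (Real.Gamma (α * k + β) : ℂ) ≠ 0 := by
    exact_mod_cast (Real.Gamma_pos_of_pos hpos).ne'
  have hne : (α * k + β : ℂ) ≠ 0 := by exact_mod_cast hpos.ne'
  push_cast
  field_simp

theorem tendsto_mlfKernel {α β : ℝ} {s : ℂ} (hs : 0 < s.re) :
    Tendsto (fun t => mlfKernel α β t s) atTop (𝓝 0) := by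
  have hs0 : s ≠ 0 := by
    rintro rfl
    simp at hs
  have hc : 0 < ‖s ^ (-α : ℂ)‖ := norm_pos_iff.2 (by simp [cpow_eq_zero_iff, hs0])
  have hv : Tendsto (fun t : ℝ => (1 + t * s ^ (-α : ℂ))⁻¹) atTop (𝓝 0) := by
    refine tendsto_inv₀_cobounded.comp (tendsto_norm_atTop_iff_cobounded.1 ?_)
    refine tendsto_atTop_mono (f := fun t : ℝ => t * ‖s ^ (-α : ℂ)‖ - 1) (fun t => ?_)
      (tendsto_atTop_add_const_right _ _ (tendsto_id.atTop_mul_const hc))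
    have h1 := norm_sub_le (1 + (t : ℂ) * s ^ (-α : ℂ)) 1
    rw [add_sub_cancel_left, norm_mul, norm_real, norm_one] at h1
    have h2 : t * ‖s ^ (-α : ℂ)‖ ≤ ‖t‖ * ‖s ^ (-α : ℂ)‖ :=
      mul_le_mul_of_nonneg_right (le_abs_self t) hc.le
    linarith
  simpa [mlfKernel] using ((hv.const_mul ((β : ℂ) - α)).add ((hv.pow 2).const_mul (α : ℂ))).const_mul
    (cexp s * s ^ (-(β + 1 : ℝ) : ℂ))

theorem mlf_tendsto_zero (α β : ℝ) (hα1 : 1 < α) (hα2 : α < 2) (hβ : 1 ≤ β) :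
    Filter.Tendsto (fun t : ℝ => mlfR α β (-t)) Filter.atTop (nhds 0) := by
  have hrep : ∀ t : ℝ, 0 ≤ t →
      2 * Real.pi * (mlfR α β (-t) : ℂ) = ∫ y : ℝ, mlfKernel α β t ((1 : ℝ) + y * I) := by
    intro t ht
    have hlim : Tendsto (fun a : ℝ => t * a ^ (-α)) atTop (𝓝 0) := by
      simpa using (tendsto_rpow_neg_atTop (by linarith : 0 < α)).const_mul t
    obtain ⟨a, ha, ha1⟩ := ((hlim.eventually_lt_const one_pos).and (eventually_ge_atTop 1)).exists
    rw [mlfR_neg_eq_integral hα1 hβ ht (one_pos.trans_le ha1) ha]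
    obtain ⟨C, hC⟩ := norm_mlfKernel_le hα1 hα2 hβ (b := a) one_pos
    exact (integral_vertical_eq (differentiableOn_mlfKernel hα1 hα2 ht) one_pos ha1
      (hC t ht)).symm
  obtain ⟨C, hC⟩ := norm_mlfKernel_le hα1 hα2 hβ (b := 1) one_pos
  have hint : Tendsto (fun t => ∫ y : ℝ, mlfKernel α β t ((1 : ℝ) + y * I)) atTop (𝓝 0) := by
    rw [← integral_zero ℝ ℂ (μ := volume)]
    refine tendsto_integral_filter_of_dominated_convergence (fun y => C * (1 + y ^ 2)⁻¹) ?_ ?_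
      (integrable_inv_one_add_sq.const_mul C)
      (ae_of_all _ fun y => tendsto_mlfKernel (by simp))
    · filter_upwards [eventually_ge_atTop 0] with t ht
      refine Continuous.aestronglyMeasurable ?_
      exact (differentiableOn_mlfKernel hα1 hα2 ht).continuousOn.comp_continuous (by fun_prop)
        fun y => by simp
    · filter_upwards [eventually_ge_atTop 0] with t ht
      exact ae_of_all _ fun y => by
        simpa using hC t ht ((1 : ℝ) + y * I) (by simp) (by simp)
  have hC0 : Tendsto (fun t : ℝ => (mlfR α β (-t) : ℂ)) atTop (𝓝 0) := by
    have h := hint.const_mul (2 * Real.pi : ℂ)⁻¹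
    rw [mul_zero] at h
    refine h.congr' ?_
    filter_upwards [eventually_ge_atTop 0] with t ht
    have hpi : (Real.pi : ℂ) ≠ 0 := by exact_mod_cast Real.pi_ne_zero
    rw [← hrep t ht]
    field_simp
  simpa [Function.comp_def] using (continuous_re.tendsto 0).comp hC0
end

section
/- For all real α with 1 < α < 2 and real β ≥ 1, the set of nonnegative real t with E_{α,β}(−t) = 0 is finite; i.e., E_{α,β}(−t) has at most finitely many nonnegative real roots. -/
open Set Filter Topology MeasureTheory FourierTransform

theorem integrableOn_rpow_mul_exp_neg_mul {a r : ℝ} (ha : -1 < a) (hr : 0 < r) :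
    IntegrableOn (fun t : ℝ => t ^ a * Real.exp (-(r * t))) (Ioi 0) := by
  simpa using integrableOn_rpow_mul_exp_neg_mul_rpow (p := 1) ha one_pos hr

theorem norm_rpow_mul_cexp_neg_mul {a t : ℝ} (ht : 0 < t) (z : ℂ) :
    ‖((t ^ a : ℝ) : ℂ) * Complex.exp (-(z * t))‖ = t ^ a * Real.exp (-(z.re * t)) := by
  rw [norm_mul, Complex.norm_exp, Complex.norm_real, Real.norm_of_nonneg (by positivity)]
  simp

theorem measurable_rpow_mul_cexp_neg_mul (a : ℝ) (z : ℂ) :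
    Measurable (fun t : ℝ => ((t ^ a : ℝ) : ℂ) * Complex.exp (-(z * t))) := by
  fun_prop

theorem integrableOn_rpow_mul_cexp_neg_mul {a : ℝ} (ha : -1 < a) {z : ℂ} (hz : 0 < z.re) :
    IntegrableOn (fun t : ℝ => ((t ^ a : ℝ) : ℂ) * Complex.exp (-(z * t))) (Ioi 0) := by
  refine (integrableOn_rpow_mul_exp_neg_mul ha hz).mono'
    (measurable_rpow_mul_cexp_neg_mul a z).aestronglyMeasurable ?_
  filter_upwards [self_mem_ae_restrict measurableSet_Ioi] with t ht
  exact (norm_rpow_mul_cexp_neg_mul ht z).le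

theorem differentiableAt_integral_rpow_mul_cexp_neg_mul {a : ℝ} (ha : -1 < a) {z : ℂ}
    (hz : 0 < z.re) :
    DifferentiableAt ℂ
      (fun z : ℂ => ∫ t in Ioi (0 : ℝ), ((t ^ a : ℝ) : ℂ) * Complex.exp (-(z * t))) z := by
  have hs : {w : ℂ | z.re / 2 < w.re} ∈ 𝓝 z :=
    (isOpen_lt continuous_const Complex.continuous_re).mem_nhds (by simp; linarith)
  refine (hasDerivAt_integral_of_dominated_loc_of_deriv_le (μ := volume.restrict (Ioi 0))
    (F' := fun w t => -(((t ^ (a + 1) : ℝ) : ℂ) * Complex.exp (-(w * t))))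
    (bound := fun t => t ^ (a + 1) * Real.exp (-(z.re / 2 * t))) hs
    (Eventually.of_forall fun w => (measurable_rpow_mul_cexp_neg_mul a w).aestronglyMeasurable)
    (integrableOn_rpow_mul_cexp_neg_mul ha hz)
    (measurable_rpow_mul_cexp_neg_mul (a + 1) z).neg.aestronglyMeasurable ?_
    (integrableOn_rpow_mul_exp_neg_mul (by linarith) (by linarith)) ?_).2.differentiableAt
  · filter_upwards [self_mem_ae_restrict measurableSet_Ioi] with t (ht : 0 < t) w hw
    rw [norm_neg, norm_rpow_mul_cexp_neg_mul ht]
    have hw' : z.re / 2 < w.re := hw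
    gcongr
  · filter_upwards [self_mem_ae_restrict measurableSet_Ioi] with t (ht : 0 < t) w hw
    have h : HasDerivAt (fun w : ℂ => -(w * (t : ℂ))) (-(1 * (t : ℂ))) w :=
      ((hasDerivAt_id w).mul_const (t : ℂ)).neg
    convert! (h.cexp.const_mul ((t ^ a : ℝ) : ℂ)) using 1
    rw [Real.rpow_add_one ht.ne']
    push_cast
    ring

theorem integral_rpow_mul_cexp_neg_mul_Ioi_s8 {a : ℝ} (ha : 0 < a) {z : ℂ} (hz : 0 < z.re) :
    ∫ t in Ioi (0 : ℝ), ((t ^ (a - 1) : ℝ) : ℂ) * Complex.exp (-(z * t)) =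
      z ^ (-a : ℂ) * Real.Gamma a := by
  have hU : IsOpen {w : ℂ | 0 < w.re} := isOpen_lt continuous_const Complex.continuous_re
  have hconv : Convex ℝ {w : ℂ | 0 < w.re} := convex_halfSpace_re_gt 0
  refine AnalyticOnNhd.eqOn_of_preconnected_of_frequently_eq (z₀ := 1) (𝕜 := ℂ)
    (f := fun z : ℂ => ∫ t in Ioi (0 : ℝ), ((t ^ (a - 1) : ℝ) : ℂ) * Complex.exp (-(z * t)))
    (g := fun z : ℂ => z ^ (-a : ℂ) * Real.Gamma a)
    (DifferentiableOn.analyticOnNhd (fun w hw => ?_) hU)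
    (DifferentiableOn.analyticOnNhd (fun w hw => ?_) hU) hconv.isPreconnected (by simp) ?_ hz
  · exact (differentiableAt_integral_rpow_mul_cexp_neg_mul (by linarith) hw).differentiableWithinAt
  · have : w ∈ Complex.slitPlane := Or.inl hw
    refine DifferentiableAt.differentiableWithinAt ?_
    fun_prop (disch := assumption)
  · have htend : Tendsto (fun r : ℝ => (r : ℂ)) (𝓝[≠] 1) (𝓝[≠] 1) := by
      refine tendsto_nhdsWithin_of_tendsto_nhds_of_eventually_within _ ?_ ?_
      · exact (Complex.continuous_ofReal.tendsto' 1 1 (by simp)).mono_left nhdsWithin_le_nhds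
      · filter_upwards [self_mem_nhdsWithin] with r hr
        simpa using hr
    refine htend.frequently (Eventually.frequently ?_)
    filter_upwards [nhdsWithin_le_nhds (lt_mem_nhds (zero_lt_one' ℝ))] with r hr
    rw [← Complex.Gamma_ofReal, Complex.cpow_neg, ← Complex.inv_cpow _ _
      (by simp [Complex.arg_ofReal_of_nonneg hr.le, Real.pi_ne_zero.symm]), ← one_div,
      ← Complex.integral_cpow_mul_exp_neg_mul_Ioi (by simpa) hr]
    refine setIntegral_congr_fun measurableSet_Ioi fun t ht => ?_
    rw [Complex.ofReal_cpow (le_of_lt ht)]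
    push_cast
    rfl

theorem integrable_norm_add_mul_I_rpow {a c : ℝ} (ha : 1 < a) (hc : 0 < c) :
    Integrable (fun y : ℝ => ‖(c : ℂ) + y * Complex.I‖ ^ (-a)) := by
  have hm : 0 < min c 1 := lt_min hc one_pos
  have h1 : Integrable (fun y : ℝ => (min c 1 / 2) ^ (-a) * (1 + ‖y‖) ^ (-a)) :=
    (integrable_one_add_norm (by simpa using ha)).const_mul _
  refine h1.mono' (Measurable.aestronglyMeasurable (by fun_prop)) (Eventually.of_forall fun y => ?_)
  rw [Real.norm_of_nonneg (by positivity), ← Real.mul_rpow (by positivity) (by positivity)]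
  refine Real.rpow_le_rpow_of_nonpos (by positivity) ?_ (by linarith)
  have hre := Complex.abs_re_le_norm ((c : ℂ) + y * Complex.I)
  have him := Complex.abs_im_le_norm ((c : ℂ) + y * Complex.I)
  simp at hre him
  rw [Real.norm_eq_abs]
  nlinarith [min_le_left c 1, min_le_right c 1, le_abs_self c, abs_nonneg y]

theorem continuous_add_mul_I_cpow {c : ℝ} (hc : 0 < c) (a : ℂ) :
    Continuous (fun y : ℝ => ((c : ℂ) + y * Complex.I) ^ a) := by
  refine Continuous.cpow (by fun_prop) continuous_const fun y => Or.inl (by simpa)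

theorem integrable_add_mul_I_cpow {a c : ℝ} (ha : 1 < a) (hc : 0 < c) :
    Integrable (fun y : ℝ => ((c : ℂ) + y * Complex.I) ^ (-a : ℂ)) := by
  refine (integrable_norm_add_mul_I_rpow ha hc).mono'
    (continuous_add_mul_I_cpow hc _).aestronglyMeasurable (Eventually.of_forall fun y => ?_)
  rw [← Complex.norm_cpow_real, Complex.ofReal_neg]

/-- The inverse Laplace transform of `s ^ (-a)`. -/
theorem integral_cexp_mul_cpow_add_mul_I {a c x : ℝ} (ha : 1 < a) (hc : 0 < c) (hx : 0 < x) :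
    ∫ y : ℝ, Complex.exp (((c : ℂ) + y * Complex.I) * x) * ((c : ℂ) + y * Complex.I) ^ (-a : ℂ) =
      ((2 * Real.pi * (x ^ (a - 1) / Real.Gamma a) : ℝ) : ℂ) := by
  set f : ℝ → ℂ := (Ioi (0 : ℝ)).indicator
    (fun t => ((t ^ (a - 1) : ℝ) : ℂ) * Complex.exp (-((c : ℂ) * t))) with hf
  have hΓ : Real.Gamma a ≠ 0 := (Real.Gamma_pos_of_pos (by linarith)).ne'
  have hfi : Integrable f :=
    (integrable_indicator_iff measurableSet_Ioi).2
      (integrableOn_rpow_mul_cexp_neg_mul (by linarith) (by simpa))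
  have hF : 𝓕 f = fun w : ℝ =>
      ((c : ℂ) + ((2 * Real.pi * w : ℝ) : ℂ) * Complex.I) ^ (-a : ℂ) * Real.Gamma a := by
    ext w
    rw [Real.fourier_real_eq_integral_exp_smul, ← integral_rpow_mul_cexp_neg_mul_Ioi_s8 (by linarith)
      (by simpa), ← integral_indicator measurableSet_Ioi]
    congr 1 with t
    by_cases ht : t ∈ Ioi (0 : ℝ)
    · simp only [hf, indicator_of_mem ht, smul_eq_mul]
      rw [mul_left_comm, ← Complex.exp_add]
      push_cast
      ring_nf
    · simp [hf, indicator_of_notMem ht]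
  have hFi : Integrable (𝓕 f) := by
    rw [hF]
    exact ((integrable_comp_mul_left_iff
      (fun y : ℝ => ((c : ℂ) + y * Complex.I) ^ (-a : ℂ)) (by positivity)).2
      (integrable_add_mul_I_cpow ha hc)).mul_const _
  have hcont : ContinuousAt f x := by
    have : f =ᶠ[𝓝 x] fun t => ((t ^ (a - 1) : ℝ) : ℂ) * Complex.exp (-((c : ℂ) * t)) := by
      filter_upwards [lt_mem_nhds hx] with t ht
      simp [hf, indicator_of_mem (show t ∈ Ioi (0 : ℝ) from ht)]
    refine ContinuousAt.congr ?_ this.symm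
    have h1 : ContinuousAt (fun t : ℝ => t ^ (a - 1)) x :=
      Real.continuousAt_rpow_const _ _ (Or.inl hx.ne')
    fun_prop
  have key := hfi.fourierInv_fourier_eq hFi hcont
  rw [Real.fourierInv_eq', hF] at key
  have hsub := Measure.integral_comp_mul_left (fun y : ℝ =>
    Complex.exp (((c : ℂ) + y * Complex.I) * x) * ((c : ℂ) + y * Complex.I) ^ (-a : ℂ))
    (2 * Real.pi)
  have hconv : (∫ w : ℝ, Complex.exp (((c : ℂ) + ((2 * Real.pi * w : ℝ) : ℂ) * Complex.I) * x) *
      ((c : ℂ) + ((2 * Real.pi * w : ℝ) : ℂ) * Complex.I) ^ (-a : ℂ)) =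
      Complex.exp (c * x) / Real.Gamma a * f x := by
    rw [← key, ← integral_const_mul]
    congr 1 with w
    have hΓ' : (Real.Gamma a : ℂ) ≠ 0 := by exact_mod_cast hΓ
    simp only [smul_eq_mul, RCLike.inner_apply, conj_trivial]
    rw [add_mul, Complex.exp_add]
    field_simp
    push_cast
    ring_nf
  rw [hconv, abs_of_pos (by positivity)] at hsub
  have hfx : f x = ((x ^ (a - 1) : ℝ) : ℂ) * Complex.exp (-((c : ℂ) * x)) := by
    simp [hf, indicator_of_mem (show x ∈ Ioi (0 : ℝ) from hx)]
  rw [hfx, Complex.real_smul] at hsub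
  have he : Complex.exp (c * x) * Complex.exp (-((c : ℂ) * x)) = 1 := by
    rw [← Complex.exp_add]; simp
  have : ((2 * Real.pi : ℝ) : ℂ) * ((((2 * Real.pi)⁻¹ : ℝ) : ℂ) * ∫ y : ℝ,
      Complex.exp (((c : ℂ) + y * Complex.I) * x) * ((c : ℂ) + y * Complex.I) ^ (-a : ℂ)) =
      ∫ y : ℝ,
        Complex.exp (((c : ℂ) + y * Complex.I) * x) * ((c : ℂ) + y * Complex.I) ^ (-a : ℂ) := by
    rw [← mul_assoc, ← Complex.ofReal_mul, mul_inv_cancel₀ (by positivity), Complex.ofReal_one,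
      one_mul]
  rw [← this, ← hsub]
  push_cast
  linear_combination (2 * Real.pi * ((x ^ (a - 1) : ℝ) : ℂ) / Real.Gamma a) * he

theorem exists_mul_one_add_norm_rpow_le_norm_one_add_cpow {α : ℝ} (h0 : 0 < α) (h2 : α < 2) :
    ∃ κ : ℝ, 0 < κ ∧ ∀ s : ℂ, 0 < s.re → κ * (1 + ‖s‖ ^ (-α)) ≤ ‖1 + s ^ (-α : ℂ)‖ := by
  have hpi := Real.pi_pos
  have hcos : -1 < Real.cos (α * (Real.pi / 2)) := by
    rw [← Real.cos_pi]
    exact Real.cos_lt_cos_of_nonneg_of_le_pi (by positivity) le_rfl (by nlinarith)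
  refine ⟨Real.sqrt ((1 + Real.cos (α * (Real.pi / 2))) / 2), Real.sqrt_pos.2 (by linarith),
    fun s hs => ?_⟩
  have hs0 : s ≠ 0 := by rintro rfl; simp at hs
  have hr : 0 < ‖s‖ ^ (-α) := Real.rpow_pos_of_pos (norm_pos_iff.2 hs0) _
  have hnorm : ‖s ^ (-α : ℂ)‖ = ‖s‖ ^ (-α) := by
    rw [← Complex.norm_cpow_real, Complex.ofReal_neg]
  have hre : (s ^ (-α : ℂ)).re = ‖s‖ ^ (-α) * Real.cos (α * s.arg) := by
    rw [Complex.cpow_def_of_ne_zero hs0, Complex.exp_re, Real.rpow_def_of_pos (norm_pos_iff.2 hs0)]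
    simp [Complex.log_re, Complex.log_im, mul_comm]
  have harg : |s.arg| < Real.pi / 2 := Complex.abs_arg_lt_pi_div_two_iff.2 (Or.inl hs)
  have hcos' : Real.cos (α * (Real.pi / 2)) ≤ Real.cos (α * s.arg) := by
    rw [← Real.cos_abs (α * s.arg), abs_mul, abs_of_pos h0]
    exact Real.cos_le_cos_of_nonneg_of_le_pi (by positivity) (by nlinarith) (by gcongr)
  refine le_of_sq_le_sq ?_ (norm_nonneg _)
  have hsq : ‖1 + s ^ (-α : ℂ)‖ ^ 2 =
      1 + 2 * (‖s‖ ^ (-α) * Real.cos (α * s.arg)) + (‖s‖ ^ (-α)) ^ 2 := by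
    rw [← hre, ← hnorm, ← Complex.normSq_eq_norm_sq, ← Complex.normSq_eq_norm_sq,
      Complex.normSq_apply, Complex.normSq_apply]
    simp
    ring
  rw [hsq, mul_pow, Real.sq_sqrt (by linarith)]
  set r := ‖s‖ ^ (-α)
  have h1 := mul_le_mul_of_nonneg_left hcos' hr.le
  have h3 : Real.cos (α * (Real.pi / 2)) ≤ 1 := Real.cos_le_one _
  nlinarith [mul_nonneg (sub_nonneg.2 h3) (sq_nonneg (1 - r))]

/-- The Laplace transform of the Prabhakar function
`∑ (-1) ^ k * (k + m - 1).choose (m - 1) * x ^ (α * k + δ - 1) / Γ (α * k + δ)`. -/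
noncomputable def prabhakarLaplace (α δ : ℝ) (m : ℕ) (s : ℂ) : ℂ :=
  s ^ (-δ : ℂ) * ((1 + s ^ (-α : ℂ)) ^ m)⁻¹

theorem exists_norm_prabhakarLaplace_le {α : ℝ} (h0 : 0 < α) (h2 : α < 2) (δ : ℝ) (j : ℕ) :
    ∃ C : ℝ, 0 ≤ C ∧ ∀ η : ℝ, δ - α ≤ η → η ≤ δ → ∀ s : ℂ, 0 < s.re →
      ‖prabhakarLaplace α δ (j + 1) s‖ ≤ C * ‖s‖ ^ (-η) := by
  obtain ⟨κ, hκ, H⟩ := exists_mul_one_add_norm_rpow_le_norm_one_add_cpow h0 h2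
  refine ⟨(κ ^ (j + 1))⁻¹, by positivity, fun η hη1 hη2 s hs => ?_⟩
  have hs0 : 0 < ‖s‖ := norm_pos_iff.2 (by rintro rfl; simp at hs)
  have hr : 0 < ‖s‖ ^ (-α) := Real.rpow_pos_of_pos hs0 _
  have hle : ‖s‖ ^ (η - δ) ≤ 1 + ‖s‖ ^ (-α) := by
    rcases le_total 1 ‖s‖ with h | h
    · linarith [Real.rpow_le_one_of_one_le_of_nonpos h (show η - δ ≤ 0 by linarith)]
    · linarith [Real.rpow_le_rpow_of_exponent_ge hs0 h (show -α ≤ η - δ by linarith)]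
  have hpow : 1 + ‖s‖ ^ (-α) ≤ (1 + ‖s‖ ^ (-α)) ^ (j + 1) :=
    le_self_pow₀ (by linarith) (by simp)
  have hden : κ ^ (j + 1) * ‖s‖ ^ (η - δ) ≤ ‖1 + s ^ (-α : ℂ)‖ ^ (j + 1) := by
    calc κ ^ (j + 1) * ‖s‖ ^ (η - δ) ≤ κ ^ (j + 1) * (1 + ‖s‖ ^ (-α)) ^ (j + 1) := by
          gcongr; exact hle.trans hpow
      _ = (κ * (1 + ‖s‖ ^ (-α))) ^ (j + 1) := (mul_pow _ _ _).symm
      _ ≤ _ := by gcongr; exact H s hs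
  have hδ : ‖s ^ (-δ : ℂ)‖ = ‖s‖ ^ (-δ) := by
    rw [← Complex.norm_cpow_real, Complex.ofReal_neg]
  rw [prabhakarLaplace, norm_mul, norm_inv, norm_pow, hδ]
  calc ‖s‖ ^ (-δ) * (‖1 + s ^ (-α : ℂ)‖ ^ (j + 1))⁻¹
      ≤ ‖s‖ ^ (-δ) * (κ ^ (j + 1) * ‖s‖ ^ (η - δ))⁻¹ := by gcongr
    _ = (κ ^ (j + 1))⁻¹ * (‖s‖ ^ (-δ) * (‖s‖ ^ (η - δ))⁻¹) := by rw [mul_inv]; ring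
    _ = (κ ^ (j + 1))⁻¹ * ‖s‖ ^ (-η) := by
        rw [← Real.rpow_neg hs0.le, ← Real.rpow_add hs0]
        ring_nf

theorem differentiableAt_prabhakarLaplace {α : ℝ} (h0 : 0 < α) (h2 : α < 2) (δ : ℝ) (m : ℕ)
    {s : ℂ} (hs : 0 < s.re) : DifferentiableAt ℂ (prabhakarLaplace α δ m) s := by
  obtain ⟨κ, hκ, H⟩ := exists_mul_one_add_norm_rpow_le_norm_one_add_cpow h0 h2
  have hs0 : s ≠ 0 := by rintro rfl; simp at hs
  have hslit : s ∈ Complex.slitPlane := Or.inl hs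
  have hne : 1 + s ^ (-α : ℂ) ≠ 0 := by
    rw [← norm_pos_iff]
    exact lt_of_lt_of_le (by positivity) (H s hs)
  unfold prabhakarLaplace
  have := pow_ne_zero m hne
  fun_prop (disch := assumption)

/-- Integrals over vertical lines in the right half plane agree, for a holomorphic function that
decays sufficiently fast. -/
theorem integral_vertical_line_eq {g : ℂ → ℂ} {δ K b c : ℝ} (hδ : 1 < δ) (hb : 0 < b) (hbc : b ≤ c)
    (hg : DifferentiableOn ℂ g {z | 0 < z.re})
    (hK : ∀ z : ℂ, 0 < z.re → z.re ≤ c → ‖g z‖ ≤ K * ‖z‖ ^ (-δ)) :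
    ∫ y : ℝ, g (b + y * Complex.I) = ∫ y : ℝ, g (c + y * Complex.I) := by
  have hint : ∀ a : ℝ, 0 < a → a ≤ c → Integrable (fun y : ℝ => g (a + y * Complex.I)) := by
    intro a ha hac
    refine ((integrable_norm_add_mul_I_rpow hδ ha).const_mul K).mono'
      (Continuous.aestronglyMeasurable ?_) (Eventually.of_forall fun y => hK _ (by simpa) (by simpa))
    exact hg.continuousOn.comp_continuous (by fun_prop) (fun y => by simpa)
  have hvert : ∀ a : ℝ, 0 < a → a ≤ c → Tendsto (fun T : ℝ => ∫ y in (-T)..T,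
      g (a + y * Complex.I)) atTop (𝓝 (∫ y : ℝ, g (a + y * Complex.I))) := fun a ha hac =>
    intervalIntegral_tendsto_integral (hint a ha hac) tendsto_neg_atTop_atBot tendsto_id
  have hbound : ∀ T u : ℝ, 0 < T → |u| = T →
      ‖∫ x in b..c, g (x + u * Complex.I)‖ ≤ |K| * T ^ (-δ) * |c - b| := by
    intro T u hT hu
    refine intervalIntegral.norm_integral_le_of_norm_le_const fun x hx => ?_
    rw [uIoc_of_le hbc] at hx
    have hx0 : 0 < x := hb.trans hx.1
    refine (hK _ (by simpa) (by simpa using hx.2)).trans ?_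
    have him := Complex.abs_im_le_norm ((x : ℂ) + u * Complex.I)
    simp only [Complex.add_im, Complex.ofReal_im, Complex.mul_im, Complex.ofReal_re, Complex.I_im,
      Complex.I_re, mul_one, mul_zero, zero_add, add_zero, hu] at him
    exact mul_le_mul (le_abs_self K) (Real.rpow_le_rpow_of_nonpos hT him (by linarith))
      (by positivity) (abs_nonneg K)
  have hlim : Tendsto (fun T : ℝ => |K| * T ^ (-δ) * |c - b|) atTop (𝓝 0) := by
    simpa using ((tendsto_rpow_neg_atTop (show 0 < δ by linarith)).const_mul |K|).mul_const |c - b|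
  have hhor : ∀ σ : ℝ, |σ| = 1 →
      Tendsto (fun T : ℝ => ∫ x in b..c, g (x + (σ * T : ℝ) * Complex.I)) atTop (𝓝 0) := by
    intro σ hσ
    refine squeeze_zero_norm' ?_ hlim
    filter_upwards [eventually_gt_atTop 0] with T hT
    exact hbound T _ hT (by rw [abs_mul, hσ, one_mul, abs_of_pos hT])
  have hrect : ∀ T : ℝ, (∫ x in b..c, g (x + (-1 * T : ℝ) * Complex.I)) -
      (∫ x in b..c, g (x + (1 * T : ℝ) * Complex.I)) +
      Complex.I * (∫ y in (-T)..T, g (c + y * Complex.I)) -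
      Complex.I * (∫ y in (-T)..T, g (b + y * Complex.I)) = 0 := by
    intro T
    have := Complex.integral_boundary_rect_eq_zero_of_differentiableOn g ⟨b, -T⟩ ⟨c, T⟩
      (hg.mono fun z hz => ?_)
    · simpa using this
    · have := hz.1
      simp only [mem_preimage, uIcc_of_le hbc] at this
      exact hb.trans_le this.1
  have hL := (((hhor (-1) (by simp)).sub (hhor 1 (by simp))).add
    ((hvert c (hb.trans_le hbc) le_rfl).const_mul Complex.I)).sub
    ((hvert b hb hbc).const_mul Complex.I)
  have h := tendsto_nhds_unique hL (tendsto_const_nhds.congr fun T => (hrect T).symm)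
  have h' : Complex.I * ((∫ y : ℝ, g (c + y * Complex.I)) - ∫ y : ℝ, g (b + y * Complex.I)) = 0 := by
    rw [← h]; ring
  exact (sub_eq_zero.1 ((mul_eq_zero.1 h').resolve_left Complex.I_ne_zero)).symm

theorem hasSum_prabhakarLaplace {α : ℝ} (h0 : 0 < α) (δ : ℝ) (j : ℕ) {s : ℂ}
    (hs : 0 < s.re) (hs1 : 1 < ‖s‖) :
    HasSum (fun k : ℕ => ((-1) ^ k * ((k + j).choose j : ℂ)) * s ^ (-(α * k + δ : ℝ) : ℂ))
      (prabhakarLaplace α δ (j + 1) s) := by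
  have hs0 : s ≠ 0 := by rintro rfl; simp at hs
  have hr : ‖-(s ^ (-α : ℂ))‖ < 1 := by
    rw [norm_neg, ← Complex.ofReal_neg, Complex.norm_cpow_real]
    exact Real.rpow_lt_one_of_one_lt_of_neg hs1 (by linarith)
  have h := (hasSum_choose_mul_geometric_of_norm_lt_one j hr).mul_left (s ^ (-δ : ℂ))
  rw [prabhakarLaplace]
  convert! h using 1
  · ext k
    rw [neg_pow (s ^ (-α : ℂ)), ← Complex.cpow_nat_mul]
    have : (-(α * k + δ : ℝ) : ℂ) = -δ + k * (-α) := by push_cast; ring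
    rw [this, Complex.cpow_add _ _ hs0]
    ring
  · rw [sub_neg_eq_add, one_div]

theorem norm_cexp_mul_real (z : ℂ) (x : ℝ) : ‖Complex.exp (z * x)‖ = Real.exp (z.re * x) := by
  rw [Complex.norm_exp]; simp

/-- The term of index `k` of the series defining the function with Laplace transform
`prabhakarLaplace α δ (j + 1)`, with general coefficients. -/
noncomputable def mlfTerm (α δ : ℝ) (a : ℕ → ℝ) (x : ℝ) (k : ℕ) : ℝ :=
  (-1) ^ k * a k * (x ^ (α * k + δ - 1) / Real.Gamma (α * k + δ))

theorem hasSum_mlfTerm_choose {α δ x : ℝ} (h0 : 0 < α) (hδ : 1 < δ) (hx : 0 < x) (j : ℕ) :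
    HasSum (fun k : ℕ => ((2 * Real.pi * mlfTerm α δ (fun k => ((k + j).choose j : ℝ)) x k : ℝ) : ℂ))
      (∫ y : ℝ, Complex.exp ((((2 : ℝ) : ℂ) + y * Complex.I) * x) *
        prabhakarLaplace α δ (j + 1) (((2 : ℝ) : ℂ) + y * Complex.I)) := by
  set L : ℝ → ℂ := fun y => ((2 : ℝ) : ℂ) + y * Complex.I with hL
  have hLre : ∀ y, (L y).re = 2 := fun y => by simp [hL]
  have hL2 : ∀ y, 2 ≤ ‖L y‖ := fun y => by
    have := Complex.abs_re_le_norm (L y)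
    rwa [hLre, abs_of_pos two_pos] at this
  set F : ℕ → ℝ → ℂ := fun k y => Complex.exp (L y * x) *
    (((-1) ^ k * ((k + j).choose j : ℂ)) * (L y) ^ (-(α * k + δ : ℝ) : ℂ)) with hF
  have hδk : ∀ k : ℕ, 1 < α * k + δ := fun k => by
    have : 0 ≤ α * k := by positivity
    linarith
  have hnorm : ∀ k y, ‖F k y‖ = Real.exp (2 * x) * ((k + j).choose j *
      ‖L y‖ ^ (-(α * k + δ))) := by
    intro k y
    rw [hF]
    simp only [norm_mul, norm_cexp_mul_real, hLre, norm_pow, norm_neg, norm_one, one_pow, one_mul,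
      ← Complex.ofReal_neg, Complex.norm_cpow_real, Complex.norm_natCast]
  have hFi : ∀ k, Integrable (F k) := by
    intro k
    have hi := ((integrable_norm_add_mul_I_rpow (hδk k) two_pos).const_mul
      ((k + j).choose j : ℝ)).const_mul (Real.exp (2 * x))
    refine hi.mono' (Continuous.aestronglyMeasurable ?_)
      (Eventually.of_forall fun y => (hnorm k y).le)
    have := continuous_add_mul_I_cpow two_pos (-(α * k + δ : ℝ) : ℂ)
    simp only [hF, hL]
    fun_prop
  have hsum : Summable fun k => ∫ y, ‖F k y‖ := by
    have hr : ‖(2 : ℝ) ^ (-α)‖ < 1 := by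
      rw [Real.norm_of_nonneg (by positivity)]
      exact Real.rpow_lt_one_of_one_lt_of_neg one_lt_two (by linarith)
    have hI := integrable_norm_add_mul_I_rpow hδ two_pos
    refine Summable.of_nonneg_of_le (fun k => integral_nonneg fun y => norm_nonneg _) (fun k => ?_)
      (((summable_choose_mul_geometric_of_norm_lt_one j hr).mul_left (Real.exp (2 * x))).mul_right
        (∫ y : ℝ, ‖((2 : ℝ) : ℂ) + y * Complex.I‖ ^ (-δ)))
    rw [← integral_const_mul]
    refine integral_mono (hFi k).norm (hI.const_mul _) fun y => ?_
    simp only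
    rw [hnorm, mul_assoc, mul_assoc]
    have hp : 0 < ‖L y‖ := two_pos.trans_le (hL2 y)
    gcongr
    rw [neg_add, Real.rpow_add hp, ← Real.rpow_natCast, ← Real.rpow_mul two_pos.le, neg_mul]
    refine mul_le_mul_of_nonneg_right ?_ (by positivity)
    exact Real.rpow_le_rpow_of_nonpos two_pos (hL2 y) (by simp; positivity)
  have h := hasSum_integral_of_summable_integral_norm hFi hsum
  convert! h using 1
  · ext k
    have := integral_cexp_mul_cpow_add_mul_I (hδk k) two_pos hx
    simp only [hF, hL, mul_left_comm (Complex.exp _)]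
    rw [integral_const_mul, this, mlfTerm]
    push_cast
    ring
  · congr 1 with y
    exact ((hasSum_prabhakarLaplace h0 δ j (by rw [hLre]; exact two_pos)
      (one_lt_two.trans_le (hL2 y))).mul_left _).tsum_eq.symm

theorem summable_mlfTerm_choose {α δ x : ℝ} (h0 : 0 < α) (hδ : 1 < δ) (hx : 0 < x) (j : ℕ) :
    Summable (mlfTerm α δ (fun k => ((k + j).choose j : ℝ)) x) := by
  have h := Complex.hasSum_re (hasSum_mlfTerm_choose h0 hδ hx j)
  simp only [Complex.ofReal_re] at h
  exact (summable_mul_left_iff (by positivity)).1 h.summable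

theorem integrable_min_abs_rpow {η δ : ℝ} (hη : η < 1) (hδ : 1 < δ) :
    Integrable (fun y : ℝ => min (|y| ^ (-η)) (|y| ^ (-δ))) := by
  have hm : ∀ s : Set ℝ, AEStronglyMeasurable (fun y : ℝ => min (|y| ^ (-η)) (|y| ^ (-δ)))
      (volume.restrict s) := fun s => Measurable.aestronglyMeasurable (by fun_prop)
  have hnn : ∀ y : ℝ, ‖min (|y| ^ (-η)) (|y| ^ (-δ))‖ = min (|y| ^ (-η)) (|y| ^ (-δ)) :=
    fun y => Real.norm_of_nonneg (by positivity)
  have hpos : IntegrableOn (fun y : ℝ => min (|y| ^ (-η)) (|y| ^ (-δ))) (Ioi 0) := by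
    rw [← Ioc_union_Ioi_eq_Ioi zero_le_one]
    refine IntegrableOn.union ?_ ?_
    · have := (intervalIntegrable_iff_integrableOn_Ioc_of_le zero_le_one).1
        (intervalIntegral.intervalIntegrable_rpow' (a := 0) (b := 1) (show -1 < -η by linarith))
      refine this.mono' (hm _) ?_
      filter_upwards [self_mem_ae_restrict measurableSet_Ioc] with y hy
      rw [hnn, abs_of_pos hy.1]
      exact min_le_left _ _
    · refine (integrableOn_Ioi_rpow_of_lt (show -δ < -1 by linarith) one_pos).mono' (hm _) ?_
      filter_upwards [self_mem_ae_restrict measurableSet_Ioi] with y hy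
      rw [hnn, abs_of_pos (one_pos.trans hy)]
      exact min_le_right _ _
  have hneg : IntegrableOn (fun y : ℝ => min (|y| ^ (-η)) (|y| ^ (-δ))) (Iio 0) := by
    have h := (Measure.measurePreserving_neg (volume : Measure ℝ)).integrableOn_comp_preimage
      (Homeomorph.neg ℝ).measurableEmbedding
      (f := fun y : ℝ => min (|y| ^ (-η)) (|y| ^ (-δ))) (s := Ioi 0)
    have h2 := h.2 hpos
    simpa [Function.comp_def] using h2
  rw [← integrableOn_univ, ← Iic_union_Ioi (a := (0 : ℝ))]
  exact ((integrableOn_Iic_iff_integrableOn_Iio (by simp)).2 hneg).union hpos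

theorem exists_abs_tsum_mlfTerm_choose_le {α δ : ℝ} (h0 : 0 < α) (h2 : α < 2) (hδ : 1 < δ)
    (hδα : δ < 1 + α) (j : ℕ) :
    ∃ B : ℝ, ∀ x : ℝ, 0 < x → |∑' k, mlfTerm α δ (fun k => ((k + j).choose j : ℝ)) x k| ≤ B := by
  obtain ⟨C, hC0, hC⟩ := exists_norm_prabhakarLaplace_le h0 h2 δ j
  set η := max (δ - α) 0 with hη
  have hη0 : 0 ≤ η := le_max_right _ _
  have hη1 : η < 1 := max_lt (by linarith) one_pos
  have hint := integrable_min_abs_rpow hη1 hδ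
  refine ⟨(2 * Real.pi)⁻¹ * (Real.exp 1 * C * ∫ y : ℝ, min (|y| ^ (-η)) (|y| ^ (-δ))),
    fun x hx => ?_⟩
  set g : ℂ → ℂ := fun s => Complex.exp (s * x) * prabhakarLaplace α δ (j + 1) s with hg
  have hgd : DifferentiableOn ℂ g {z | 0 < z.re} := fun s hs => by
    have := differentiableAt_prabhakarLaplace h0 h2 δ (j + 1) hs
    refine DifferentiableAt.differentiableWithinAt ?_
    fun_prop
  set b := min x⁻¹ 2 with hb
  have hb0 : 0 < b := lt_min (by positivity) two_pos
  have hline := integral_vertical_line_eq (g := g) (K := Real.exp (2 * x) * C) hδ hb0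
    (min_le_right _ _) hgd (fun z hz hz2 => by
      rw [hg, norm_mul, norm_cexp_mul_real, mul_assoc]
      gcongr
      exact hC δ (by linarith) le_rfl z hz)
  have hsum := (hasSum_mlfTerm_choose h0 hδ hx j).tsum_eq
  rw [← hline, ← Complex.ofReal_tsum, tsum_mul_left] at hsum
  have hle : ‖∫ y : ℝ, g (b + y * Complex.I)‖ ≤
      Real.exp 1 * C * ∫ y : ℝ, min (|y| ^ (-η)) (|y| ^ (-δ)) := by
    rw [← integral_const_mul]
    refine norm_integral_le_of_norm_le (hint.const_mul _) ?_
    have hne : ∀ᵐ y : ℝ, y ≠ 0 := by simp [ae_iff, measure_singleton]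
    filter_upwards [hne] with y hy
    have hz : 0 < ((b : ℂ) + y * Complex.I).re := by simpa
    have him : |y| ≤ ‖(b : ℂ) + y * Complex.I‖ := by
      simpa using Complex.abs_im_le_norm ((b : ℂ) + y * Complex.I)
    have hy' : 0 < |y| := abs_pos.2 hy
    rw [hg, norm_mul, norm_cexp_mul_real, mul_assoc]
    have hbx : b * x ≤ 1 := by
      calc b * x ≤ x⁻¹ * x := by gcongr; exact min_le_left _ _
        _ = 1 := inv_mul_cancel₀ hx.ne'
    have hexp : ∀ e : ℝ, δ - α ≤ e → 0 ≤ e → e ≤ δ →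
        ‖prabhakarLaplace α δ (j + 1) ((b : ℂ) + y * Complex.I)‖ ≤ C * |y| ^ (-e) :=
      fun e he1 he0 he2 => (hC e he1 he2 _ hz).trans (mul_le_mul_of_nonneg_left
        (Real.rpow_le_rpow_of_nonpos hy' him (by linarith)) hC0)
    gcongr
    · simpa using hbx
    · rw [mul_min_of_nonneg _ _ hC0]
      exact le_min (hexp η (le_max_left _ _) hη0 (hη1.le.trans hδ.le))
        (hexp δ (by linarith) (by linarith) le_rfl)
  rw [← hsum, Complex.norm_real, Real.norm_eq_abs, abs_mul, abs_of_pos (by positivity)] at hle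
  rwa [inv_mul_eq_div, le_div_iff₀' (by positivity)]

/-- The polynomial sequences, presented as the span of the sequences of binomial coefficients. -/
def chooseSpan : Submodule ℝ (ℕ → ℝ) :=
  Submodule.span ℝ (range fun j k : ℕ => ((k + j).choose j : ℝ))

theorem choose_mem_chooseSpan (j : ℕ) : (fun k : ℕ => ((k + j).choose j : ℝ)) ∈ chooseSpan :=
  Submodule.subset_span ⟨j, rfl⟩

theorem one_mem_chooseSpan : (fun _ => 1 : ℕ → ℝ) ∈ chooseSpan := by
  simpa using choose_mem_chooseSpan 0

theorem natCast_mul_mem_chooseSpan {a : ℕ → ℝ} (ha : a ∈ chooseSpan) :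
    (fun k : ℕ => (k : ℝ) * a k) ∈ chooseSpan := by
  induction ha using Submodule.span_induction with
  | mem a h =>
    obtain ⟨j, rfl⟩ := h
    have h := chooseSpan.sub_mem
      (chooseSpan.smul_mem ((j : ℝ) + 1) (choose_mem_chooseSpan (j + 1)))
      (chooseSpan.smul_mem ((j : ℝ) + 1) (choose_mem_chooseSpan j))
    convert! h using 1
    ext k
    have := Nat.add_one_mul_choose_eq (k + j) j
    have h' : ((k : ℝ) + j + 1) * ((k + j).choose j : ℝ) =
        ((k + (j + 1)).choose (j + 1) : ℝ) * (j + 1) := by exact_mod_cast this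
    simp only [Pi.sub_apply, Pi.smul_apply, smul_eq_mul]
    linear_combination h'
  | zero => simp only [Pi.zero_apply, mul_zero]; exact chooseSpan.zero_mem
  | add a b _ _ iha ihb =>
    convert! chooseSpan.add_mem iha ihb using 1
    ext k; simp [mul_add]
  | smul c a _ ih =>
    convert! chooseSpan.smul_mem c ih using 1
    ext k; simp [mul_left_comm]

theorem affine_mul_mem_chooseSpan (p q : ℝ) {a : ℕ → ℝ} (ha : a ∈ chooseSpan) :
    (fun k : ℕ => (p * k + q) * a k) ∈ chooseSpan := by
  convert! chooseSpan.add_mem (chooseSpan.smul_mem p (natCast_mul_mem_chooseSpan ha))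
    (chooseSpan.smul_mem q ha) using 1
  ext k
  simp
  ring

theorem mlfTerm_add (α δ : ℝ) (a b : ℕ → ℝ) (x : ℝ) :
    mlfTerm α δ (a + b) x = mlfTerm α δ a x + mlfTerm α δ b x := by
  ext k; simp [mlfTerm]; ring

theorem mlfTerm_smul (α δ c : ℝ) (a : ℕ → ℝ) (x : ℝ) :
    mlfTerm α δ (c • a) x = c • mlfTerm α δ a x := by
  ext k; simp [mlfTerm]; ring

theorem mlfTerm_zero (α δ x : ℝ) : mlfTerm α δ 0 x = 0 := by
  ext k; simp [mlfTerm]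

theorem summable_mlfTerm {α δ x : ℝ} (h0 : 0 < α) (hδ : 1 < δ) (hx : 0 < x) {a : ℕ → ℝ}
    (ha : a ∈ chooseSpan) : Summable (mlfTerm α δ a x) := by
  induction ha using Submodule.span_induction with
  | mem a h =>
    obtain ⟨j, rfl⟩ := h
    exact summable_mlfTerm_choose h0 hδ hx j
  | zero => rw [mlfTerm_zero]; exact summable_zero
  | add a b _ _ iha ihb => rw [mlfTerm_add]; exact iha.add ihb
  | smul c a _ ih => rw [mlfTerm_smul]; exact ih.const_smul c

theorem exists_abs_tsum_mlfTerm_le {α δ : ℝ} (h0 : 0 < α) (h2 : α < 2) (hδ : 1 < δ)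
    (hδα : δ < 1 + α) {a : ℕ → ℝ} (ha : a ∈ chooseSpan) :
    ∃ B : ℝ, ∀ x : ℝ, 0 < x → |∑' k, mlfTerm α δ a x k| ≤ B := by
  induction ha using Submodule.span_induction with
  | mem a h =>
    obtain ⟨j, rfl⟩ := h
    exact exists_abs_tsum_mlfTerm_choose_le h0 h2 hδ hδα j
  | zero => exact ⟨0, fun x _ => by simp [mlfTerm_zero]⟩
  | add a b ha hb iha ihb =>
    obtain ⟨A, hA⟩ := iha
    obtain ⟨B, hB⟩ := ihb
    refine ⟨A + B, fun x hx => ?_⟩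
    have := (summable_mlfTerm h0 hδ hx ha).tsum_add (summable_mlfTerm h0 hδ hx hb)
    rw [mlfTerm_add]
    simp only [Pi.add_apply]
    rw [this]
    exact (abs_add_le _ _).trans (add_le_add (hA x hx) (hB x hx))
  | smul c a ha ih =>
    obtain ⟨A, hA⟩ := ih
    refine ⟨|c| * A, fun x hx => ?_⟩
    rw [mlfTerm_smul]
    simp only [Pi.smul_apply, smul_eq_mul]
    rw [tsum_mul_left, abs_mul]
    exact mul_le_mul_of_nonneg_left (hA x hx) (abs_nonneg c)

theorem Real.inv_Gamma_eq_mul_inv_Gamma_add_one (s : ℝ) :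
    (Real.Gamma s)⁻¹ = s * (Real.Gamma (s + 1))⁻¹ := by
  rcases eq_or_ne s 0 with rfl | hs
  · simp [Real.Gamma_zero]
  · rw [Real.Gamma_add_one hs, mul_inv, mul_inv_cancel_left₀ hs]

theorem exists_inv_Gamma_eq_mul (α γ : ℝ) (n : ℕ) : ∃ a ∈ chooseSpan, ∀ k : ℕ,
    (Real.Gamma (α * k + γ))⁻¹ = a k * (Real.Gamma (α * k + (γ + n)))⁻¹ := by
  induction n with
  | zero => exact ⟨_, one_mem_chooseSpan, fun k => by simp⟩
  | succ n ih =>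
    obtain ⟨a, ha, h⟩ := ih
    refine ⟨_, affine_mul_mem_chooseSpan α (γ + n) ha, fun k => ?_⟩
    rw [h, Real.inv_Gamma_eq_mul_inv_Gamma_add_one]
    push_cast
    ring_nf

theorem exists_mlfTerm_eq (α γ : ℝ) (n : ℕ) : ∃ a ∈ chooseSpan, ∀ x : ℝ, 0 < x → ∀ k : ℕ,
    mlfTerm α (γ + n) a x k =
      x ^ (γ + n - 1) * ((-(x ^ α)) ^ k / Real.Gamma (α * k + γ)) := by
  obtain ⟨a, ha, h⟩ := exists_inv_Gamma_eq_mul α γ n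
  refine ⟨a, ha, fun x hx k => ?_⟩
  rw [mlfTerm, div_eq_mul_inv, div_eq_mul_inv, h, neg_pow (x ^ α), ← Real.rpow_mul_natCast hx.le,
    show α * k + (γ + n) - 1 = (γ + n - 1) + α * k by ring, Real.rpow_add hx]
  ring

theorem summable_mlfR {α : ℝ} (h0 : 0 < α) (γ t : ℝ) :
    Summable (fun k : ℕ => t ^ k / Real.Gamma (α * k + γ)) := by
  obtain ⟨n, hn⟩ := exists_nat_gt (1 - γ)
  obtain ⟨a, ha, h⟩ := exists_mlfTerm_eq α γ n
  set T := |t| + 1 with hT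
  have hT0 : 0 < T := by positivity
  have hx : 0 < T ^ α⁻¹ := by positivity
  have hxT : (T ^ α⁻¹) ^ α = T := Real.rpow_inv_rpow hT0.le h0.ne'
  have hs := summable_mlfTerm h0 (show 1 < γ + n by linarith) hx ha
  have hs' := ((summable_mul_left_iff (by positivity)).1 (hs.congr fun k => h _ hx k)).norm
  refine Summable.of_norm_bounded hs' fun k => ?_
  rw [hxT, norm_div, norm_div, norm_pow, norm_pow, norm_neg, Real.norm_eq_abs t,
    Real.norm_of_nonneg hT0.le]
  gcongr
  linarith

theorem mlfR_eq_sub_mul {α : ℝ} (h0 : 0 < α) (γ t : ℝ) :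
    mlfR α γ (-t) = (Real.Gamma γ)⁻¹ - t * mlfR α (γ + α) (-t) := by
  rw [mlfR, (summable_mlfR h0 γ (-t)).tsum_eq_zero_add, mlfR, ← tsum_mul_left]
  have : ∀ k : ℕ, (-t) ^ (k + 1) / Real.Gamma (α * ((k + 1 : ℕ) : ℝ) + γ) =
      -(t * ((-t) ^ k / Real.Gamma (α * k + (γ + α)))) := fun k => by
    rw [show α * ((k + 1 : ℕ) : ℝ) + γ = α * k + (γ + α) by push_cast; ring]
    ring
  simp_rw [this]
  rw [tsum_neg]
  simp [sub_eq_add_neg]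

theorem tendsto_mlfR_neg_of_lt {α γ : ℝ} (h1 : 1 < α) (h2 : α < 2) (hγ : γ < 1 + α) :
    Tendsto (fun t => mlfR α γ (-t)) atTop (𝓝 0) := by
  have h0 : 0 < α := by linarith
  obtain ⟨n, hn1, hn2⟩ : ∃ n : ℕ, 1 < γ + n ∧ γ + n < 1 + α := by
    rcases lt_or_ge 1 γ with h | h
    · exact ⟨0, by simpa, by simpa⟩
    · refine ⟨⌊1 - γ⌋₊ + 1, ?_, ?_⟩
      · have := Nat.lt_floor_add_one (1 - γ)
        push_cast; linarith
      · have := Nat.floor_le (show 0 ≤ 1 - γ by linarith)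
        push_cast; linarith
  obtain ⟨a, ha, h⟩ := exists_mlfTerm_eq α γ n
  obtain ⟨B, hB⟩ := exists_abs_tsum_mlfTerm_le h0 h2 hn1 hn2 ha
  have hlim : Tendsto (fun t : ℝ => B * t ^ (-(α⁻¹ * (γ + n - 1)))) atTop (𝓝 0) := by
    simpa using (tendsto_rpow_neg_atTop
      (show 0 < α⁻¹ * (γ + n - 1) by have := sub_pos.2 hn1; positivity)).const_mul B
  refine squeeze_zero_norm' ?_ hlim
  filter_upwards [eventually_gt_atTop 0] with t ht
  have hx : 0 < t ^ α⁻¹ := by positivity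
  have hb := hB _ hx
  simp_rw [h _ hx] at hb
  rw [tsum_mul_left, Real.rpow_inv_rpow ht.le h0.ne', abs_mul, abs_of_pos (by positivity),
    ← Real.rpow_mul ht.le] at hb
  rw [Real.rpow_neg ht.le, ← div_eq_mul_inv, le_div_iff₀' (by positivity)]
  exact hb

theorem tendsto_mul_mlfR_neg_of_tendsto {α γ : ℝ} (h0 : 0 < α)
    (h : Tendsto (fun t => mlfR α (γ - α) (-t)) atTop (𝓝 0)) :
    Tendsto (fun t => t * mlfR α γ (-t)) atTop (𝓝 (Real.Gamma (γ - α))⁻¹) := by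
  have h' := h.const_sub (Real.Gamma (γ - α))⁻¹
  rw [sub_zero] at h'
  refine h'.congr fun t => ?_
  rw [mlfR_eq_sub_mul h0, sub_add_cancel]
  ring

theorem tendsto_mlfR_neg {α : ℝ} (h1 : 1 < α) (h2 : α < 2) (γ : ℝ) :
    Tendsto (fun t => mlfR α γ (-t)) atTop (𝓝 0) := by
  have h0 : 0 < α := by linarith
  have H : ∀ N : ℕ, ∀ γ : ℝ, γ < 1 + α + N * α →
      Tendsto (fun t => mlfR α γ (-t)) atTop (𝓝 0) := by
    intro N
    induction N with
    | zero => exact fun γ hγ => tendsto_mlfR_neg_of_lt h1 h2 (by simpa using hγ)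
    | succ N ih =>
      intro γ hγ
      have h := tendsto_mul_mlfR_neg_of_tendsto h0 (ih (γ - α) (by push_cast at hγ; linarith))
      have h' := tendsto_inv_atTop_zero.mul h
      rw [zero_mul] at h'
      refine h'.congr' ?_
      filter_upwards [eventually_ne_atTop 0] with t ht
      rw [inv_mul_cancel_left₀ ht]
  obtain ⟨N, hN⟩ := exists_nat_gt (γ / α)
  exact H N γ (by rw [div_lt_iff₀ h0] at hN; linarith)

/-- The leading asymptotics of `mlfR α γ` at `-∞`. -/
theorem tendsto_mul_mlfR_neg {α : ℝ} (h1 : 1 < α) (h2 : α < 2) (γ : ℝ) :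
    Tendsto (fun t => t * mlfR α γ (-t)) atTop (𝓝 (Real.Gamma (γ - α))⁻¹) :=
  tendsto_mul_mlfR_neg_of_tendsto (by linarith) (tendsto_mlfR_neg h1 h2 _)

theorem eventually_mlfR_neg_ne_zero {α β : ℝ} (h1 : 1 < α) (h2 : α < 2) (hβ : 1 ≤ β) :
    ∀ᶠ t in atTop, mlfR α β (-t) ≠ 0 := by
  rcases eq_or_ne β α with rfl | hne
  · have hΓ : Real.Gamma (0 - β) ≠ 0 := Real.Gamma_ne_zero fun m hm => by
      have hm1 : 1 < (m : ℝ) := by linarith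
      have hm2 : (m : ℝ) < 2 := by linarith
      norm_cast at hm1 hm2
      omega
    filter_upwards [(tendsto_mul_mlfR_neg h1 h2 0).eventually_ne (inv_ne_zero hΓ)] with t ht h
    rw [mlfR_eq_sub_mul (by linarith), zero_add, h] at ht
    simp [Real.Gamma_zero] at ht
  · have hΓ : Real.Gamma (β - α) ≠ 0 := Real.Gamma_ne_zero fun m hm => by
      have hm1 : (m : ℝ) < 1 := by linarith
      have hm0 : m = 0 := by norm_cast at hm1; omega
      subst hm0
      exact hne (by simpa [sub_eq_zero] using hm)
    filter_upwards [(tendsto_mul_mlfR_neg h1 h2 β).eventually_ne (inv_ne_zero hΓ)] with t ht h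
    exact ht (by rw [h, mul_zero])

theorem analyticOnNhd_mlfR {α : ℝ} (h0 : 0 < α) (β : ℝ) : AnalyticOnNhd ℝ (mlfR α β) univ := by
  set p := FormalMultilinearSeries.ofScalars ℝ
    (fun k : ℕ => (Real.Gamma (α * k + β))⁻¹) with hp
  have hr : p.radius = ⊤ := p.radius_eq_top_of_summable_norm fun r => by
    refine (summable_mlfR h0 β r).norm.congr fun k => ?_
    rw [hp, FormalMultilinearSeries.ofScalars_norm, norm_div, norm_inv, norm_pow,
      Real.norm_of_nonneg r.coe_nonneg]
    ring
  have h := (p.hasFPowerSeriesOnBall (by simp [hr])).analyticOnNhd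
  rw [hr, Metric.eball_top] at h
  convert! h using 1
  ext x
  simp [mlfR, hp, FormalMultilinearSeries.sum, div_eq_mul_inv]

theorem mlf_finitely_many_roots (α β : ℝ) (hα1 : 1 < α) (hα2 : α < 2) (hβ : 1 ≤ β) :
    {t : ℝ | 0 ≤ t ∧ mlfR α β (-t) = 0}.Finite := by
  have h0 : 0 < α := by linarith
  obtain ⟨T, hT⟩ := eventually_atTop.1 (eventually_mlfR_neg_ne_zero hα1 hα2 hβ)
  by_contra hinf
  obtain ⟨z, -, hz⟩ := Set.Infinite.exists_accPt_of_subset_isCompact hinf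
    (isCompact_Icc (a := 0) (b := T)) fun t ht => ⟨ht.1, not_lt.1 fun h => hT t h.le ht.2⟩
  have han : AnalyticOnNhd ℝ (fun t => mlfR α β (-t)) univ :=
    (analyticOnNhd_mlfR h0 β).comp analyticOnNhd_id.neg (mapsTo_univ _ _)
  have hzero := han.eqOn_zero_of_preconnected_of_frequently_eq_zero isPreconnected_univ
    (mem_univ z) ((accPt_iff_frequently_nhdsNE.1 hz).mono fun t ht => ht.2)
  exact hT T le_rfl (hzero (mem_univ T))
end

section
/- For all real α with 1 < α < 2 and real β ≥ 1, the function t ↦ E_{α,β}(−t) is eventually monotone: there exists T ≥ 0 such that t ↦ E_{α,β}(−t) is monotone (either monotone nondecreasing or monotone nonincreasing) on the interval [T, ∞). -/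
open MeasureTheory Set Filter Topology

/-- A unit vector in the open second quadrant of the complex plane. -/
structure IsRayDirection (u : ℂ) : Prop where
  norm_eq_one : ‖u‖ = 1
  re_neg : u.re < 0
  im_pos : 0 < u.im

namespace IsRayDirection

variable {u : ℂ} {c ρ : ℝ}

theorem mem_slitPlane (hu : IsRayDirection u) (hc : 0 < c) (hρ : 0 ≤ ρ) :
    (c + ρ * u : ℂ) ∈ Complex.slitPlane := by
  rw [Complex.mem_slitPlane_iff]
  rcases hρ.eq_or_lt with rfl | h
  · left; simpa using hc
  · right; simp [h.ne', hu.im_pos.ne']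

theorem smul_mem_slitPlane (hu : IsRayDirection u) (hρ : 0 < ρ) :
    (ρ * u : ℂ) ∈ Complex.slitPlane := by
  rw [Complex.mem_slitPlane_iff]
  right; simp [hρ.ne', hu.im_pos.ne']

theorem mul_im_le_norm (hu : IsRayDirection u) (hρ : 0 ≤ ρ) :
    ρ * u.im ≤ ‖(c + ρ * u : ℂ)‖ := by
  refine le_trans (le_of_eq ?_) (Complex.abs_im_le_norm _)
  simp [abs_of_nonneg hρ, abs_of_pos hu.im_pos]

theorem mul_im_le_norm' (hu : IsRayDirection u) (hc : 0 ≤ c) :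
    c * u.im ≤ ‖(c + ρ * u : ℂ)‖ := by
  have h : ‖(c + ρ * u : ℂ)‖ = ‖(c + ρ * u : ℂ) * (starRingEnd ℂ) u‖ := by
    rw [norm_mul, RCLike.norm_conj, hu.norm_eq_one, mul_one]
  rw [h]
  refine le_trans (le_of_eq ?_) (Complex.abs_im_le_norm _)
  have : ((c + ρ * u : ℂ) * (starRingEnd ℂ) u).im = -(c * u.im) := by simp; ring
  rw [this, abs_neg, abs_of_nonneg (mul_nonneg hc hu.im_pos.le)]

theorem norm_le (hu : IsRayDirection u) (hc : 0 ≤ c) (hρ : 0 ≤ ρ) :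
    ‖(c + ρ * u : ℂ)‖ ≤ c + ρ := by
  refine (norm_add_le _ _).trans (le_of_eq ?_)
  rw [norm_mul, hu.norm_eq_one, Complex.norm_of_nonneg hc, Complex.norm_of_nonneg hρ, mul_one]

theorem norm_exp (u : ℂ) (c ρ : ℝ) :
    ‖Complex.exp (c + ρ * u : ℂ)‖ = Real.exp (c + ρ * u.re) := by
  rw [Complex.norm_exp]; simp

theorem hasDerivAt_ray (u : ℂ) (c ρ : ℝ) :
    HasDerivAt (fun x : ℝ => (c + x * u : ℂ)) u ρ := by
  have h := ((hasDerivAt_id ρ).ofReal_comp.mul_const u).const_add (c : ℂ)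
  simpa using h

theorem hasDerivAt_shift (u : ℂ) (c ρ : ℝ) :
    HasDerivAt (fun x : ℝ => (x + ρ * u : ℂ)) 1 c := by
  have h := (hasDerivAt_id c).ofReal_comp.add_const (ρ * u : ℂ)
  simpa using h

theorem continuous_ray (u : ℂ) (c : ℝ) : Continuous (fun x : ℝ => (c + x * u : ℂ)) := by
  fun_prop

end IsRayDirection

theorem exists_rpow_le_mul_exp (p : ℝ) {η : ℝ} (hη : 0 < η) :
    ∃ C : ℝ, 0 ≤ C ∧ ∀ x : ℝ, 1 ≤ x → x ^ p ≤ C * Real.exp (η * x) := by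
  rcases le_or_gt p 0 with hp | hp
  · refine ⟨1, zero_le_one, fun x hx => ?_⟩
    have h1 := Real.rpow_le_one_of_one_le_of_nonpos hx hp
    have h2 : 1 ≤ Real.exp (η * x) := Real.one_le_exp (by positivity)
    linarith
  · refine ⟨(p / η) ^ p, by positivity, fun x hx => ?_⟩
    have hx0 : 0 ≤ x := by linarith
    have h1 : η * x / p ≤ Real.exp (η * x / p) := by
      linarith [Real.add_one_le_exp (η * x / p)]
    have h2 : x = (p / η) * (η * x / p) := by field_simp
    calc x ^ p = (p / η) ^ p * (η * x / p) ^ p := by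
          rw [← Real.mul_rpow (by positivity) (by positivity), ← h2]
      _ ≤ (p / η) ^ p * (Real.exp (η * x / p)) ^ p := by gcongr
      _ = (p / η) ^ p * Real.exp (η * x) := by
          rw [← Real.exp_mul]; congr 2; field_simp

/-- Uniform exponential decay along the rays `c + ρ u`, for `c` in compact subsets of `(0, ∞)`. -/
def RayDecay (u : ℂ) (F : ℂ → ℂ) : Prop :=
  ∀ a b : ℝ, 0 < a → ∃ K : ℝ, ∀ c ∈ Icc a b, ∀ ρ : ℝ, 0 ≤ ρ →
    ‖F (c + ρ * u)‖ ≤ K * Real.exp (u.re / 2 * ρ)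

namespace RayDecay

variable {u : ℂ} {F G : ℂ → ℂ}

theorem add (hF : RayDecay u F) (hG : RayDecay u G) : RayDecay u (fun s => F s + G s) := by
  intro a b ha
  obtain ⟨K, hK⟩ := hF a b ha
  obtain ⟨L, hL⟩ := hG a b ha
  refine ⟨K + L, fun c hc ρ hρ => (norm_add_le _ _).trans ?_⟩
  rw [add_mul]
  exact add_le_add (hK c hc ρ hρ) (hL c hc ρ hρ)

theorem mul_of_norm_le (hF : RayDecay u F) {M : ℝ}
    (hG : ∀ c ρ : ℝ, 0 < c → 0 ≤ ρ → ‖G (c + ρ * u)‖ ≤ M) :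
    RayDecay u (fun s => F s * G s) := by
  intro a b ha
  obtain ⟨K, hK⟩ := hF a b ha
  refine ⟨K * M, fun c hc ρ hρ => ?_⟩
  rw [norm_mul, mul_right_comm]
  exact mul_le_mul (hK c hc ρ hρ) (hG c ρ (ha.trans_le hc.1) hρ) (norm_nonneg _)
    ((norm_nonneg _).trans (hK c hc ρ hρ))

theorem mul_const (hF : RayDecay u F) (k : ℂ) : RayDecay u (fun s => F s * k) :=
  hF.mul_of_norm_le fun _ _ _ _ => le_rfl

theorem exp_mul_cpow (hu : IsRayDirection u) (p : ℝ) :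
    RayDecay u (fun s => Complex.exp s * s ^ (p : ℂ)) := by
  intro a b ha
  obtain ⟨C, hC0, hC⟩ := exists_rpow_le_mul_exp p (η := -u.re / 2) (by linarith [hu.re_neg])
  have him := hu.im_pos
  refine ⟨Real.exp b * ((a * u.im) ^ p + C * Real.exp (-u.re / 2 * (1 + b))),
    fun c hc ρ hρ => ?_⟩
  have hc0 : 0 < c := ha.trans_le hc.1
  have hb0 : 0 < b := hc0.trans_le hc.2
  rw [norm_mul, Complex.norm_cpow_real, IsRayDirection.norm_exp]
  set r := ‖(c + ρ * u : ℂ)‖ with hr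
  have hr1 : a * u.im ≤ r :=
    (mul_le_mul_of_nonneg_right hc.1 him.le).trans (hu.mul_im_le_norm' hc0.le)
  have hr2 : r ≤ 1 + b + ρ := (hu.norm_le hc0.le hρ).trans (by linarith [hc.2])
  have hau : 0 < a * u.im := by positivity
  have hpow : r ^ p ≤ (a * u.im) ^ p + C * Real.exp (-u.re / 2 * (1 + b + ρ)) := by
    rcases le_or_gt p 0 with hp | hp
    · have h1 : r ^ p ≤ (a * u.im) ^ p := Real.rpow_le_rpow_of_nonpos hau hr1 hp
      have h2 : 0 ≤ C * Real.exp (-u.re / 2 * (1 + b + ρ)) := by positivity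
      linarith
    · have h1 : r ^ p ≤ (1 + b + ρ) ^ p := Real.rpow_le_rpow (hau.le.trans hr1) hr2 hp.le
      have h2 := hC (1 + b + ρ) (by linarith)
      have h3 : 0 ≤ (a * u.im) ^ p := by positivity
      linarith
  have hE : 1 ≤ Real.exp (-u.re / 2 * ρ) :=
    Real.one_le_exp (mul_nonneg (by linarith [hu.re_neg]) hρ)
  have hsplit : Real.exp (-u.re / 2 * (1 + b + ρ))
      = Real.exp (-u.re / 2 * (1 + b)) * Real.exp (-u.re / 2 * ρ) := by
    rw [← Real.exp_add]; ring_nf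
  have hpow2 : r ^ p ≤ ((a * u.im) ^ p + C * Real.exp (-u.re / 2 * (1 + b)))
      * Real.exp (-u.re / 2 * ρ) := by
    rw [hsplit] at hpow
    have h3 : 0 ≤ (a * u.im) ^ p := by positivity
    nlinarith [mul_le_mul_of_nonneg_left hE h3]
  have hexp : Real.exp (c + ρ * u.re) ≤ Real.exp b * Real.exp (ρ * u.re) := by
    rw [← Real.exp_add]; exact Real.exp_le_exp.2 (by linarith [hc.2])
  calc Real.exp (c + ρ * u.re) * r ^ p
      ≤ (Real.exp b * Real.exp (ρ * u.re)) *
        (((a * u.im) ^ p + C * Real.exp (-u.re / 2 * (1 + b))) * Real.exp (-u.re / 2 * ρ)) := by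
        gcongr
    _ = Real.exp b * ((a * u.im) ^ p + C * Real.exp (-u.re / 2 * (1 + b))) *
        (Real.exp (ρ * u.re) * Real.exp (-u.re / 2 * ρ)) := by ring
    _ = _ := by rw [← Real.exp_add]; ring_nf

end RayDecay

/-- The integral of `F` along the ray `c + ρ u`, `ρ > 0`. -/
noncomputable def rayIntegral (u : ℂ) (F : ℂ → ℂ) (c : ℝ) : ℂ :=
  ∫ ρ in Ioi (0 : ℝ), F (c + ρ * u) * u

theorem integrableOn_exp_re_half {u : ℂ} (hu : IsRayDirection u) (K : ℝ) :
    IntegrableOn (fun ρ : ℝ => K * Real.exp (u.re / 2 * ρ)) (Ioi 0) :=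
  (integrableOn_exp_mul_Ioi (by linarith [hu.re_neg]) 0).const_mul K

section Ray

variable {u : ℂ} {F : ℂ → ℂ}

theorem continuousOn_ray (hu : IsRayDirection u) {c : ℝ} (hc : 0 < c)
    (hF : ContinuousOn F Complex.slitPlane) :
    ContinuousOn (fun ρ : ℝ => F (c + ρ * u) * u) (Ici 0) :=
  (hF.comp (IsRayDirection.continuous_ray u c).continuousOn
    fun _ hρ => hu.mem_slitPlane hc hρ).mul continuousOn_const

theorem integrableOn_ray (hu : IsRayDirection u) {c : ℝ} (hc : 0 < c) (hd : RayDecay u F)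
    (hF : ContinuousOn (fun ρ : ℝ => F (c + ρ * u) * u) (Ici 0)) :
    IntegrableOn (fun ρ : ℝ => F (c + ρ * u) * u) (Ioi 0) := by
  obtain ⟨K, hK⟩ := hd c c hc
  refine Integrable.mono' (integrableOn_exp_re_half hu K)
    ((hF.mono Ioi_subset_Ici_self).aestronglyMeasurable measurableSet_Ioi) ?_
  refine (ae_restrict_iff' measurableSet_Ioi).2 (ae_of_all _ fun ρ hρ => ?_)
  rw [norm_mul, hu.norm_eq_one, mul_one]
  exact hK c ⟨le_rfl, le_rfl⟩ ρ (le_of_lt hρ)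

/-- The fundamental theorem of calculus along a ray. -/
theorem rayIntegral_deriv (hu : IsRayDirection u) {c : ℝ} (hc : 0 < c) {F' : ℂ → ℂ}
    (hF : ∀ ρ : ℝ, 0 ≤ ρ → HasDerivAt F (F' (c + ρ * u)) (c + ρ * u))
    (hd : RayDecay u F) (hint : IntegrableOn (fun ρ : ℝ => F' (c + ρ * u) * u) (Ioi 0)) :
    rayIntegral u F' c = -F c := by
  have hder : ∀ ρ : ℝ, 0 ≤ ρ →
      HasDerivAt (fun x : ℝ => F (c + x * u)) (F' (c + ρ * u) * u) ρ := fun ρ hρ =>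
    (hF ρ hρ).comp ρ (IsRayDirection.hasDerivAt_ray u c ρ)
  have hlim : Tendsto (fun x : ℝ => F (c + x * u)) atTop (𝓝 0) := by
    obtain ⟨K, hK⟩ := hd c c hc
    have h0 : Tendsto (fun ρ : ℝ => K * Real.exp (u.re / 2 * ρ)) atTop (𝓝 0) := by
      have : Tendsto (fun ρ : ℝ => u.re / 2 * ρ) atTop atBot :=
        tendsto_id.const_mul_atTop_of_neg (by linarith [hu.re_neg])
      simpa using (Real.tendsto_exp_atBot.comp this).const_mul K
    refine squeeze_zero_norm' ?_ h0
    filter_upwards [eventually_ge_atTop 0] with ρ hρ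
    exact hK c ⟨le_rfl, le_rfl⟩ ρ hρ
  have := integral_Ioi_of_hasDerivAt_of_tendsto (a := (0 : ℝ))
    (hder 0 le_rfl).continuousAt.continuousWithinAt (fun x hx => hder x (le_of_lt hx)) hint hlim
  simpa [rayIntegral] using this

/-- The imaginary part of the integral of a function real on the positive half-line along the ray
issued from `c` does not depend on `c`. -/
theorem rayIntegral_im_eq (hu : IsRayDirection u) {F' : ℂ → ℂ}
    (hF : ∀ c ρ : ℝ, 0 < c → 0 ≤ ρ → HasDerivAt F (F' (c + ρ * u)) (c + ρ * u))
    (hF' : ∀ c : ℝ, 0 < c → ContinuousOn (fun ρ : ℝ => F' (c + ρ * u) * u) (Ici 0))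
    (hd : RayDecay u F) (hd' : RayDecay u F') (hreal : ∀ c : ℝ, 0 < c → (F c).im = 0)
    {c₁ c₂ : ℝ} (h₁ : 0 < c₁) (h₂ : 0 < c₂) :
    (rayIntegral u F c₁).im = (rayIntegral u F c₂).im := by
  have hFc : ∀ c : ℝ, 0 < c → ContinuousOn (fun ρ : ℝ => F (c + ρ * u) * u) (Ici 0) := by
    intro c hc ρ hρ
    exact (((hF c ρ hc hρ).comp ρ
      (IsRayDirection.hasDerivAt_ray u c ρ)).mul_const u).continuousAt.continuousWithinAt
  have key : ∀ c : ℝ, 0 < c → HasDerivAt (fun c => (rayIntegral u F c).im) 0 c := by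
    intro c hc
    obtain ⟨K, hK⟩ := hd' (c / 2) (2 * c) (by positivity)
    have hnhds : Icc (c / 2) (2 * c) ∈ 𝓝 c := Icc_mem_nhds (by linarith) (by linarith)
    have h := hasDerivAt_integral_of_dominated_loc_of_deriv_le
      (μ := volume.restrict (Ioi (0 : ℝ))) (x₀ := c)
      (F := fun (c ρ : ℝ) => F (c + ρ * u) * u) (F' := fun (c ρ : ℝ) => F' (c + ρ * u) * u)
      (bound := fun ρ => K * Real.exp (u.re / 2 * ρ)) hnhds ?_
      (integrableOn_ray hu hc hd (hFc c hc)) (integrableOn_ray hu hc hd' (hF' c hc)).1 ?_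
      (integrableOn_exp_re_half hu K) ?_
    · have hval := rayIntegral_deriv hu hc (fun ρ hρ => hF c ρ hc hρ) hd
        (integrableOn_ray hu hc hd' (hF' c hc))
      have h2 : HasDerivAt (rayIntegral u F) (-F c) c := by
        rw [← hval]; exact h.2
      have h3 := (Complex.imCLM.hasFDerivAt.comp_hasDerivAt c h2)
      have h4 : Complex.imCLM (-F c) = 0 := by simp [hreal c hc]
      rw [h4] at h3
      exact h3
    · filter_upwards [hnhds] with x hx
      have hx0 : 0 < x := by linarith [hx.1]
      exact (integrableOn_ray hu hx0 hd (hFc x hx0)).1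
    · refine (ae_restrict_iff' measurableSet_Ioi).2 (ae_of_all _ fun ρ hρ x hx => ?_)
      rw [norm_mul, hu.norm_eq_one, mul_one]
      exact hK x hx ρ (le_of_lt hρ)
    · refine (ae_restrict_iff' measurableSet_Ioi).2 (ae_of_all _ fun ρ hρ x hx => ?_)
      have hx0 : 0 < x := by linarith [hx.1]
      have := (hF x ρ hx0 (le_of_lt hρ)).comp x (IsRayDirection.hasDerivAt_shift u x ρ)
      simpa using this.mul_const u
  exact isOpen_Ioi.is_const_of_deriv_eq_zero (s := Ioi (0 : ℝ)) isPreconnected_Ioi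
    (fun c hc => (key c hc).differentiableAt.differentiableWithinAt)
    (fun c hc => (key c hc).deriv) h₁ h₂

end Ray

theorem integrableOn_rpow_mul_exp_neg_mul_s10 {p ε : ℝ} (hp : -1 < p) (hε : 0 < ε) :
    IntegrableOn (fun ρ : ℝ => ρ ^ p * Real.exp (-ε * ρ)) (Ioi 0) := by
  simpa using integrableOn_rpow_mul_exp_neg_mul_rpow hp one_pos hε

theorem norm_rpow_mul_cexp_neg {p ρ : ℝ} (hρ : 0 < ρ) (r : ℂ) :
    ‖((ρ ^ p : ℝ) : ℂ) * Complex.exp (-(r * ρ))‖ = ρ ^ p * Real.exp (-r.re * ρ) := by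
  rw [norm_mul, Complex.norm_exp, Complex.norm_of_nonneg (Real.rpow_nonneg hρ.le p)]
  simp

theorem aestronglyMeasurable_rpow_mul_cexp_neg (p : ℝ) (r : ℂ) :
    AEStronglyMeasurable (fun ρ : ℝ => ((ρ ^ p : ℝ) : ℂ) * Complex.exp (-(r * ρ)))
      (volume.restrict (Ioi (0 : ℝ))) := by
  apply Measurable.aestronglyMeasurable
  fun_prop

theorem differentiableOn_integral_rpow_mul_cexp_neg {a : ℝ} (ha : 0 < a) :
    DifferentiableOn ℂ (fun r : ℂ => ∫ ρ in Ioi (0 : ℝ),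
      ((ρ ^ (a - 1) : ℝ) : ℂ) * Complex.exp (-(r * ρ))) {r : ℂ | 0 < r.re} := by
  intro r hr
  have hr' : 0 < r.re := hr
  have hopen : IsOpen {z : ℂ | r.re / 2 < z.re} := isOpen_lt continuous_const Complex.continuous_re
  have h := hasDerivAt_integral_of_dominated_loc_of_deriv_le
      (μ := volume.restrict (Ioi (0 : ℝ))) (x₀ := r)
      (F := fun (r : ℂ) (ρ : ℝ) => ((ρ ^ (a - 1) : ℝ) : ℂ) * Complex.exp (-(r * ρ)))
      (F' := fun (r : ℂ) (ρ : ℝ) => ((ρ ^ (a - 1) : ℝ) : ℂ) * (Complex.exp (-(r * ρ)) * (-ρ)))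
      (bound := fun ρ => ρ ^ a * Real.exp (-(r.re / 2) * ρ))
      (hopen.mem_nhds (show r.re / 2 < r.re by linarith)) ?_ ?_ ?_ ?_
      (integrableOn_rpow_mul_exp_neg_mul_s10 (by linarith) (by positivity)) ?_
  · exact h.2.differentiableAt.differentiableWithinAt
  · exact Eventually.of_forall fun r => aestronglyMeasurable_rpow_mul_cexp_neg _ r
  · refine Integrable.mono' (integrableOn_rpow_mul_exp_neg_mul_s10 (p := a - 1) (by linarith) hr')
      (aestronglyMeasurable_rpow_mul_cexp_neg _ r) ?_
    refine (ae_restrict_iff' measurableSet_Ioi).2 (ae_of_all _ fun ρ hρ => ?_)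
    exact (norm_rpow_mul_cexp_neg hρ r).le
  · apply Measurable.aestronglyMeasurable
    fun_prop
  · refine (ae_restrict_iff' measurableSet_Ioi).2 (ae_of_all _ fun ρ hρ z hz => ?_)
    have hρ0 : 0 < ρ := hρ
    have hz' : r.re / 2 < z.re := hz
    rw [← mul_assoc, norm_mul, norm_rpow_mul_cexp_neg hρ, norm_neg, Complex.norm_of_nonneg hρ0.le,
      mul_right_comm]
    have h1 : ρ ^ (a - 1) * ρ = ρ ^ a := by
      rw [← Real.rpow_add_one hρ0.ne']; ring_nf
    rw [h1]
    gcongr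
  · refine ae_of_all _ fun ρ z _ => ?_
    have h1 : HasDerivAt (fun z : ℂ => -(z * (ρ : ℂ))) (-(ρ : ℂ)) z := by
      simpa using ((hasDerivAt_id z).mul_const (ρ : ℂ)).fun_neg
    exact h1.cexp.const_mul _

/-- The Gamma integral with a complex scaling parameter of positive real part. -/
theorem integral_rpow_mul_cexp_neg_mul {a : ℝ} (ha : 0 < a) {r : ℂ} (hr : 0 < r.re) :
    ∫ ρ in Ioi (0 : ℝ), ((ρ ^ (a - 1) : ℝ) : ℂ) * Complex.exp (-(r * ρ))
      = r ^ (-a : ℂ) * (Real.Gamma a : ℂ) := by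
  have hopen : IsOpen {r : ℂ | 0 < r.re} := isOpen_lt continuous_const Complex.continuous_re
  have hconv : Convex ℝ {r : ℂ | 0 < r.re} := convex_halfSpace_re_gt 0
  have h1 := (differentiableOn_integral_rpow_mul_cexp_neg ha).analyticOnNhd hopen
  have h2 : AnalyticOnNhd ℂ (fun r : ℂ => r ^ (-a : ℂ) * (Real.Gamma a : ℂ))
      {r : ℂ | 0 < r.re} := by
    refine DifferentiableOn.analyticOnNhd (fun z hz => ?_) hopen
    have hz' : z ∈ Complex.slitPlane := Or.inl hz
    exact (((hasDerivAt_id z).cpow_const (c := (-a : ℂ)) hz').mul_const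
      (Real.Gamma a : ℂ)).differentiableAt.differentiableWithinAt
  have hreal : ∀ x : ℝ, 0 < x →
      ∫ ρ in Ioi (0 : ℝ), ((ρ ^ (a - 1) : ℝ) : ℂ) * Complex.exp (-((x : ℂ) * ρ))
      = (x : ℂ) ^ (-a : ℂ) * (Real.Gamma a : ℂ) := by
    intro x hx
    have h3 := Real.integral_rpow_mul_exp_neg_mul_Ioi ha hx
    have h4 : (x : ℂ) ^ (-a : ℂ) * (Real.Gamma a : ℂ) = (((1 / x) ^ a * Real.Gamma a : ℝ) : ℂ) := by
      rw [Complex.ofReal_mul, one_div, Real.inv_rpow hx.le, ← Real.rpow_neg hx.le,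
        Complex.ofReal_cpow hx.le]
      simp
    rw [h4, ← h3, ← integral_complex_ofReal]
    congr 1
    ext ρ
    push_cast
    rfl
  refine h1.eqOn_of_preconnected_of_frequently_eq h2 hconv.isPreconnected
    (z₀ := 1) (by simp) ?_ hr
  have htend : Tendsto (fun x : ℝ => (x : ℂ)) (𝓝[>] 1) (𝓝[≠] 1) := by
    refine tendsto_nhdsWithin_iff.2 ⟨?_, ?_⟩
    · exact (Complex.continuous_ofReal.tendsto' 1 1 (by simp)).mono_left nhdsWithin_le_nhds
    · filter_upwards [self_mem_nhdsWithin] with x hx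
      simpa using (ne_of_gt hx)
  refine htend.frequently (Eventually.frequently ?_)
  filter_upwards [self_mem_nhdsWithin] with x hx
  exact hreal x (zero_lt_one.trans hx)

section Hankel

variable {u : ℂ}

theorem integral_exp_mul_cpow_im (hu : IsRayDirection u) {w : ℝ} (hw : w < 1) :
    (∫ ρ in Ioi (0 : ℝ), Complex.exp (ρ * u) * (ρ * u : ℂ) ^ ((-w : ℝ) : ℂ) * u).im
      = Real.sin (Real.pi * w) * Real.Gamma (1 - w) := by
  have hu0 : u ≠ 0 := by
    intro h; have := hu.im_pos; simp [h] at this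
  have hre : 0 < (-u).re := by simpa using hu.re_neg
  have h1 : ∀ ρ ∈ Ioi (0 : ℝ), Complex.exp (ρ * u) * (ρ * u : ℂ) ^ ((-w : ℝ) : ℂ) * u
      = u ^ ((1 - w : ℝ) : ℂ) * (((ρ ^ ((1 - w) - 1) : ℝ) : ℂ) * Complex.exp (-(-u * ρ))) := by
    intro ρ hρ
    have hρ0 : (0 : ℝ) < ρ := hρ
    have hρu : (ρ * u : ℂ) ≠ 0 := mul_ne_zero (by exact_mod_cast hρ0.ne') hu0
    have h2 : (ρ * u : ℂ) ^ ((-w : ℝ) : ℂ) = ((ρ ^ (-w) : ℝ) : ℂ) * u ^ ((-w : ℝ) : ℂ) := by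
      rw [Complex.cpow_def_of_ne_zero hρu, Complex.log_ofReal_mul hρ0 hu0, add_mul, Complex.exp_add,
        ← Complex.cpow_def_of_ne_zero hu0, Complex.ofReal_cpow hρ0.le,
        Complex.cpow_def_of_ne_zero (Complex.ofReal_ne_zero.2 hρ0.ne'), Complex.ofReal_log hρ0.le]
    have h3 : u ^ ((1 - w : ℝ) : ℂ) = u ^ ((-w : ℝ) : ℂ) * u := by
      have h := Complex.cpow_add ((-w : ℝ) : ℂ) 1 hu0
      rw [Complex.cpow_one] at h
      rw [← h]; congr 1; push_cast; ring
    rw [h2, h3, show (1 - w) - 1 = -w by ring, show -(-u * (ρ : ℂ)) = ρ * u by ring]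
    ring
  rw [setIntegral_congr_fun measurableSet_Ioi h1, integral_const_mul,
    integral_rpow_mul_cexp_neg_mul (by linarith : 0 < 1 - w) hre]
  have hlog : Complex.log (-u) = Complex.log u - Real.pi * Complex.I := by
    rw [Complex.log, Complex.log, norm_neg, Complex.arg_neg_eq_arg_sub_pi_of_im_pos hu.im_pos]
    push_cast; ring
  have h4 : u ^ ((1 - w : ℝ) : ℂ) * ((-u) ^ (-((1 - w : ℝ) : ℂ)) * (Real.Gamma (1 - w) : ℂ))
      = Complex.exp ((Real.pi * (1 - w) : ℝ) * Complex.I) * (Real.Gamma (1 - w) : ℂ) := by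
    rw [Complex.cpow_def_of_ne_zero hu0, Complex.cpow_def_of_ne_zero (neg_ne_zero.2 hu0), hlog,
      ← mul_assoc, ← Complex.exp_add]
    congr 2; push_cast; ring
  rw [h4, Complex.im_mul_ofReal, Complex.exp_ofReal_mul_I_im,
    show Real.pi * (1 - w) = Real.pi - Real.pi * w by ring, Real.sin_pi_sub]

theorem sin_mul_Gamma_one_sub {w : ℝ} (h0 : 0 ≤ w) (h1 : w < 1) :
    Real.sin (Real.pi * w) * Real.Gamma (1 - w) = Real.pi * (Real.Gamma w)⁻¹ := by
  rcases h0.eq_or_lt with rfl | h0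
  · simp
  · have hs : 0 < Real.sin (Real.pi * w) :=
      Real.sin_pos_of_pos_of_lt_pi (by positivity) (by nlinarith [Real.pi_pos])
    have hG := Real.Gamma_pos_of_pos h0
    have h := Real.Gamma_mul_Gamma_one_sub w
    rw [eq_div_iff hs.ne'] at h
    rw [eq_mul_inv_iff_mul_eq₀ hG.ne']
    linarith

theorem hasDerivAt_exp_mul_cpow {s : ℂ} (hs : s ∈ Complex.slitPlane) (p : ℝ) :
    HasDerivAt (fun s => Complex.exp s * s ^ (p : ℂ))
      (Complex.exp s * s ^ (p : ℂ) + Complex.exp s * s ^ ((p - 1 : ℝ) : ℂ) * p) s := by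
  have h := (Complex.hasDerivAt_exp s).mul ((hasDerivAt_id s).cpow_const (c := (p : ℂ)) hs)
  refine h.congr_deriv ?_
  push_cast
  simp only [id]
  ring

theorem continuousOn_exp_mul_cpow (p : ℝ) :
    ContinuousOn (fun s => Complex.exp s * s ^ (p : ℂ)) Complex.slitPlane := fun _ hs =>
  (hasDerivAt_exp_mul_cpow hs p).continuousAt.continuousWithinAt

theorem im_exp_mul_cpow_ofReal {c : ℝ} (hc : 0 < c) (p : ℝ) :
    (Complex.exp c * (c : ℂ) ^ (p : ℂ)).im = 0 := by
  rw [← Complex.ofReal_cpow hc.le, ← Complex.ofReal_exp, ← Complex.ofReal_mul, Complex.ofReal_im]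

theorem rayIntegral_exp_mul_cpow_im_eq (hu : IsRayDirection u) (p : ℝ) {c₁ c₂ : ℝ}
    (h₁ : 0 < c₁) (h₂ : 0 < c₂) :
    (rayIntegral u (fun s => Complex.exp s * s ^ (p : ℂ)) c₁).im
      = (rayIntegral u (fun s => Complex.exp s * s ^ (p : ℂ)) c₂).im :=
  rayIntegral_im_eq hu (fun _ _ hc hρ => hasDerivAt_exp_mul_cpow (hu.mem_slitPlane hc hρ) p)
    (fun _ hc => continuousOn_ray hu hc ((continuousOn_exp_mul_cpow p).add
      ((continuousOn_exp_mul_cpow (p - 1)).mul continuousOn_const)))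
    (RayDecay.exp_mul_cpow hu p)
    ((RayDecay.exp_mul_cpow hu p).add ((RayDecay.exp_mul_cpow hu (p - 1)).mul_const p))
    (fun _ hc => im_exp_mul_cpow_ofReal hc p) h₁ h₂

theorem integrableOn_ray_exp_mul_cpow (hu : IsRayDirection u) (p : ℝ) {c : ℝ} (hc : 0 < c) :
    IntegrableOn (fun ρ : ℝ => Complex.exp (c + ρ * u) * (c + ρ * u : ℂ) ^ (p : ℂ) * u) (Ioi 0) :=
  integrableOn_ray (F := fun s => Complex.exp s * s ^ (p : ℂ)) hu hc (RayDecay.exp_mul_cpow hu p)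
    (continuousOn_ray hu hc (continuousOn_exp_mul_cpow p))

theorem rayIntegral_exp_mul_cpow_im_rec (hu : IsRayDirection u) (p : ℝ) {c : ℝ} (hc : 0 < c) :
    (rayIntegral u (fun s => Complex.exp s * s ^ (p : ℂ)) c).im
      = -p * (rayIntegral u (fun s => Complex.exp s * s ^ ((p - 1 : ℝ) : ℂ)) c).im := by
  have hi := integrableOn_ray_exp_mul_cpow hu p hc
  have hi' := integrableOn_ray_exp_mul_cpow hu (p - 1) hc
  have hfun : ∀ ρ : ℝ, (Complex.exp (c + ρ * u) * (c + ρ * u : ℂ) ^ (p : ℂ) +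
      Complex.exp (c + ρ * u) * (c + ρ * u : ℂ) ^ ((p - 1 : ℝ) : ℂ) * p) * u
      = Complex.exp (c + ρ * u) * (c + ρ * u : ℂ) ^ (p : ℂ) * u +
        p * (Complex.exp (c + ρ * u) * (c + ρ * u : ℂ) ^ ((p - 1 : ℝ) : ℂ) * u) :=
    fun ρ => by ring
  have h := rayIntegral_deriv hu hc
    (F' := fun s => Complex.exp s * s ^ (p : ℂ) + Complex.exp s * s ^ ((p - 1 : ℝ) : ℂ) * p)
    (fun ρ hρ => hasDerivAt_exp_mul_cpow (hu.mem_slitPlane hc hρ) p)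
    (RayDecay.exp_mul_cpow hu p) (by
      simp only [hfun]
      exact hi.add (hi'.const_mul _))
  rw [rayIntegral] at h
  simp only [hfun] at h
  rw [integral_add hi (hi'.const_mul _), integral_const_mul] at h
  have h2 := congrArg Complex.im h
  rw [Complex.add_im, Complex.im_ofReal_mul, Complex.neg_im, im_exp_mul_cpow_ofReal hc p] at h2
  simp only [rayIntegral]
  linarith

theorem hankel_of_mem_Ico (hu : IsRayDirection u) {w : ℝ} (h0 : 0 ≤ w) (h1 : w < 1)
    {c : ℝ} (hc : 0 < c) :
    (rayIntegral u (fun s => Complex.exp s * s ^ ((-w : ℝ) : ℂ)) c).im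
      = Real.pi * (Real.Gamma w)⁻¹ := by
  rw [← sin_mul_Gamma_one_sub h0 h1, ← integral_exp_mul_cpow_im hu h1]
  have hlim : Tendsto (fun c : ℝ => rayIntegral u (fun s => Complex.exp s * s ^ ((-w : ℝ) : ℂ)) c)
      (𝓝[>] 0) (𝓝 (∫ ρ in Ioi (0 : ℝ),
        Complex.exp (ρ * u) * (ρ * u : ℂ) ^ ((-w : ℝ) : ℂ) * u)) := by
    refine tendsto_integral_filter_of_dominated_convergence
      (fun ρ => (Real.exp 1 * u.im ^ (-w)) * (ρ ^ (-w) * Real.exp (-(-u.re) * ρ))) ?_ ?_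
      ((integrableOn_rpow_mul_exp_neg_mul_s10 (by linarith) (by linarith [hu.re_neg])).const_mul _) ?_
    · filter_upwards [self_mem_nhdsWithin] with c hc
      exact (integrableOn_ray_exp_mul_cpow hu (-w) hc).1
    · filter_upwards [Ioo_mem_nhdsGT (zero_lt_one (α := ℝ))] with c hc
      refine (ae_restrict_iff' measurableSet_Ioi).2 (ae_of_all _ fun ρ hρ => ?_)
      have hρ0 : (0 : ℝ) < ρ := hρ
      have him := hu.im_pos
      rw [norm_mul, norm_mul, hu.norm_eq_one, mul_one, Complex.norm_cpow_real,
        IsRayDirection.norm_exp]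
      have hp : ‖(c + ρ * u : ℂ)‖ ^ (-w) ≤ u.im ^ (-w) * ρ ^ (-w) := by
        rw [← Real.mul_rpow him.le hρ0.le, mul_comm u.im]
        exact Real.rpow_le_rpow_of_nonpos (by positivity) (hu.mul_im_le_norm hρ0.le) (by linarith)
      have he : Real.exp (c + ρ * u.re) ≤ Real.exp 1 * Real.exp (-(-u.re) * ρ) := by
        rw [← Real.exp_add]; exact Real.exp_le_exp.2 (by linarith [hc.2])
      calc _ ≤ (Real.exp 1 * Real.exp (-(-u.re) * ρ)) * (u.im ^ (-w) * ρ ^ (-w)) := by gcongr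
        _ = _ := by ring
    · refine (ae_restrict_iff' measurableSet_Ioi).2 (ae_of_all _ fun ρ hρ => ?_)
      have hsp := hu.smul_mem_slitPlane hρ
      have hcont := (hasDerivAt_exp_mul_cpow hsp (-w)).continuousAt
      have ht : Tendsto (fun c : ℝ => (c + ρ * u : ℂ)) (𝓝[>] 0) (𝓝 (ρ * u)) := by
        have : Continuous (fun c : ℝ => (c + ρ * u : ℂ)) := by fun_prop
        exact (this.tendsto' 0 _ (by simp)).mono_left nhdsWithin_le_nhds
      exact (hcont.tendsto.comp ht).mul_const u
  have hlim' := (Complex.continuous_im.tendsto _).comp hlim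
  refine tendsto_nhds_unique (tendsto_const_nhds.congr' ?_) hlim'
  filter_upwards [self_mem_nhdsWithin] with x hx
  exact rayIntegral_exp_mul_cpow_im_eq hu (-w) hc hx

theorem continuous_inv_Gamma : Continuous fun w : ℝ => (Real.Gamma w)⁻¹ := by
  have h : Continuous fun w : ℝ => ((Complex.Gamma (w : ℂ))⁻¹).re :=
    Complex.continuous_re.comp
      (Complex.differentiable_one_div_Gamma.continuous.comp Complex.continuous_ofReal)
  refine h.congr fun w => ?_
  rw [Complex.Gamma_ofReal, ← Complex.ofReal_inv, Complex.ofReal_re]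

theorem inv_Gamma_eq_self_mul (w : ℝ) : (Real.Gamma w)⁻¹ = w * (Real.Gamma (w + 1))⁻¹ := by
  have h := Complex.one_div_Gamma_eq_self_mul_one_div_Gamma_add_one (w : ℂ)
  rw [show (w : ℂ) + 1 = ((w + 1 : ℝ) : ℂ) by push_cast; rfl, Complex.Gamma_ofReal,
    Complex.Gamma_ofReal] at h
  exact_mod_cast h

theorem hankel_one (hu : IsRayDirection u) {c : ℝ} (hc : 0 < c) :
    (rayIntegral u (fun s => Complex.exp s * s ^ ((-1 : ℝ) : ℂ)) c).im
      = Real.pi * (Real.Gamma 1)⁻¹ := by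
  have hcont : ContinuousAt
      (fun w : ℝ => rayIntegral u (fun s => Complex.exp s * s ^ ((-w : ℝ) : ℂ)) c) 1 := by
    have him := hu.im_pos
    refine continuousAt_of_dominated (bound := fun ρ =>
      (Real.exp c * (1 + (c * u.im)⁻¹) ^ (2 : ℝ)) * Real.exp (u.re * ρ)) ?_ ?_
      ((integrableOn_exp_mul_Ioi hu.re_neg 0).const_mul _) ?_
    · exact Eventually.of_forall fun w => (integrableOn_ray_exp_mul_cpow hu (-w) hc).1
    · filter_upwards [Icc_mem_nhds (show (0 : ℝ) < 1 by norm_num) (show (1 : ℝ) < 2 by norm_num)]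
        with w hw
      refine (ae_restrict_iff' measurableSet_Ioi).2 (ae_of_all _ fun ρ hρ => ?_)
      have hn := hu.mul_im_le_norm' (ρ := ρ) hc.le
      have hcu : 0 < c * u.im := by positivity
      rw [norm_mul, norm_mul, hu.norm_eq_one, mul_one, Complex.norm_cpow_real,
        IsRayDirection.norm_exp]
      have hp : ‖(c + ρ * u : ℂ)‖ ^ (-w) ≤ (1 + (c * u.im)⁻¹) ^ (2 : ℝ) := by
        calc ‖(c + ρ * u : ℂ)‖ ^ (-w) ≤ (c * u.im) ^ (-w) :=
              Real.rpow_le_rpow_of_nonpos hcu hn (by linarith [hw.1])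
          _ = ((c * u.im)⁻¹) ^ w := by rw [Real.inv_rpow hcu.le, Real.rpow_neg hcu.le]
          _ ≤ (1 + (c * u.im)⁻¹) ^ w :=
              Real.rpow_le_rpow (by positivity) (by linarith) hw.1
          _ ≤ (1 + (c * u.im)⁻¹) ^ (2 : ℝ) :=
              Real.rpow_le_rpow_of_exponent_le (by linarith [inv_pos.2 hcu]) hw.2
      calc _ ≤ Real.exp (c + ρ * u.re) * (1 + (c * u.im)⁻¹) ^ (2 : ℝ) := by gcongr
        _ = _ := by rw [Real.exp_add, mul_comm ρ]; ring
    · refine (ae_restrict_iff' measurableSet_Ioi).2 (ae_of_all _ fun ρ hρ => ?_)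
      have hsp := hu.mem_slitPlane hc (le_of_lt hρ)
      have h1 : Continuous fun w : ℝ => (c + ρ * u : ℂ) ^ ((-w : ℝ) : ℂ) :=
        (by fun_prop : Continuous fun w : ℝ => ((-w : ℝ) : ℂ)).const_cpow
          (Or.inl (Complex.slitPlane_ne_zero hsp))
      exact ((continuous_const.mul h1).mul continuous_const).continuousAt
  have h1 : Tendsto
      (fun w : ℝ => (rayIntegral u (fun s => Complex.exp s * s ^ ((-w : ℝ) : ℂ)) c).im)
      (𝓝[<] 1) (𝓝 (rayIntegral u (fun s => Complex.exp s * s ^ ((-1 : ℝ) : ℂ)) c).im) :=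
    ((Complex.continuous_im.tendsto _).comp hcont.tendsto).mono_left nhdsWithin_le_nhds
  have h2 : Tendsto (fun w : ℝ => Real.pi * (Real.Gamma w)⁻¹) (𝓝[<] 1)
      (𝓝 (Real.pi * (Real.Gamma 1)⁻¹)) :=
    ((continuous_inv_Gamma.tendsto 1).const_mul _).mono_left nhdsWithin_le_nhds
  refine tendsto_nhds_unique h1 (h2.congr' ?_)
  filter_upwards [Ioo_mem_nhdsLT (zero_lt_one (α := ℝ))] with w hw
  exact (hankel_of_mem_Ico hu hw.1.le hw.2 hc).symm

/-- Hankel's formula for the reciprocal Gamma function, on a wedge-shaped contour. -/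
theorem hankel (hu : IsRayDirection u) (w : ℝ) {c : ℝ} (hc : 0 < c) :
    (rayIntegral u (fun s => Complex.exp s * s ^ ((-w : ℝ) : ℂ)) c).im
      = Real.pi * (Real.Gamma w)⁻¹ := by
  have hrec : ∀ w : ℝ, (rayIntegral u (fun s => Complex.exp s * s ^ ((-w : ℝ) : ℂ)) c).im
      = w * (rayIntegral u (fun s => Complex.exp s * s ^ ((-(w + 1) : ℝ) : ℂ)) c).im := by
    intro w
    have h := rayIntegral_exp_mul_cpow_im_rec hu (-w) hc
    rwa [neg_neg, show -w - 1 = -(w + 1) by ring] at h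
  have hup : ∀ w : ℝ, w ≠ 0 →
      (rayIntegral u (fun s => Complex.exp s * s ^ ((-w : ℝ) : ℂ)) c).im
        = Real.pi * (Real.Gamma w)⁻¹ →
      (rayIntegral u (fun s => Complex.exp s * s ^ ((-(w + 1) : ℝ) : ℂ)) c).im
        = Real.pi * (Real.Gamma (w + 1))⁻¹ := by
    intro w hw h
    rw [hrec, inv_Gamma_eq_self_mul] at h
    exact mul_left_cancel₀ hw (by rw [h]; ring)
  have hdown : ∀ w : ℝ,
      (rayIntegral u (fun s => Complex.exp s * s ^ ((-(w + 1) : ℝ) : ℂ)) c).im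
        = Real.pi * (Real.Gamma (w + 1))⁻¹ →
      (rayIntegral u (fun s => Complex.exp s * s ^ ((-w : ℝ) : ℂ)) c).im
        = Real.pi * (Real.Gamma w)⁻¹ := by
    intro w h
    rw [hrec, inv_Gamma_eq_self_mul, h]; ring
  have hbase := hankel_of_mem_Ico hu (Int.fract_nonneg w) (Int.fract_lt_one w) hc
  have hall : ∀ n : ℤ,
      (rayIntegral u (fun s => Complex.exp s * s ^ ((-(Int.fract w + n) : ℝ) : ℂ)) c).im
        = Real.pi * (Real.Gamma (Int.fract w + n))⁻¹ := by
    intro n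
    induction n with
    | zero => simpa using hbase
    | succ n ih =>
      have hcast : Int.fract w + ((n + 1 : ℤ) : ℝ) = Int.fract w + ((n : ℤ) : ℝ) + 1 := by
        push_cast; ring
      rw [hcast]
      rcases eq_or_ne (Int.fract w + ((n : ℤ) : ℝ)) 0 with h0 | h0
      · rw [h0, zero_add]; exact hankel_one hu hc
      · exact hup _ h0 ih
    | pred n ih =>
      apply hdown
      have hcast : Int.fract w + ((-n - 1 : ℤ) : ℝ) + 1 = Int.fract w + ((-n : ℤ) : ℝ) := by
        push_cast; ring
      rw [hcast]; exact ih
  simpa using hall ⌊w⌋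

end Hankel

/-- The ray direction `u` is adapted to the exponent `α`: along the rays `c + ρ u` the power `s ^ α`
stays in a sector on which `‖s ^ α + t‖` dominates `κ t`. -/
structure IsAdaptedRay (α κ : ℝ) (u : ℂ) : Prop extends IsRayDirection u where
  pos : 0 < κ
  mul_le_norm : ∀ c ρ t : ℝ, 0 < c → 0 ≤ ρ → 0 < t →
    κ * t ≤ ‖(c + ρ * u : ℂ) ^ (α : ℂ) + t‖

theorem arg_ray_le {θ : ℝ} (h0 : 0 ≤ θ) (hπ : θ ≤ Real.pi) {u : ℂ} (hu : IsRayDirection u)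
    (hθ : u.re = Real.cos θ) {c ρ : ℝ} (hc : 0 < c) (hρ : 0 ≤ ρ) :
    (c + ρ * u : ℂ).arg ≤ θ := by
  set s : ℂ := c + ρ * u with hs
  have hs0 : s ≠ 0 := Complex.slitPlane_ne_zero (hu.mem_slitPlane hc hρ)
  have hsim : 0 ≤ s.im := by
    simpa [hs] using mul_nonneg hρ hu.im_pos.le
  have hn : 0 < ‖s‖ := norm_pos_iff.2 hs0
  rw [Complex.arg_of_im_nonneg_of_ne_zero hsim hs0, ← Real.arccos_cos h0 hπ, ← hθ]
  apply Real.arccos_le_arccos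
  rw [le_div_iff₀ hn]
  have h1 : ρ ≤ ‖s‖ + c := by
    have h2 : (ρ * u : ℂ) = s - c := by rw [hs]; ring
    have h3 : ‖(ρ * u : ℂ)‖ = ρ := by
      rw [norm_mul, hu.norm_eq_one, Complex.norm_of_nonneg hρ, mul_one]
    rw [← h3, h2]
    exact (norm_sub_le _ _).trans (by rw [Complex.norm_of_nonneg hc.le])
  have hre : s.re = c + ρ * u.re := by simp [hs]
  have hu1 : -1 ≤ u.re := by rw [hθ]; exact Real.neg_one_le_cos θ
  rw [hre]
  nlinarith [hu.re_neg, mul_nonneg (sub_nonneg.2 h1) (neg_nonneg.2 hu.re_neg.le)]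

theorem sin_mul_le_norm_add {φ : ℝ} {z : ℂ} (hz : Real.cos φ * ‖z‖ ≤ z.re)
    (hs : 0 ≤ Real.sin φ) {t : ℝ} (ht : 0 ≤ t) : Real.sin φ * t ≤ ‖z + t‖ := by
  refine (sq_le_sq₀ (by positivity) (norm_nonneg _)).1 ?_
  have h1 : ‖z + t‖ ^ 2 = ‖z‖ ^ 2 + 2 * t * z.re + t ^ 2 := by
    rw [← Complex.normSq_eq_norm_sq, ← Complex.normSq_eq_norm_sq, Complex.normSq_apply,
      Complex.normSq_apply]
    simp
    ring
  rw [h1]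
  nlinarith [sq_nonneg (‖z‖ + t * Real.cos φ), Real.sin_sq_add_cos_sq φ,
    mul_le_mul_of_nonneg_left hz ht]

theorem exists_isAdaptedRay {α : ℝ} (hα1 : 1 < α) (hα2 : α < 2) :
    ∃ (κ : ℝ) (u : ℂ), IsAdaptedRay α κ u := by
  have hπ := Real.pi_pos
  have hα0 : 0 < α := by linarith
  set θ := (Real.pi / 2 + Real.pi / α) / 2 with hθ
  have h1 : Real.pi / 2 < Real.pi / α := div_lt_div_of_pos_left hπ hα0 hα2
  have h2 : Real.pi / α < Real.pi := div_lt_self hπ hα1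
  have hθ1 : Real.pi / 2 < θ := by linarith
  have hθ2 : θ < Real.pi / α := by linarith
  have hθ3 : θ < Real.pi := by linarith
  have hαθ : α * θ < Real.pi := by rwa [lt_div_iff₀' hα0] at hθ2
  have hαθ0 : 0 < α * θ := by positivity
  have hsin : 0 < Real.sin (α * θ) := Real.sin_pos_of_pos_of_lt_pi hαθ0 hαθ
  have hre : (Complex.exp (θ * Complex.I)).re = Real.cos θ := Complex.exp_ofReal_mul_I_re θ
  have hu : IsRayDirection (Complex.exp (θ * Complex.I)) := by
    refine ⟨Complex.norm_exp_ofReal_mul_I θ, ?_, ?_⟩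
    · rw [hre]
      exact Real.cos_neg_of_pi_div_two_lt_of_lt hθ1 (by linarith)
    · rw [Complex.exp_ofReal_mul_I_im]
      exact Real.sin_pos_of_pos_of_lt_pi (by linarith) hθ3
  refine ⟨Real.sin (α * θ), Complex.exp (θ * Complex.I), ⟨hu, hsin, fun c ρ t hc hρ ht => ?_⟩⟩
  refine sin_mul_le_norm_add ?_ hsin.le ht.le
  rw [Complex.norm_cpow_real, Complex.cpow_ofReal_re, mul_comm]
  refine mul_le_mul_of_nonneg_left ?_ (Real.rpow_nonneg (norm_nonneg _) _)
  have harg := arg_ray_le (by linarith) hθ3.le hu hre hc hρ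
  have harg0 : 0 ≤ (c + ρ * Complex.exp (θ * Complex.I) : ℂ).arg := by
    rw [Complex.arg_nonneg_iff]
    simpa using mul_nonneg hρ hu.im_pos.le
  refine Real.cos_le_cos_of_nonneg_of_le_pi (mul_nonneg harg0 hα0.le) hαθ.le ?_
  rw [mul_comm α]
  exact mul_le_mul_of_nonneg_right harg hα0.le

section Representation

variable {α κ : ℝ} {u : ℂ}

theorem IsAdaptedRay.add_ne_zero (hu : IsAdaptedRay α κ u) {c ρ t : ℝ} (hc : 0 < c) (hρ : 0 ≤ ρ)
    (ht : 0 < t) : (c + ρ * u : ℂ) ^ (α : ℂ) + t ≠ 0 :=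
  norm_pos_iff.1 ((mul_pos hu.pos ht).trans_le (hu.mul_le_norm c ρ t hc hρ ht))

theorem IsAdaptedRay.norm_inv_le (hu : IsAdaptedRay α κ u) {c ρ t : ℝ} (hc : 0 < c) (hρ : 0 ≤ ρ)
    (ht : 0 < t) : ‖((c + ρ * u : ℂ) ^ (α : ℂ) + t)⁻¹‖ ≤ (κ * t)⁻¹ := by
  rw [norm_inv]
  exact inv_anti₀ (mul_pos hu.pos ht) (hu.mul_le_norm c ρ t hc hρ ht)

theorem IsRayDirection.continuousOn_cpow (hu : IsRayDirection u) {c : ℝ} (hc : 0 < c) (p : ℝ) :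
    ContinuousOn (fun ρ : ℝ => (c + ρ * u : ℂ) ^ (p : ℂ)) (Ici 0) :=
  (IsRayDirection.continuous_ray u c).continuousOn.cpow_const fun _ hρ =>
    hu.mem_slitPlane hc hρ

theorem IsAdaptedRay.continuousOn_inv (hu : IsAdaptedRay α κ u) {c t : ℝ} (hc : 0 < c)
    (ht : 0 < t) : ContinuousOn (fun ρ : ℝ => ((c + ρ * u : ℂ) ^ (α : ℂ) + t)⁻¹) (Ici 0) :=
  ((hu.continuousOn_cpow hc α).add continuousOn_const).inv₀ fun _ hρ => hu.add_ne_zero hc hρ ht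

theorem continuous_exp_ray (u : ℂ) (c : ℝ) :
    Continuous (fun ρ : ℝ => Complex.exp (c + ρ * u)) :=
  Complex.continuous_exp.comp (IsRayDirection.continuous_ray u c)

theorem hasDerivAt_exp_mul_cpow_mul_inv {s : ℂ} (hs : s ∈ Complex.slitPlane) (p : ℝ) {t : ℝ}
    (h : s ^ (α : ℂ) + t ≠ 0) :
    HasDerivAt (fun s : ℂ => Complex.exp s * s ^ (p : ℂ) * (s ^ (α : ℂ) + t)⁻¹)
      ((Complex.exp s * s ^ (p : ℂ) + Complex.exp s * s ^ ((p - 1 : ℝ) : ℂ) * p)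
          * (s ^ (α : ℂ) + t)⁻¹
        + Complex.exp s * s ^ ((p + α - 1 : ℝ) : ℂ) * (-α * ((s ^ (α : ℂ) + t)⁻¹) ^ 2)) s := by
  have h1 : HasDerivAt (fun s : ℂ => s ^ (α : ℂ) + t) (α * s ^ ((α : ℂ) - 1)) s := by
    simpa using ((hasDerivAt_id s).cpow_const (c := (α : ℂ)) hs).add_const (t : ℂ)
  refine ((hasDerivAt_exp_mul_cpow hs p).mul (h1.fun_inv h)).congr_deriv ?_
  have h2 : s ^ ((p + α - 1 : ℝ) : ℂ) = s ^ (p : ℂ) * s ^ ((α : ℂ) - 1) := by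
    rw [← Complex.cpow_add _ _ (Complex.slitPlane_ne_zero hs)]; congr 1; push_cast; ring
  rw [h2, div_eq_mul_inv, inv_pow]
  ring

theorem rayIntegral_mlf_im_eq (hu : IsAdaptedRay α κ u) (p : ℝ) {t : ℝ} (ht : 0 < t)
    {c₁ c₂ : ℝ} (h₁ : 0 < c₁) (h₂ : 0 < c₂) :
    (rayIntegral u (fun s => Complex.exp s * s ^ (p : ℂ) * (s ^ (α : ℂ) + t)⁻¹) c₁).im
      = (rayIntegral u (fun s => Complex.exp s * s ^ (p : ℂ) * (s ^ (α : ℂ) + t)⁻¹) c₂).im := by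
  have hu' := hu.toIsRayDirection
  refine rayIntegral_im_eq hu' (F' := fun s =>
      (Complex.exp s * s ^ (p : ℂ) + Complex.exp s * s ^ ((p - 1 : ℝ) : ℂ) * p)
          * (s ^ (α : ℂ) + t)⁻¹
        + Complex.exp s * s ^ ((p + α - 1 : ℝ) : ℂ) * (-α * ((s ^ (α : ℂ) + t)⁻¹) ^ 2))
    (fun c ρ hc hρ => hasDerivAt_exp_mul_cpow_mul_inv (hu.mem_slitPlane hc hρ) p
      (hu.add_ne_zero hc hρ ht)) (fun c hc => ?_) ?_ ?_ (fun c hc => ?_) h₁ h₂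
  · have he := (continuous_exp_ray u c).continuousOn (s := Ici 0)
    have hi := hu.continuousOn_inv hc ht
    exact ((((he.mul (hu'.continuousOn_cpow hc p)).add
      ((he.mul (hu'.continuousOn_cpow hc (p - 1))).mul continuousOn_const)).mul hi).add
      ((he.mul (hu'.continuousOn_cpow hc (p + α - 1))).mul
        (continuousOn_const.mul (hi.pow 2)))).mul continuousOn_const
  · exact (RayDecay.exp_mul_cpow hu' p).mul_of_norm_le fun c ρ hc hρ => hu.norm_inv_le hc hρ ht
  · refine (((RayDecay.exp_mul_cpow hu' p).add
      ((RayDecay.exp_mul_cpow hu' (p - 1)).mul_const p)).mul_of_norm_le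
        fun c ρ hc hρ => hu.norm_inv_le hc hρ ht).add
      ((RayDecay.exp_mul_cpow hu' (p + α - 1)).mul_of_norm_le
        (M := |α| * ((κ * t)⁻¹) ^ 2) fun c ρ hc hρ => ?_)
    rw [norm_mul, norm_pow, norm_neg, Complex.norm_real, Real.norm_eq_abs]
    gcongr
    exact hu.norm_inv_le hc hρ ht
  · rw [← Complex.ofReal_cpow hc.le, ← Complex.ofReal_cpow hc.le, ← Complex.ofReal_exp,
      ← Complex.ofReal_add, ← Complex.ofReal_inv, ← Complex.ofReal_mul, ← Complex.ofReal_mul,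
      Complex.ofReal_im]

theorem hasSum_mlf_ray {s : ℂ} (hs : s ≠ 0) (β : ℝ) {t : ℝ} (ht : 0 ≤ t)
    (h : 2 * t ≤ ‖s ^ (α : ℂ)‖) (u : ℂ) :
    HasSum (fun n : ℕ => Complex.exp s * s ^ ((-(α * n + β) : ℝ) : ℂ) * u * (-t) ^ n)
      (Complex.exp s * s ^ ((α - β : ℝ) : ℂ) * (s ^ (α : ℂ) + t)⁻¹ * u) := by
  set B := s ^ (α : ℂ) with hB
  have hB0 : B ≠ 0 := by
    rw [hB, Ne, Complex.cpow_eq_zero_iff]; tauto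
  have hBn : 0 < ‖B‖ := norm_pos_iff.2 hB0
  have hx : ‖-(t : ℂ) * B⁻¹‖ < 1 := by
    rw [norm_mul, norm_neg, norm_inv, Complex.norm_of_nonneg ht, ← div_eq_mul_inv, div_lt_one hBn]
    linarith
  have hgeo := (hasSum_geometric_of_norm_lt_one hx).mul_left
    (Complex.exp s * s ^ ((-β : ℝ) : ℂ) * u)
  have hBt : B + t ≠ 0 := by
    intro h0
    have h1 : B = -(t : ℂ) := eq_neg_of_add_eq_zero_left h0
    rw [h1, norm_neg, Complex.norm_of_nonneg ht] at h hBn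
    linarith
  have hterm : ∀ n : ℕ, Complex.exp s * s ^ ((-(α * n + β) : ℝ) : ℂ) * u * (-t : ℂ) ^ n
      = Complex.exp s * s ^ ((-β : ℝ) : ℂ) * u * (-(t : ℂ) * B⁻¹) ^ n := by
    intro n
    have h1 : s ^ ((-(α * n + β) : ℝ) : ℂ) = s ^ ((-β : ℝ) : ℂ) * (B⁻¹) ^ n := by
      rw [hB, ← Complex.cpow_neg, ← Complex.cpow_mul_nat, ← Complex.cpow_add _ _ hs]
      congr 1; push_cast; ring
    rw [h1, mul_pow]
    ring
  have hval : Complex.exp s * s ^ ((α - β : ℝ) : ℂ) * (B + t)⁻¹ * u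
      = Complex.exp s * s ^ ((-β : ℝ) : ℂ) * u * (1 - -(t : ℂ) * B⁻¹)⁻¹ := by
    have h1 : s ^ ((α - β : ℝ) : ℂ) = s ^ ((-β : ℝ) : ℂ) * B := by
      rw [hB, ← Complex.cpow_add _ _ hs]
      congr 1; push_cast; ring
    have h2 : (1 - -(t : ℂ) * B⁻¹)⁻¹ = B * (B + t)⁻¹ := by
      have h3 : 1 - -(t : ℂ) * B⁻¹ = (B + t) * B⁻¹ := by field_simp; ring
      rw [h3, mul_inv, inv_inv, mul_comm]
    rw [h1, h2]
    ring
  rw [hval]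
  simp_rw [hterm]
  exact hgeo

/-- The contour representation of the Mittag-Leffler function on the negative half-line. -/
theorem pi_mul_mlfR_neg (hu : IsAdaptedRay α κ u) (hα : 0 < α) (β : ℝ) {t : ℝ} (ht : 0 < t)
    {c : ℝ} (hc : 0 < c) :
    Real.pi * mlfR α β (-t) = (rayIntegral u
      (fun s => Complex.exp s * s ^ ((α - β : ℝ) : ℂ) * (s ^ (α : ℂ) + t)⁻¹) c).im := by
  have hu' := hu.toIsRayDirection
  have him := hu.im_pos
  set c₀ : ℝ := (2 * t) ^ (α⁻¹) / u.im with hc₀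
  have hc₀pos : 0 < c₀ := by positivity
  rw [rayIntegral_mlf_im_eq hu (α - β) ht hc hc₀pos]
  have hlow : ∀ ρ : ℝ, 0 ≤ ρ → 2 * t ≤ ‖(c₀ + ρ * u : ℂ) ^ (α : ℂ)‖ := by
    intro ρ hρ
    rw [Complex.norm_cpow_real]
    have h1 := hu'.mul_im_le_norm' (ρ := ρ) hc₀pos.le
    have h2 : c₀ * u.im = (2 * t) ^ (α⁻¹) := by rw [hc₀]; field_simp
    rw [h2] at h1
    calc 2 * t = ((2 * t) ^ (α⁻¹)) ^ α := by
          rw [← Real.rpow_mul (by positivity), inv_mul_cancel₀ hα.ne', Real.rpow_one]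
      _ ≤ _ := Real.rpow_le_rpow (by positivity) h1 hα.le
  obtain ⟨K, hK⟩ := RayDecay.exp_mul_cpow hu' (-β) c₀ c₀ hc₀pos
  have hsum : HasSum (fun n : ℕ => ∫ ρ in Ioi (0 : ℝ), Complex.exp (c₀ + ρ * u)
        * (c₀ + ρ * u : ℂ) ^ ((-(α * n + β) : ℝ) : ℂ) * u * (-t : ℂ) ^ n)
      (rayIntegral u
        (fun s => Complex.exp s * s ^ ((α - β : ℝ) : ℂ) * (s ^ (α : ℂ) + t)⁻¹) c₀) := by
    refine hasSum_integral_of_dominated_convergence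
      (fun n ρ => K * Real.exp (u.re / 2 * ρ) * (1 / 2) ^ n) (fun n => ?_) (fun n => ?_) ?_ ?_ ?_
    · exact ((integrableOn_ray_exp_mul_cpow hu' _ hc₀pos).mul_const _).1
    · refine (ae_restrict_iff' measurableSet_Ioi).2 (ae_of_all _ fun ρ hρ => ?_)
      have hρ0 : (0 : ℝ) ≤ ρ := le_of_lt hρ
      have hs := Complex.slitPlane_ne_zero (hu'.mem_slitPlane hc₀pos hρ0)
      have h1 : (c₀ + ρ * u : ℂ) ^ ((-(α * n + β) : ℝ) : ℂ)
          = (c₀ + ρ * u : ℂ) ^ ((-β : ℝ) : ℂ) * (((c₀ + ρ * u : ℂ) ^ (α : ℂ))⁻¹) ^ n := by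
        rw [← Complex.cpow_neg, ← Complex.cpow_mul_nat, ← Complex.cpow_add _ _ hs]
        congr 1; push_cast; ring
      have h2 : Complex.exp (c₀ + ρ * u) * (c₀ + ρ * u : ℂ) ^ ((-(α * n + β) : ℝ) : ℂ) * u
          * (-t : ℂ) ^ n = Complex.exp (c₀ + ρ * u) * (c₀ + ρ * u : ℂ) ^ ((-β : ℝ) : ℂ) * u
            * (((c₀ + ρ * u : ℂ) ^ (α : ℂ))⁻¹ * -t) ^ n := by
        rw [h1, mul_pow]; ring
      rw [h2, norm_mul _ (_ ^ n), norm_mul _ u, hu.norm_eq_one, mul_one, norm_pow,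
        norm_mul _ (-(t : ℂ)), norm_inv, norm_neg,
        Complex.norm_of_nonneg ht.le]
      have h3 := hlow ρ hρ0
      have h4 : ‖(c₀ + ρ * u : ℂ) ^ (α : ℂ)‖⁻¹ * t ≤ 1 / 2 := by
        rw [inv_mul_le_iff₀ (by linarith)]; linarith
      have h5 := hK c₀ ⟨le_rfl, le_rfl⟩ ρ hρ0
      exact mul_le_mul h5 (pow_le_pow_left₀ (by positivity) h4 n) (by positivity)
        ((norm_nonneg _).trans h5)
    · exact ae_of_all _ fun ρ => summable_geometric_two.mul_left _
    · simp_rw [tsum_mul_left]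
      exact (integrableOn_exp_re_half hu' K).mul_const _
    · refine (ae_restrict_iff' measurableSet_Ioi).2 (ae_of_all _ fun ρ hρ => ?_)
      exact hasSum_mlf_ray (Complex.slitPlane_ne_zero (hu'.mem_slitPlane hc₀pos (le_of_lt hρ))) β
        ht.le (hlow ρ (le_of_lt hρ)) u
  have him' := Complex.hasSum_im hsum
  have hterm : ∀ n : ℕ, (∫ ρ in Ioi (0 : ℝ), Complex.exp (c₀ + ρ * u)
        * (c₀ + ρ * u : ℂ) ^ ((-(α * n + β) : ℝ) : ℂ) * u * (-t : ℂ) ^ n).im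
      = Real.pi * ((-t) ^ n / Real.Gamma (α * n + β)) := by
    intro n
    have h := hankel hu' (α * n + β) hc₀pos
    rw [rayIntegral] at h
    rw [integral_mul_const, show (-(t : ℂ)) ^ n = (((-t) ^ n : ℝ) : ℂ) by push_cast; rfl,
      Complex.im_mul_ofReal, h]
    ring
  simp_rw [hterm] at him'
  rw [← him'.tsum_eq, tsum_mul_left, mlfR]

end Representation

section Asymptotics

variable {α κ : ℝ} {u : ℂ}

theorem IsAdaptedRay.norm_ratio_le (hu : IsAdaptedRay α κ u) {c ρ t : ℝ} (hc : 0 < c)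
    (hρ : 0 ≤ ρ) (ht : 0 < t) : ‖(t : ℂ) * ((c + ρ * u : ℂ) ^ (α : ℂ) + t)⁻¹‖ ≤ κ⁻¹ := by
  have h := hu.norm_inv_le hc hρ ht
  rw [norm_mul, Complex.norm_of_nonneg ht.le]
  calc t * _ ≤ t * (κ * t)⁻¹ := by gcongr
    _ = κ⁻¹ := by field_simp

theorem IsAdaptedRay.tendsto_ratio (hu : IsAdaptedRay α κ u) {c ρ : ℝ} (hc : 0 < c)
    (hρ : 0 ≤ ρ) :
    Tendsto (fun t : ℝ => (t : ℂ) * ((c + ρ * u : ℂ) ^ (α : ℂ) + t)⁻¹) atTop (𝓝 1) := by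
  have h0 : Tendsto (fun t : ℝ => ((c + ρ * u : ℂ) ^ (α : ℂ) + t)⁻¹) atTop (𝓝 0) := by
    refine squeeze_zero_norm' (a := fun t => (κ * t)⁻¹) ?_
      (tendsto_inv_atTop_zero.comp (tendsto_id.const_mul_atTop hu.pos))
    filter_upwards [eventually_gt_atTop 0] with t ht using hu.norm_inv_le hc hρ ht
  have h1 : Tendsto (fun t : ℝ => 1 - (c + ρ * u : ℂ) ^ (α : ℂ)
      * ((c + ρ * u : ℂ) ^ (α : ℂ) + t)⁻¹) atTop (𝓝 1) := by
    simpa using tendsto_const_nhds.sub (h0.const_mul ((c + ρ * u : ℂ) ^ (α : ℂ)))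
  refine h1.congr' ?_
  filter_upwards [eventually_gt_atTop 0] with t ht
  have := hu.add_ne_zero hc hρ ht
  field_simp
  ring

theorem tendsto_rayIntegral_ratio (hu : IsAdaptedRay α κ u) (p : ℝ) (ε : ℂ) :
    Tendsto (fun q : ℝ × ℝ => rayIntegral u (fun s => Complex.exp s * s ^ (p : ℂ) *
        ((q.1 * (s ^ (α : ℂ) + q.1)⁻¹) * (q.2 * (s ^ (α : ℂ) + q.2)⁻¹) *
          (1 + ε * (s ^ (α : ℂ) * ((q.1 + q.2 : ℝ) : ℂ)⁻¹)))) 1)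
      (atTop ×ˢ atTop)
      (𝓝 (rayIntegral u (fun s => Complex.exp s * s ^ (p : ℂ)) 1)) := by
  have hu' := hu.toIsRayDirection
  have hκ := hu.pos
  obtain ⟨K, hK⟩ := RayDecay.exp_mul_cpow hu' p 1 1 one_pos
  obtain ⟨L, hL⟩ := RayDecay.exp_mul_cpow hu' (p + α) 1 1 one_pos
  have hpos : ∀ᶠ q : ℝ × ℝ in atTop ×ˢ atTop, 1 ≤ q.1 ∧ 1 ≤ q.2 :=
    (eventually_ge_atTop 1).prod_mk (eventually_ge_atTop 1)
  refine tendsto_integral_filter_of_dominated_convergence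
    (fun ρ => (K + ‖ε‖ * L) * (κ⁻¹ * κ⁻¹) * Real.exp (u.re / 2 * ρ)) ?_ ?_
    (integrableOn_exp_re_half hu' _) ?_
  · filter_upwards [hpos] with q hq
    have h1 := hu.continuousOn_inv one_pos (zero_lt_one.trans_le hq.1)
    have h2 := hu.continuousOn_inv one_pos (zero_lt_one.trans_le hq.2)
    have hB := hu'.continuousOn_cpow one_pos α
    have hp := hu'.continuousOn_cpow one_pos p
    have he := (continuous_exp_ray u 1).continuousOn (s := Ici 0)
    have hcont := ((he.mul hp).mul (((continuousOn_const (c := (q.1 : ℂ))).mul h1).mul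
      ((continuousOn_const (c := (q.2 : ℂ))).mul h2) |>.mul
      ((continuousOn_const (c := (1 : ℂ))).add ((continuousOn_const (c := ε)).mul
      (hB.mul (continuousOn_const (c := ((q.1 + q.2 : ℝ) : ℂ)⁻¹))))))).mul
      (continuousOn_const (c := u))
    exact (hcont.mono Ioi_subset_Ici_self).aestronglyMeasurable measurableSet_Ioi
  · filter_upwards [hpos] with q hq
    refine (ae_restrict_iff' measurableSet_Ioi).2 (ae_of_all _ fun ρ hρ => ?_)
    have hρ0 : (0 : ℝ) ≤ ρ := le_of_lt hρ
    have hs := Complex.slitPlane_ne_zero (hu'.mem_slitPlane one_pos hρ0)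
    have hr1 := hu.norm_ratio_le one_pos hρ0 (zero_lt_one.trans_le hq.1)
    have hr2 := hu.norm_ratio_le one_pos hρ0 (zero_lt_one.trans_le hq.2)
    have hKρ := hK 1 ⟨le_rfl, le_rfl⟩ ρ hρ0
    have hLρ := hL 1 ⟨le_rfl, le_rfl⟩ ρ hρ0
    simp only at hKρ hLρ
    set s : ℂ := ((1 : ℝ) : ℂ) + ρ * u with hs_def
    have hsplit : Complex.exp s * s ^ ((p + α : ℝ) : ℂ)
        = Complex.exp s * s ^ (p : ℂ) * s ^ (α : ℂ) := by
      rw [mul_assoc, ← Complex.cpow_add _ _ hs, Complex.ofReal_add]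
    have hinv : ‖((q.1 + q.2 : ℝ) : ℂ)⁻¹‖ ≤ 1 := by
      rw [norm_inv, Complex.norm_of_nonneg (by linarith [hq.1, hq.2])]
      exact inv_le_one_of_one_le₀ (by linarith [hq.1, hq.2])
    have hfac : ‖Complex.exp s * s ^ (p : ℂ) *
        (1 + ε * (s ^ (α : ℂ) * ((q.1 + q.2 : ℝ) : ℂ)⁻¹))‖
        ≤ (K + ‖ε‖ * L) * Real.exp (u.re / 2 * ρ) := by
      have h1 : Complex.exp s * s ^ (p : ℂ) * (1 + ε * (s ^ (α : ℂ) * ((q.1 + q.2 : ℝ) : ℂ)⁻¹))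
          = Complex.exp s * s ^ (p : ℂ) + ε * (Complex.exp s * s ^ ((p + α : ℝ) : ℂ)) *
            ((q.1 + q.2 : ℝ) : ℂ)⁻¹ := by
        rw [hsplit]; ring
      rw [h1]
      refine (norm_add_le _ _).trans ?_
      rw [norm_mul _ ((q.1 + q.2 : ℝ) : ℂ)⁻¹, norm_mul ε]
      have h2 : ‖ε‖ * ‖Complex.exp s * s ^ ((p + α : ℝ) : ℂ)‖ * ‖((q.1 + q.2 : ℝ) : ℂ)⁻¹‖
          ≤ ‖ε‖ * (L * Real.exp (u.re / 2 * ρ)) * 1 := by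
        have := (norm_nonneg _).trans hLρ
        gcongr
      linarith
    rw [norm_mul _ u, hu.norm_eq_one, mul_one]
    calc _ = ‖Complex.exp s * s ^ (p : ℂ) *
          (1 + ε * (s ^ (α : ℂ) * ((q.1 + q.2 : ℝ) : ℂ)⁻¹))‖ *
          (‖(q.1 : ℂ) * (s ^ (α : ℂ) + q.1)⁻¹‖ * ‖(q.2 : ℂ) * (s ^ (α : ℂ) + q.2)⁻¹‖) := by
          rw [← norm_mul, ← norm_mul]; congr 1; ring
      _ ≤ ((K + ‖ε‖ * L) * Real.exp (u.re / 2 * ρ)) * (κ⁻¹ * κ⁻¹) := by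
          have := (norm_nonneg _).trans hfac
          gcongr
      _ = _ := by ring
  · refine (ae_restrict_iff' measurableSet_Ioi).2 (ae_of_all _ fun ρ hρ => ?_)
    have hρ0 : (0 : ℝ) ≤ ρ := le_of_lt hρ
    have hr := hu.tendsto_ratio one_pos hρ0
    have hr1 := hr.comp (tendsto_fst (f := (atTop : Filter ℝ)) (g := (atTop : Filter ℝ)))
    have hr2 := hr.comp (tendsto_snd (f := (atTop : Filter ℝ)) (g := (atTop : Filter ℝ)))
    have hadd : Tendsto (fun q : ℝ × ℝ => q.1 + q.2) (atTop ×ˢ atTop) atTop :=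
      tendsto_fst.atTop_add_atTop tendsto_snd
    have hinv : Tendsto (fun q : ℝ × ℝ => ((q.1 + q.2 : ℝ) : ℂ)⁻¹) (atTop ×ˢ atTop) (𝓝 0) := by
      have h1 := (Complex.continuous_ofReal.tendsto' 0 0 (by simp)).comp
        (tendsto_inv_atTop_zero.comp hadd)
      refine h1.congr fun q => ?_
      simp
    have h := ((hr1.mul hr2).mul
      (((hinv.const_mul ((((1 : ℝ) : ℂ) + ρ * u) ^ (α : ℂ))).const_mul ε).const_add 1)).const_mul
      (Complex.exp (((1 : ℝ) : ℂ) + ρ * u) * (((1 : ℝ) : ℂ) + ρ * u) ^ (p : ℂ)) |>.mul_const u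
    simpa using h

/-- The difference quotient of `t ↦ π E_{α,β}(-t)`, up to sign, as a contour integral. -/
noncomputable def mlfQuotient (α β : ℝ) (u : ℂ) (q : ℝ × ℝ) : ℝ :=
  (rayIntegral u (fun s => Complex.exp s * s ^ ((α - β : ℝ) : ℂ) *
    ((s ^ (α : ℂ) + q.1)⁻¹ * (s ^ (α : ℂ) + q.2)⁻¹)) 1).im

theorem IsAdaptedRay.integrableOn_mul_inv (hu : IsAdaptedRay α κ u) (p : ℝ) {t : ℝ}
    (ht : 0 < t) :
    IntegrableOn (fun ρ : ℝ => Complex.exp ((1 : ℝ) + ρ * u) *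
      ((1 : ℝ) + ρ * u : ℂ) ^ (p : ℂ) * (((1 : ℝ) + ρ * u : ℂ) ^ (α : ℂ) + t)⁻¹ * u) (Ioi 0) := by
  have hu' := hu.toIsRayDirection
  refine integrableOn_ray
    (F := fun s => Complex.exp s * s ^ (p : ℂ) * (s ^ (α : ℂ) + t)⁻¹) hu' one_pos
    ((RayDecay.exp_mul_cpow hu' p).mul_of_norm_le fun c ρ hc hρ => hu.norm_inv_le hc hρ ht) ?_
  exact (((continuous_exp_ray u 1).continuousOn.mul (hu'.continuousOn_cpow one_pos p)).mul
    (hu.continuousOn_inv one_pos ht)).mul continuousOn_const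

theorem pi_mul_mlfR_sub (hu : IsAdaptedRay α κ u) (hα : 0 < α) (β : ℝ) {t₁ t₂ : ℝ}
    (h₁ : 0 < t₁) (h₂ : 0 < t₂) :
    Real.pi * (mlfR α β (-t₁) - mlfR α β (-t₂))
      = (t₂ - t₁) * mlfQuotient α β u (t₁, t₂) := by
  rw [mul_sub, pi_mul_mlfR_neg hu hα β h₁ one_pos, pi_mul_mlfR_neg hu hα β h₂ one_pos,
    ← Complex.sub_im, mlfQuotient, ← Complex.im_ofReal_mul]
  congr 1
  simp only [rayIntegral]
  rw [← integral_sub (hu.integrableOn_mul_inv _ h₁) (hu.integrableOn_mul_inv _ h₂),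
    ← integral_const_mul]
  refine setIntegral_congr_fun measurableSet_Ioi fun ρ hρ => ?_
  have hn1 := hu.add_ne_zero one_pos (le_of_lt hρ) h₁
  have hn2 := hu.add_ne_zero one_pos (le_of_lt hρ) h₂
  rw [← sub_mul, ← mul_sub, inv_sub_inv hn1 hn2]
  push_cast
  rw [div_eq_mul_inv, mul_inv]
  ring

theorem tendsto_mlfQuotient (hu : IsAdaptedRay α κ u) (β : ℝ) :
    Tendsto (fun q : ℝ × ℝ => q.1 * q.2 * mlfQuotient α β u q) (atTop ×ˢ atTop)
      (𝓝 (Real.pi * (Real.Gamma (β - α))⁻¹)) := by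
  have h := (Complex.continuous_im.tendsto _).comp (tendsto_rayIntegral_ratio hu (α - β) 0)
  have hval := hankel hu.toIsRayDirection (β - α) one_pos
  rw [neg_sub] at hval
  rw [hval] at h
  refine h.congr fun q => ?_
  rw [Function.comp_apply, mlfQuotient, ← Complex.im_ofReal_mul]
  congr 1
  simp only [rayIntegral]
  rw [← integral_const_mul]
  congr 1
  ext ρ
  push_cast
  ring

theorem tendsto_mlfQuotient_self (hu : IsAdaptedRay α κ u) :
    Tendsto (fun q : ℝ × ℝ => q.1 * q.2 / (q.1 + q.2) * (q.1 * q.2 * mlfQuotient α α u q))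
      (atTop ×ˢ atTop) (𝓝 (-(Real.pi * (Real.Gamma (-α))⁻¹))) := by
  have hu' := hu.toIsRayDirection
  have h := ((Complex.continuous_im.tendsto _).comp (tendsto_rayIntegral_ratio hu α 1)).neg
  have hval := hankel hu' (-α) one_pos
  rw [neg_neg] at hval
  rw [hval] at h
  have hzero : (rayIntegral u (fun s => Complex.exp s * s ^ ((-0 : ℝ) : ℂ)) 1).im = 0 := by
    simpa using hankel hu' 0 one_pos
  refine h.congr' ?_
  filter_upwards [(eventually_gt_atTop (0 : ℝ)).prod_mk (eventually_gt_atTop (0 : ℝ))] with q hq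
  obtain ⟨h₁, h₂⟩ := hq
  have hdecay : RayDecay u (fun s => Complex.exp s * s ^ ((-0 : ℝ) : ℂ) *
      (s ^ (α : ℂ) + q.1)⁻¹ * (s ^ (α : ℂ) + q.2)⁻¹) :=
    ((RayDecay.exp_mul_cpow hu' (-0)).mul_of_norm_le
      fun c ρ hc hρ => hu.norm_inv_le hc hρ h₁).mul_of_norm_le
      fun c ρ hc hρ => hu.norm_inv_le hc hρ h₂
  have hint := integrableOn_ray hu' one_pos hdecay
    (((((continuous_exp_ray u 1).continuousOn.mul (hu'.continuousOn_cpow one_pos (-0))).mul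
      (hu.continuousOn_inv one_pos h₁)).mul (hu.continuousOn_inv one_pos h₂)).mul
      continuousOn_const)
  have hint₀ := integrableOn_ray_exp_mul_cpow hu' (-0) one_pos
  set r : ℝ := q.1 * q.2 / (q.1 + q.2) with hr
  have key : rayIntegral u (fun s => Complex.exp s * s ^ (α : ℂ) *
        ((q.1 * (s ^ (α : ℂ) + q.1)⁻¹) * (q.2 * (s ^ (α : ℂ) + q.2)⁻¹) *
          (1 + 1 * (s ^ (α : ℂ) * ((q.1 + q.2 : ℝ) : ℂ)⁻¹)))) 1
      = (r : ℂ) * rayIntegral u (fun s => Complex.exp s * s ^ ((-0 : ℝ) : ℂ)) 1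
        - ((r * (q.1 * q.2) : ℝ) : ℂ) * rayIntegral u (fun s => Complex.exp s *
          s ^ ((α - α : ℝ) : ℂ) * ((s ^ (α : ℂ) + q.1)⁻¹ * (s ^ (α : ℂ) + q.2)⁻¹)) 1 := by
    simp only [rayIntegral, sub_self, ← mul_assoc]
    simp only [neg_zero] at hint hint₀ ⊢
    rw [← integral_const_mul, ← integral_const_mul, ← integral_sub]
    · refine setIntegral_congr_fun measurableSet_Ioi fun ρ hρ => ?_
      have hn1 := hu.add_ne_zero one_pos (le_of_lt hρ) h₁
      have hn2 := hu.add_ne_zero one_pos (le_of_lt hρ) h₂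
      have hn3 : (q.1 : ℂ) + q.2 ≠ 0 := by
        rw [← Complex.ofReal_add]
        exact Complex.ofReal_ne_zero.2 (add_pos h₁ h₂).ne'
      simp only [hr, Complex.ofReal_zero, Complex.cpow_zero]
      push_cast at hn1 hn2 ⊢
      field_simp
      ring
    · exact hint₀.const_mul _
    · exact hint.const_mul _
  simp only [Function.comp_apply]
  rw [key, Complex.sub_im, Complex.im_ofReal_mul, Complex.im_ofReal_mul, hzero, mlfQuotient]
  ring

end Asymptotics

theorem exists_forall_mlfQuotient_sign {α β κ : ℝ} {u : ℂ} (hu : IsAdaptedRay α κ u)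
    (hα1 : 1 < α) (hα2 : α < 2) (hβ : 1 ≤ β) :
    ∃ T : ℝ, 0 < T ∧ ((∀ t₁ t₂, T ≤ t₁ → T ≤ t₂ → 0 ≤ mlfQuotient α β u (t₁, t₂)) ∨
      ∀ t₁ t₂, T ≤ t₁ → T ≤ t₂ → mlfQuotient α β u (t₁, t₂) ≤ 0) := by
  obtain ⟨w, L, hw, hL, hlim⟩ : ∃ (w : ℝ × ℝ → ℝ) (L : ℝ),
      (∀ q : ℝ × ℝ, 0 < q.1 → 0 < q.2 → 0 < w q) ∧ L ≠ 0 ∧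
      Tendsto (fun q => w q * mlfQuotient α β u q) (atTop ×ˢ atTop) (𝓝 L) := by
    rcases eq_or_ne β α with rfl | hne
    · refine ⟨fun q => q.1 * q.2 / (q.1 + q.2) * (q.1 * q.2), _,
        fun q h₁ h₂ => by positivity, ?_, (tendsto_mlfQuotient_self hu).congr fun q => by ring⟩
      refine neg_ne_zero.2 (mul_ne_zero Real.pi_ne_zero (inv_ne_zero (Real.Gamma_ne_zero ?_)))
      intro m hm
      have h1 : (1 : ℝ) < m := by linarith
      have h2 : (m : ℝ) < 2 := by linarith
      norm_cast at h1 h2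
      omega
    · refine ⟨fun q => q.1 * q.2, _, fun q h₁ h₂ => by positivity, ?_, tendsto_mlfQuotient hu β⟩
      refine mul_ne_zero Real.pi_ne_zero (inv_ne_zero (Real.Gamma_ne_zero ?_))
      intro m hm
      have h1 : (m : ℝ) < 1 := by linarith
      norm_cast at h1
      obtain rfl : m = 0 := by omega
      exact hne (by simpa [sub_eq_zero] using hm)
  rw [prod_atTop_atTop_eq] at hlim
  rcases hL.lt_or_gt with hneg | hpos
  · obtain ⟨⟨a, b⟩, hab⟩ := eventually_atTop.1 (hlim.eventually_lt_const hneg)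
    refine ⟨max 1 (max a b), by positivity, Or.inr fun t₁ t₂ h₁ h₂ => ?_⟩
    simp only [max_le_iff] at h₁ h₂
    have h := hab (t₁, t₂) ⟨h₁.2.1, h₂.2.2⟩
    exact (neg_of_mul_neg_right h (hw (t₁, t₂) (by linarith) (by linarith)).le).le
  · obtain ⟨⟨a, b⟩, hab⟩ := eventually_atTop.1 (hlim.eventually_const_lt hpos)
    refine ⟨max 1 (max a b), by positivity, Or.inl fun t₁ t₂ h₁ h₂ => ?_⟩
    simp only [max_le_iff] at h₁ h₂
    have h := hab (t₁, t₂) ⟨h₁.2.1, h₂.2.2⟩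
    exact ((pos_iff_pos_of_mul_pos h).1 (hw (t₁, t₂) (by linarith) (by linarith))).le

theorem mlf_eventually_monotone (α β : ℝ) (hα1 : 1 < α) (hα2 : α < 2) (hβ : 1 ≤ β) :
    ∃ T : ℝ, 0 ≤ T ∧
      (MonotoneOn (fun t : ℝ => mlfR α β (-t)) (Set.Ici T) ∨
       AntitoneOn (fun t : ℝ => mlfR α β (-t)) (Set.Ici T)) := by
  obtain ⟨κ, u, hu⟩ := exists_isAdaptedRay hα1 hα2
  obtain ⟨T, hT, hsign⟩ := exists_forall_mlfQuotient_sign hu hα1 hα2 hβ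
  have hsub : ∀ t₁ t₂, T ≤ t₁ → T ≤ t₂ → Real.pi * (mlfR α β (-t₁) - mlfR α β (-t₂))
      = (t₂ - t₁) * mlfQuotient α β u (t₁, t₂) := fun t₁ t₂ h₁ h₂ =>
    pi_mul_mlfR_sub hu (by linarith) β (hT.trans_le h₁) (hT.trans_le h₂)
  refine ⟨T, hT.le, hsign.symm.imp (fun h t₁ h₁ t₂ h₂ h₁₂ => ?_) fun h t₁ h₁ t₂ h₂ h₁₂ => ?_⟩
  · have := mul_nonpos_of_nonneg_of_nonpos (sub_nonneg.2 h₁₂) (h t₁ t₂ h₁ h₂)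
    rw [← hsub t₁ t₂ h₁ h₂] at this
    exact sub_nonpos.1 (nonpos_of_mul_nonpos_right this Real.pi_pos)
  · have := mul_nonneg (sub_nonneg.2 h₁₂) (h t₁ t₂ h₁ h₂)
    rw [← hsub t₁ t₂ h₁ h₂] at this
    exact sub_nonneg.1 (nonneg_of_mul_nonneg_right this Real.pi_pos)
end

section
/- For all real α with 0 < α ≤ 1 and real β ≥ α, the function t ↦ E_{α,β}(−t) is completely monotone on [0, ∞): for every natural number n and every t ≥ 0, (−1)^n times the n-th derivative of t ↦ E_{α,β}(−t) at t is nonnegative. -/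
open Filter Topology Finset MeasureTheory

/-- A sequence `m` is Stieltjes positive if the linear functional `X ^ k ↦ m k` is nonnegative on
all real polynomials that are nonnegative on `[0, ∞)`. -/
def StieltjesPositive (m : ℕ → ℝ) : Prop :=
  ∀ (N : ℕ) (a : ℕ → ℝ), (∀ x : ℝ, 0 ≤ x → 0 ≤ ∑ k ∈ range N, a k * x ^ k) →
    0 ≤ ∑ k ∈ range N, a k * m k

namespace StieltjesPositive

theorem one : StieltjesPositive fun _ => 1 := fun N a h => by
  simpa using h 1 zero_le_one

theorem const_mul {m : ℕ → ℝ} (hm : StieltjesPositive m) {C : ℝ} (hC : 0 ≤ C) :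
    StieltjesPositive fun k => C * m k := fun N a h => by
  have := mul_nonneg hC (hm N a h)
  rw [mul_sum] at this
  exact this.trans_eq (sum_congr rfl fun k _ => by ring)

theorem pow_mul {m : ℕ → ℝ} (hm : StieltjesPositive m) {D : ℝ} (hD : 0 ≤ D) :
    StieltjesPositive fun k => D ^ k * m k := fun N a h => by
  have := hm N (fun k => a k * D ^ k) fun x hx =>
    (h (D * x) (mul_nonneg hD hx)).trans_eq (sum_congr rfl fun k _ => by ring)
  exact this.trans_eq (sum_congr rfl fun k _ => by ring)

theorem shift {m : ℕ → ℝ} (hm : StieltjesPositive m) (n : ℕ) :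
    StieltjesPositive fun k => m (k + n) := by
  induction n with
  | zero => exact hm
  | succ n ih =>
    intro N a h
    have := ih (N + 1) (fun k => if k = 0 then 0 else a (k - 1)) fun x hx => by
      rw [sum_range_succ']
      refine (mul_nonneg hx (h x hx)).trans_eq ?_
      rw [mul_sum]
      simp only [Nat.succ_ne_zero, if_true, if_false, Nat.add_sub_cancel, zero_mul, add_zero]
      exact sum_congr rfl fun k _ => by ring
    rw [sum_range_succ'] at this
    simp only [Nat.succ_ne_zero, if_true, if_false, Nat.add_sub_cancel, zero_mul, add_zero] at this
    exact this.trans_eq (sum_congr rfl fun k _ => by rw [add_right_comm, add_assoc])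

theorem of_tendsto {M : ℕ → ℕ → ℝ} {m : ℕ → ℝ} (hM : ∀ᶠ N in atTop, StieltjesPositive (M N))
    (h : ∀ k, Tendsto (fun N => M N k) atTop (𝓝 (m k))) : StieltjesPositive m := fun N a ha =>
  ge_of_tendsto (tendsto_finsetSum _ fun k _ => (h k).const_mul (a k))
    (hM.mono fun _ hj => hj N a ha)

theorem mul_div_add {m : ℕ → ℝ} (hm : StieltjesPositive m) {α c : ℝ} {j : ℕ} (hα : 0 ≤ α)
    (hc : α * (j + 1) ≤ c) :
    StieltjesPositive fun k => (α * k + c) / (k + 1 + j) * m k := fun N a h => by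
  have key := hm N (fun k => a k * ((α * k + c) / (k + 1 + j))) fun x hx => by
    have h_int : 0 ≤ ∫ u in (0 : ℝ)..1, ∑ k ∈ range N, a k * x ^ k * u ^ (k + j) := by
      refine intervalIntegral.integral_nonneg zero_le_one fun u hu => ?_
      refine (mul_nonneg (pow_nonneg hu.1 j) (h (u * x) (mul_nonneg hu.1 hx))).trans_eq ?_
      rw [mul_sum]
      exact sum_congr rfl fun k _ => by ring
    rw [intervalIntegral.integral_finsetSum fun k _ =>
      Continuous.intervalIntegrable (by fun_prop) _ _] at h_int
    simp only [intervalIntegral.integral_const_mul, integral_pow] at h_int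
    refine (add_nonneg (mul_nonneg hα (h x hx))
      (mul_nonneg (sub_nonneg.2 hc) h_int)).trans_eq ?_
    rw [mul_sum, mul_sum, ← sum_add_distrib]
    refine sum_congr rfl fun k _ => ?_
    have : (k : ℝ) + 1 + j ≠ 0 := by positivity
    have h' : (k : ℝ) + j + 1 ≠ 0 := by positivity
    push_cast
    simp only [one_pow, ne_eq, Nat.add_eq_zero_iff, one_ne_zero, and_false, not_false_eq_true,
      zero_pow, sub_zero]
    field_simp
    ring
  exact key.trans_eq (sum_congr rfl fun k _ => by ring)

theorem prod_div_add {α β : ℝ} (hα0 : 0 ≤ α) (hα1 : α ≤ 1) (hβ : α ≤ β) (n : ℕ) :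
    StieltjesPositive fun k => ∏ j ∈ range n, (α * k + β + j) / (k + 1 + j) := by
  induction n with
  | zero => simpa using one
  | succ n ih =>
    have hn : α * (n + 1) ≤ β + n := by nlinarith [mul_le_mul_of_nonneg_right hα1 n.cast_nonneg]
    have := ih.mul_div_add hα0 hn
    simpa only [prod_range_succ, mul_comm, add_assoc] using this

end StieltjesPositive

theorem gammaSeq_div_gammaSeq {α β : ℝ} (hα : 0 < α) (hβ : 0 < β) {n : ℕ} (hn : 0 < n) (k : ℕ) :
    Real.GammaSeq (k + 1) n / Real.GammaSeq (α * k + β) n =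
      (n : ℝ) ^ (1 - β) * (((n : ℝ) ^ (1 - α)) ^ k *
        ∏ j ∈ range (n + 1), (α * k + β + j) / (k + 1 + j)) := by
  have hn' : (0 : ℝ) < n := by exact_mod_cast hn
  have h1 : ∏ j ∈ range (n + 1), ((k : ℝ) + 1 + j) ≠ 0 :=
    prod_ne_zero_iff.2 fun j _ => by positivity
  have h2 : ∏ j ∈ range (n + 1), (α * k + β + j) ≠ 0 :=
    prod_ne_zero_iff.2 fun j _ => by positivity
  have h3 : (n : ℝ) ^ ((k : ℝ) + 1) =
      (n : ℝ) ^ (1 - β) * ((n : ℝ) ^ (1 - α)) ^ k * (n : ℝ) ^ (α * k + β) := by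
    rw [← Real.rpow_natCast, ← Real.rpow_mul hn'.le, ← Real.rpow_add hn', ← Real.rpow_add hn']
    congr 1
    ring
  rw [prod_div_distrib, Real.GammaSeq, Real.GammaSeq, h3]
  have h4 : (n : ℝ) ^ (α * k + β) ≠ 0 := (Real.rpow_pos_of_pos hn' _).ne'
  have h5 : (n.factorial : ℝ) ≠ 0 := by positivity
  field_simp

theorem stieltjesPositive_factorial_div_gamma {α β : ℝ} (hα0 : 0 < α) (hα1 : α ≤ 1) (hβ : α ≤ β) :
    StieltjesPositive fun k => (k.factorial : ℝ) / Real.Gamma (α * k + β) := by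
  have hβ0 := hα0.trans_le hβ
  refine .of_tendsto
    (M := fun n k => Real.GammaSeq (k + 1) n / Real.GammaSeq (α * k + β) n) ?_ fun k => ?_
  · filter_upwards [eventually_gt_atTop 0] with n hn
    simp only [gammaSeq_div_gammaSeq hα0 hβ0 hn]
    exact ((StieltjesPositive.prod_div_add hα0.le hα1 hβ _).pow_mul (by positivity)).const_mul
      (by positivity)
  · rw [← Real.Gamma_nat_eq_factorial]
    exact (Real.GammaSeq_tendsto_Gamma _).div (Real.GammaSeq_tendsto_Gamma _)
      (Real.Gamma_pos_of_pos (by positivity)).ne'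

theorem neg_one_pow_mul_exp_taylor_sub_nonneg (n : ℕ) {y : ℝ} (hy : 0 ≤ y) :
    0 ≤ (-1) ^ n * (∑ k ∈ range (n + 1), (-y) ^ k / k.factorial - Real.exp (-y)) := by
  induction n generalizing y with
  | zero => simpa using hy
  | succ n ih =>
    have hd : ∀ z : ℝ, HasDerivAt (fun y : ℝ => (-1) ^ (n + 1) *
        (∑ k ∈ range (n + 1 + 1), (-y) ^ k / k.factorial - Real.exp (-y)))
        ((-1) ^ n * (∑ k ∈ range (n + 1), (-z) ^ k / k.factorial - Real.exp (-z))) z := by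
      intro z
      have hs : HasDerivAt (fun y : ℝ => ∑ k ∈ range (n + 1 + 1), (-y) ^ k / k.factorial)
          (∑ k ∈ range (n + 1 + 1), (k * (-z) ^ (k - 1) * (-1)) / k.factorial) z :=
        HasDerivAt.fun_sum fun k _ => ((hasDerivAt_neg z).pow k).div_const _
      have he : HasDerivAt (fun y : ℝ => Real.exp (-y)) (Real.exp (-z) * (-1)) z :=
        (hasDerivAt_neg z).exp
      refine ((hs.sub he).const_mul ((-1) ^ (n + 1))).congr_deriv ?_
      rw [sum_range_succ']
      have : ∑ k ∈ range (n + 1), (((k + 1 : ℕ) : ℝ) * (-z) ^ (k + 1 - 1) * (-1)) /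
          (k + 1).factorial = -∑ k ∈ range (n + 1), (-z) ^ k / k.factorial := by
        rw [← sum_neg_distrib]
        refine sum_congr rfl fun k _ => ?_
        rw [Nat.factorial_succ]
        push_cast
        have : (k.factorial : ℝ) ≠ 0 := by positivity
        have : (k : ℝ) + 1 ≠ 0 := by positivity
        field_simp
      rw [this]
      simp
      ring
    have hmono := monotoneOn_of_hasDerivWithinAt_nonneg (convex_Ici (0 : ℝ))
      (fun z _ => (hd z).continuousAt.continuousWithinAt)
      (fun z _ => (hd z).hasDerivWithinAt)
      (fun z hz => ih (interior_subset hz))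
    refine le_trans ?_ (hmono (Set.mem_Ici.2 le_rfl) (Set.mem_Ici.2 hy) hy)
    simp [sum_range_succ']

theorem sum_range_exp_neg_nonneg (K : ℕ) {y : ℝ} (hy : 0 ≤ y) :
    0 ≤ ∑ k ∈ range (2 * K + 1), (-y) ^ k / k.factorial := by
  have := neg_one_pow_mul_exp_taylor_sub_nonneg (2 * K) hy
  rw [pow_mul, neg_one_sq, one_pow, one_mul] at this
  linarith [Real.exp_pos (-y)]

theorem StieltjesPositive.tsum_nonneg {m : ℕ → ℝ} (hm : StieltjesPositive m) {t : ℝ} (ht : 0 ≤ t)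
    (hs : Summable fun k => m k * (-t) ^ k / k.factorial) :
    0 ≤ ∑' k, m k * (-t) ^ k / k.factorial := by
  have hlim := hs.hasSum.tendsto_sum_nat.comp
    (tendsto_atTop_mono (fun K : ℕ => (by simp only [id]; omega : id K ≤ 2 * K + 1)) tendsto_id)
  refine ge_of_tendsto' hlim fun K => ?_
  have := hm (2 * K + 1) (fun k => (-t) ^ k / k.factorial) fun x hx =>
    (sum_range_exp_neg_nonneg K (mul_nonneg ht hx)).trans_eq (sum_congr rfl fun k _ => by
      rw [← neg_mul, mul_pow]; ring)
  exact this.trans_eq (sum_congr rfl fun k _ => by ring)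

theorem summable_shift_egf {c : ℕ → ℝ} (hc : ∀ r : ℝ, Summable fun k => c k * r ^ k / k.factorial)
    (r : ℝ) : Summable fun k => c (k + 1) * r ^ k / k.factorial := by
  have h := ((summable_nat_add_iff 1).2 (hc (2 * (|r| + 1)))).norm
  refine Summable.of_norm_bounded h fun k => ?_
  have hk : ((k : ℝ) + 1) * |r| ^ k ≤ (2 * (|r| + 1)) ^ (k + 1) := by
    rw [mul_pow]
    refine mul_le_mul ?_ ?_ (by positivity) (by positivity)
    · exact_mod_cast (Nat.lt_two_pow_self (n := k + 1)).le
    · calc |r| ^ k ≤ (|r| + 1) ^ k := by gcongr; linarith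
        _ ≤ (|r| + 1) ^ (k + 1) := pow_le_pow_right₀ (by linarith [abs_nonneg r]) k.le_succ
  have h0 : |(|r| + 1)| = |r| + 1 := abs_of_nonneg (by positivity)
  simp only [norm_div, norm_mul, norm_pow, Real.norm_eq_abs, Nat.abs_cast, abs_two, h0]
  rw [Nat.factorial_succ, div_le_div_iff₀ (by positivity) (by positivity)]
  push_cast
  calc _ = |c (k + 1)| * (((k : ℝ) + 1) * |r| ^ k) * k.factorial := by ring
    _ ≤ _ := by gcongr

theorem hasDerivAt_egf {c : ℕ → ℝ} (hc : ∀ r : ℝ, Summable fun k => c k * r ^ k / k.factorial)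
    (x : ℝ) : HasDerivAt (fun x => ∑' k, c k * x ^ k / k.factorial)
      (∑' k, c (k + 1) * x ^ k / k.factorial) x := by
  have hterm : ∀ (k : ℕ) (y : ℝ), HasDerivAt (fun x => c (k + 1) * x ^ (k + 1) / (k + 1).factorial)
      (c (k + 1) * y ^ k / k.factorial) y := fun k y => by
    refine (((hasDerivAt_pow (k + 1) y).const_mul (c (k + 1))).div_const _).congr_deriv ?_
    rw [Nat.factorial_succ]
    push_cast
    have : (k.factorial : ℝ) ≠ 0 := by positivity
    have : (k : ℝ) + 1 ≠ 0 := by positivity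
    field_simp
  have hmem : x ∈ Metric.ball (0 : ℝ) (|x| + 1) := by simp
  have h := hasDerivAt_tsum_of_isPreconnected (summable_shift_egf hc (|x| + 1)).norm
    Metric.isOpen_ball (convex_ball (0 : ℝ) (|x| + 1)).isPreconnected
    (fun k y _ => hterm k y) (fun k y hy => ?_) hmem ((summable_nat_add_iff 1).2 (hc x)) hmem
  · have heq : (fun x => ∑' k, c k * x ^ k / k.factorial) =
        fun x => c 0 + ∑' k, c (k + 1) * x ^ (k + 1) / (k + 1).factorial := by
      ext y
      rw [(hc y).tsum_eq_zero_add]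
      simp
    rw [heq]
    exact h.const_add _
  · have hy' : |y| ≤ |(|x| + 1)| := by
      rw [abs_of_nonneg (by positivity : 0 ≤ |x| + 1)]
      simpa using (mem_ball_zero_iff.1 hy).le
    simp only [norm_div, norm_mul, norm_pow, Real.norm_eq_abs]
    gcongr

theorem summable_shift_egf_iterate {c : ℕ → ℝ}
    (hc : ∀ r : ℝ, Summable fun k => c k * r ^ k / k.factorial) (n : ℕ) (r : ℝ) :
    Summable fun k => c (k + n) * r ^ k / k.factorial := by
  induction n generalizing r with
  | zero => exact hc r
  | succ n ih => simpa only [add_assoc, add_comm 1 n] using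
      summable_shift_egf (c := fun k => c (k + n)) ih r

theorem iteratedDeriv_egf_neg {c : ℕ → ℝ}
    (hc : ∀ r : ℝ, Summable fun k => c k * r ^ k / k.factorial) (n : ℕ) :
    iteratedDeriv n (fun t : ℝ => ∑' k, c k * (-t) ^ k / k.factorial) =
      fun t => (-1) ^ n * ∑' k, c (k + n) * (-t) ^ k / k.factorial := by
  induction n with
  | zero => simp
  | succ n ih =>
    ext t
    rw [iteratedDeriv_succ, ih]
    have h := hasDerivAt_egf (c := fun k => c (k + n)) (summable_shift_egf_iterate hc n) (-t)
    have h' := ((h.comp t (hasDerivAt_neg t)).const_mul ((-1) ^ n)).deriv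
    refine h'.trans ?_
    simp only [add_assoc, add_comm 1 n]
    ring

theorem Real.rpow_mul_exp_neg_le_Gamma {x R : ℝ} (hx : 1 ≤ x) (hR : 0 < R) :
    R ^ (x - 1) * Real.exp (-R) ≤ Real.Gamma x := by
  have h_int := Real.GammaIntegral_convergent (zero_lt_one.trans_le hx)
  rw [Real.Gamma_eq_integral (zero_lt_one.trans_le hx), ← integral_exp_neg_Ioi R,
    ← integral_const_mul]
  have hsub : Set.Ioi R ⊆ Set.Ioi 0 := Set.Ioi_subset_Ioi hR.le
  calc ∫ u in Set.Ioi R, R ^ (x - 1) * Real.exp (-u)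
      ≤ ∫ u in Set.Ioi R, Real.exp (-u) * u ^ (x - 1) := by
        refine setIntegral_mono_on ((integrableOn_exp_neg_Ioi R).const_mul _)
          (h_int.mono_set hsub) measurableSet_Ioi fun u hu => ?_
        rw [mul_comm]
        gcongr
        exact (Set.mem_Ioi.1 hu).le
    _ ≤ _ := by
        refine setIntegral_mono_set h_int ?_ hsub.eventuallyLE
        filter_upwards [ae_restrict_mem measurableSet_Ioi] with u hu
        have : (0 : ℝ) < u := hu
        positivity

theorem summable_pow_div_gamma {α β : ℝ} (hα : 0 < α) (hβ : 0 < β) (r : ℝ) :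
    Summable fun k : ℕ => r ^ k / Real.Gamma (α * k + β) := by
  set R : ℝ := (2 * (|r| + 1)) ^ (1 / α) with hR
  have hR0 : 0 < R := by positivity
  have hRα : R ^ α = 2 * (|r| + 1) := by
    rw [hR, ← Real.rpow_mul (by positivity), one_div_mul_cancel hα.ne', Real.rpow_one]
  refine Summable.of_norm_bounded_eventually_nat
    (g := fun k : ℕ => (Real.exp R * R ^ (1 - β)) * (1 / 2 : ℝ) ^ k)
    (summable_geometric_two.mul_left _) ?_
  have hev : ∀ᶠ k : ℕ in atTop, 1 ≤ α * k + β := by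
    filter_upwards [(tendsto_natCast_atTop_atTop (R := ℝ)).eventually_ge_atTop (1 / α)] with k hk
    have := (div_le_iff₀ hα).1 hk
    linarith
  filter_upwards [hev] with k hk
  have hG := Real.rpow_mul_exp_neg_le_Gamma hk hR0
  have hG0 := Real.Gamma_pos_of_pos (zero_lt_one.trans_le hk)
  have hpow : R ^ (α * k + β - 1) = (2 * (|r| + 1)) ^ k * R ^ (β - 1) := by
    rw [add_sub_assoc, Real.rpow_add hR0, Real.rpow_mul hR0.le, hRα, Real.rpow_natCast]
  have hinv : R ^ (1 - β) * R ^ (β - 1) = 1 := by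
    rw [← Real.rpow_add hR0]; simp
  have hexp : Real.exp R * Real.exp (-R) = 1 := by
    rw [← Real.exp_add]; simp
  rw [norm_div, norm_pow, Real.norm_eq_abs, Real.norm_eq_abs, abs_of_pos hG0, div_le_iff₀ hG0]
  calc |r| ^ k ≤ (|r| + 1) ^ k := by gcongr; linarith
    _ = Real.exp R * R ^ (1 - β) * (1 / 2) ^ k * (R ^ (α * k + β - 1) * Real.exp (-R)) := by
        have h2 : (1 / 2 : ℝ) ^ k * 2 ^ k = 1 := by rw [← mul_pow]; norm_num
        rw [hpow, mul_pow]
        linear_combination (-(|r| + 1) ^ k) * (hexp + (Real.exp R * Real.exp (-R)) * hinv +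
          (Real.exp R * Real.exp (-R)) * (R ^ (1 - β) * R ^ (β - 1)) * h2)
    _ ≤ _ := by gcongr

theorem mlf_completely_monotone (α β : ℝ) (hα0 : 0 < α) (hα1 : α ≤ 1) (hβ : α ≤ β) :
    ∀ n : ℕ, ∀ t : ℝ, 0 ≤ t →
      0 ≤ (-1) ^ n * iteratedDeriv n (fun t : ℝ => mlfR α β (-t)) t := by
  intro n t ht
  have hterm : ∀ (r : ℝ) (k : ℕ), (k.factorial : ℝ) / Real.Gamma (α * k + β) * r ^ k /
      k.factorial = r ^ k / Real.Gamma (α * k + β) := fun r k => by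
    have : (k.factorial : ℝ) ≠ 0 := by positivity
    field_simp
  have hc : ∀ r : ℝ, Summable fun k : ℕ =>
      (k.factorial : ℝ) / Real.Gamma (α * k + β) * r ^ k / k.factorial := fun r => by
    simpa only [hterm] using summable_pow_div_gamma hα0 (hα0.trans_le hβ) r
  have hfun : (fun t : ℝ => mlfR α β (-t)) = fun t => ∑' k : ℕ,
      (k.factorial : ℝ) / Real.Gamma (α * k + β) * (-t) ^ k / k.factorial := by
    simp only [hterm, mlfR]
  rw [hfun, iteratedDeriv_egf_neg hc n, ← mul_assoc, ← mul_pow, neg_one_mul, neg_neg, one_pow,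
    one_mul]
  exact ((stieltjesPositive_factorial_div_gamma hα0 hα1 hβ).shift n).tsum_nonneg ht
    (summable_shift_egf_iterate hc n _)
end

section
/- (Matrix derooting identity) For every square complex matrix A, every real α > 0, every real β > 0, and every natural number r, one has E_{α,β}(A) = A^r · E_{α, β+αr}(A) + Σ_{k=0}^{r-1} A^k / Γ(αk + β), where the sum is the zero matrix when r = 0. -/
noncomputable def mlfM {n : ℕ} (α β : ℝ) (A : Matrix (Fin n) (Fin n) ℂ) :
    Matrix (Fin n) (Fin n) ℂ :=
  ∑' k : ℕ, (Real.Gamma (α * k + β) : ℂ)⁻¹ • A ^ k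

theorem Real.rpow_sub_two_mul_exp_neg_le_Gamma {R x : ℝ} (hR : 1 ≤ R) (hx : 2 ≤ x) :
    R ^ (x - 2) * Real.exp (-R) ≤ Real.Gamma x := by
  obtain ⟨m, hm⟩ : ∃ m : ℕ, ⌊x⌋₊ = m + 2 :=
    Nat.exists_eq_add_of_le' (Nat.le_floor (by exact_mod_cast hx))
  have hle : (m : ℝ) + 2 ≤ x := by
    have := Nat.floor_le (show 0 ≤ x by linarith)
    rw [hm] at this
    exact_mod_cast this
  have hlt : x < m + 3 := by
    have := Nat.lt_floor_add_one x
    rw [hm] at this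
    push_cast at this
    linarith
  calc R ^ (x - 2) * Real.exp (-R) ≤ R ^ (m + 1) * Real.exp (-R) := by
        gcongr
        rw [← Real.rpow_natCast]
        exact Real.rpow_le_rpow_of_exponent_le hR (by push_cast; linarith)
    _ ≤ (m + 1).factorial := by
        have h := Real.pow_div_factorial_le_exp R (by linarith) (m + 1)
        rw [div_le_iff₀ (by positivity)] at h
        rw [Real.exp_neg, ← div_eq_mul_inv, div_le_iff₀ (Real.exp_pos R)]
        linarith
    _ = Real.Gamma (m + 2) := by
        rw [← Real.Gamma_nat_eq_factorial]
        push_cast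
        congr 1
        ring
    _ ≤ Real.Gamma x :=
        Real.Gamma_strictMonoOn_Ici.monotoneOn (Set.mem_Ici.2 (by linarith [m.cast_nonneg (α := ℝ)]))
          hx hle

theorem summable_inv_Gamma_smul_pow {𝔸 : Type*} [NormedRing 𝔸] [NormedAlgebra ℂ 𝔸]
    [CompleteSpace 𝔸] {α : ℝ} (hα : 0 < α) (β : ℝ) (a : 𝔸) :
    Summable fun k : ℕ => (Real.Gamma (α * k + β) : ℂ)⁻¹ • a ^ k := by
  set M : ℝ := max ‖a‖ 1
  have hM : 1 ≤ M := le_max_right _ _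
  set R : ℝ := (2 * M) ^ α⁻¹
  have hR : 1 ≤ R := Real.one_le_rpow (by linarith) (by positivity)
  have hR0 : 0 < R := by linarith
  have hRα : R ^ α = 2 * M := Real.rpow_inv_rpow (by positivity) hα.ne'
  refine Summable.of_norm_bounded_eventually_nat
    (g := fun k : ℕ => (R ^ (β - 2) * Real.exp (-R))⁻¹ * (1 / 2) ^ k)
    (summable_geometric_two.mul_left _) ?_
  have htend : Filter.Tendsto (fun k : ℕ => α * k + β) Filter.atTop Filter.atTop :=
    Filter.tendsto_atTop_add_const_right _ _
      (tendsto_natCast_atTop_atTop.const_mul_atTop hα)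
  filter_upwards [htend.eventually_ge_atTop 2, Filter.eventually_gt_atTop 0] with k hk hk0
  have hΓ := Real.rpow_sub_two_mul_exp_neg_le_Gamma hR hk
  have hsplit : R ^ (α * k + β - 2) = (2 * M) ^ k * R ^ (β - 2) := by
    rw [add_sub_assoc, Real.rpow_add hR0, Real.rpow_mul hR0.le, hRα, Real.rpow_natCast]
  rw [hsplit] at hΓ
  have hΓ0 : 0 < Real.Gamma (α * k + β) := Real.Gamma_pos_of_pos (by linarith)
  rw [norm_smul, norm_inv, Complex.norm_real, Real.norm_of_nonneg hΓ0.le]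
  calc (Real.Gamma (α * k + β))⁻¹ * ‖a ^ k‖
      ≤ ((2 * M) ^ k * R ^ (β - 2) * Real.exp (-R))⁻¹ * M ^ k := by
        gcongr
        exact (norm_pow_le' a hk0).trans (by gcongr; exact le_max_left _ _)
    _ = (R ^ (β - 2) * Real.exp (-R))⁻¹ * (1 / 2) ^ k := by
        have : M ≠ 0 := by positivity
        rw [mul_pow, one_div, inv_pow]
        field_simp

theorem Matrix.summable_inv_Gamma_smul_pow {n : ℕ} {α : ℝ} (hα : 0 < α) (β : ℝ)
    (A : Matrix (Fin n) (Fin n) ℂ) :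
    Summable fun k : ℕ => (Real.Gamma (α * k + β) : ℂ)⁻¹ • A ^ k := by
  let _ : NormedRing (Matrix (Fin n) (Fin n) ℂ) := Matrix.linftyOpNormedRing
  let _ : NormedAlgebra ℂ (Matrix (Fin n) (Fin n) ℂ) := Matrix.linftyOpNormedAlgebra
  have : CompleteSpace (Matrix (Fin n) (Fin n) ℂ) := FiniteDimensional.complete ℂ _
  exact _root_.summable_inv_Gamma_smul_pow hα β A

theorem mlf_matrix_derooting (n : ℕ) (α β : ℝ) (hα : 0 < α) (hβ : 0 < β)
    (A : Matrix (Fin n) (Fin n) ℂ) (r : ℕ) :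
    mlfM α β A = A ^ r * mlfM α (β + α * r) A
      + ∑ k ∈ Finset.range r, (Real.Gamma (α * k + β) : ℂ)⁻¹ • A ^ k := by
  unfold mlfM
  rw [← (Matrix.summable_inv_Gamma_smul_pow hα β A).sum_add_tsum_nat_add r, add_comm,
    ← (Matrix.summable_inv_Gamma_smul_pow hα (β + α * r) A).tsum_mul_left]
  congr 1
  refine tsum_congr fun k => ?_
  rw [mul_smul_comm, ← pow_add, add_comm r k]
  congr 4
  push_cast
  ring
end
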